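/- arXiv:math/0108212 — 2 statements merged into one kernel-verified Lean document; each statement's English description precedes it below -/
import Mathlib

section
/- Let F ⊂ ℝⁿ be a compact convex set of volume 1, let P be a non-constant polynomial on ℝⁿ of degree at most d, and let M(P) be the unique positive number with Vol{x ∈ F : |P(x)| ≥ M(P)} = 1/e. Let T_d be the Chebyshev polynomial of degree d. Then for every λ > 1: (i) Vol{x ∈ F : |P(x)| > T_d(2λ−1)·M(P)} ≤ e^{−λ}, and (ii) Vol{x ∈ F : |P(x)| < M(P)/T_d(2λ−1)} ≤ 1 − e^{−1/λ}. -/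
open MeasureTheory

/-- The Chebyshev polynomial of degree `d`, for `x ≥ 1` given by
`T_d(x) = (1/2)[(x + √(x²-1))^d + (x - √(x²-1))^d]`. -/
noncomputable def chebyshevT (d : ℕ) (x : ℝ) : ℝ :=
  (1 / 2) * ((x + Real.sqrt (x ^ 2 - 1)) ^ d + (x - Real.sqrt (x ^ 2 - 1)) ^ d)

lemma chebyshevT_eq_eval (d : ℕ) {x : ℝ} (hx : 1 ≤ x) :
    chebyshevT d x = (Polynomial.Chebyshev.T ℝ d).eval x := by
  obtain ⟨θ, hθ, rfl⟩ : ∃ θ : ℝ, 0 ≤ θ ∧ Real.cosh θ = x :=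
    ⟨Real.arcosh x, Real.arcosh_nonneg hx, Real.cosh_arcosh hx⟩
  have hs : Real.sqrt (Real.cosh θ ^ 2 - 1) = Real.sinh θ := by
    rw [← Real.sinh_sq, Real.sqrt_sq (Real.sinh_nonneg_iff.2 hθ)]
  rw [Polynomial.Chebyshev.T_real_cosh, chebyshevT, hs, Real.cosh_add_sinh, Real.cosh_sub_sinh,
    ← Real.exp_nat_mul, ← Real.exp_nat_mul, Real.cosh_eq]
  push_cast
  ring_nf

lemma one_lt_chebyshevT {d : ℕ} (hd : d ≠ 0) {x : ℝ} (hx : 1 < x) : 1 < chebyshevT d x := by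
  rw [chebyshevT_eq_eval d hx.le]
  exact Polynomial.Chebyshev.one_lt_eval_T_real (by exact_mod_cast hd) hx

lemma strictMonoOn_chebyshevT {d : ℕ} (hd : d ≠ 0) :
    StrictMonoOn (chebyshevT d) (Set.Ici 1) := by
  intro x hx y hy hxy
  rw [Set.mem_Ici] at hx hy
  rw [chebyshevT_eq_eval d hx, chebyshevT_eq_eval d hy]
  rw [← Real.cosh_arcosh hx, ← Real.cosh_arcosh hy] at hxy ⊢
  rw [Polynomial.Chebyshev.T_real_cosh, Polynomial.Chebyshev.T_real_cosh, Real.cosh_lt_cosh,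
    abs_mul, abs_mul]
  rw [Real.cosh_lt_cosh] at hxy
  have : (0 : ℝ) < |((d : ℤ) : ℝ)| := by simpa using Nat.pos_of_ne_zero hd
  gcongr

lemma Polynomial.eval_eq_sum_lagrange {d : ℕ} {p : Polynomial ℝ} (hp : p.natDegree ≤ d)
    {v : ℕ → ℝ} (hv : Set.InjOn v (Finset.range (d + 1))) (x : ℝ) :
    p.eval x = ∑ k ∈ Finset.range (d + 1),
      p.eval (v k) * ∏ j ∈ (Finset.range (d + 1)).erase k, (x - v j) / (v k - v j) := by
  have hdeg : p.degree < ((Finset.range (d + 1)).card : ℕ) := by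
    rw [Finset.card_range]
    refine lt_of_le_of_lt Polynomial.degree_le_natDegree ?_
    exact_mod_cast Nat.lt_succ_of_le hp
  conv_lhs => rw [Lagrange.eq_interpolate hv hdeg]
  rw [Lagrange.interpolate_apply, Polynomial.eval_finsetSum]
  refine Finset.sum_congr rfl fun k _ => ?_
  rw [Polynomial.eval_mul, Polynomial.eval_C, Lagrange.basis, Polynomial.eval_prod]
  congr 1
  refine Finset.prod_congr rfl fun j _ => ?_
  simp [Lagrange.basisDivisor, div_eq_inv_mul]

open Polynomial.Chebyshev in
lemma chebyshevT_eq_sum (d : ℕ) {ξ : ℝ} (hξ : 1 ≤ ξ) :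
    chebyshevT d ξ = ∑ k ∈ Finset.range (d + 1),
      ∏ j ∈ (Finset.range (d + 1)).erase k, (ξ + node d j) / |node d k - node d j| := by
  have hpar : chebyshevT d ξ = (-1) ^ d * (T ℝ d).eval (-ξ) := by
    rw [chebyshevT_eq_eval d hξ, T_eval_neg, ← mul_assoc]
    simp [Int.negOnePow, ← mul_pow]
  have hdeg : (T ℝ (d : ℤ)).natDegree ≤ d := by simp
  rw [hpar, Polynomial.eval_eq_sum_lagrange hdeg (strictAntiOn_node d).injOn, Finset.mul_sum]
  refine Finset.sum_congr rfl fun k hk => ?_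
  have hk' : k ≤ d := Finset.mem_range_succ_iff.1 hk
  rw [eval_T_real_node (by simpa using hk'), Finset.prod_div_distrib, Finset.prod_div_distrib,
    ← Finset.abs_prod]
  have hpos := zero_lt_prod_node_sub_node (n := d) hk'
  have hnum : ∏ j ∈ (Finset.range (d + 1)).erase k, (-ξ - node d j) =
      (-1) ^ d * ∏ j ∈ (Finset.range (d + 1)).erase k, (ξ + node d j) := by
    have hcard : ((Finset.range (d + 1)).erase k).card = d := by
      rw [Finset.card_erase_of_mem hk]; simp
    have hconst : (-1 : ℝ) ^ d = ∏ _j ∈ (Finset.range (d + 1)).erase k, (-1 : ℝ) := by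
      rw [Finset.prod_const, hcard]
    rw [hconst, ← Finset.prod_mul_distrib]
    refine Finset.prod_congr rfl fun j _ => ?_
    ring
  rw [hnum]
  set Q := ∏ j ∈ (Finset.range (d + 1)).erase k, (node d k - node d j)
  have habs : |Q| = (-1) ^ k * Q := by
    rw [← abs_of_pos hpos, abs_mul]; simp
  have h1 : ((-1 : ℝ) ^ d) * (-1) ^ d = 1 := by rw [← mul_pow]; simp
  have h2 : ((-1 : ℝ) ^ k)⁻¹ = (-1) ^ k := by rw [← inv_pow]; norm_num
  rw [habs, div_eq_mul_inv, div_eq_mul_inv, mul_inv, h2]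
  linear_combination (-1) ^ k * (∏ j ∈ (Finset.range (d + 1)).erase k, (ξ + node d j)) * Q⁻¹ * h1

lemma exists_mem_volume_inter_Icc_eq {E : Set ℝ} (hE : IsClosed E) {x y v : ℝ} (hxy : x ≤ y)
    (hv0 : 0 < v) (hv : v ≤ volume.real (E ∩ Set.Icc x y)) :
    ∃ z ∈ E ∩ Set.Icc x y, volume.real (E ∩ Set.Icc x z) = v := by
  have hfin : ∀ a b : ℝ, volume (E ∩ Set.Icc a b) ≠ ⊤ := fun a b =>
    measure_ne_top_of_subset Set.inter_subset_right (by simp)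
  have hlip : ∀ a b : ℝ, a ≤ b →
      volume.real (E ∩ Set.Icc x b) ≤ volume.real (E ∩ Set.Icc x a) + (b - a) := by
    intro a b hab
    have hsub : E ∩ Set.Icc x b ⊆ (E ∩ Set.Icc x a) ∪ Set.Icc a b := by
      rintro u ⟨hu, hu1, hu2⟩
      rcases le_total u a with h | h
      · exact Or.inl ⟨hu, hu1, h⟩
      · exact Or.inr ⟨h, hu2⟩
    calc volume.real (E ∩ Set.Icc x b) ≤ volume.real ((E ∩ Set.Icc x a) ∪ Set.Icc a b) :=
          measureReal_mono hsub (measure_union_ne_top (hfin _ _) (by simp))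
      _ ≤ volume.real (E ∩ Set.Icc x a) + volume.real (Set.Icc a b) := measureReal_union_le _ _
      _ = _ := by rw [Real.volume_real_Icc_of_le hab]
  have hmono : Monotone fun b => volume.real (E ∩ Set.Icc x b) := by
    intro a b hab
    refine measureReal_mono ?_ (hfin _ _)
    exact Set.inter_subset_inter_right _ (Set.Icc_subset_Icc_right hab)
  have hcont : Continuous fun b => volume.real (E ∩ Set.Icc x b) := by
    refine LipschitzWith.continuous (K := 1) (LipschitzWith.of_le_add fun a b => ?_)
    rcases le_total a b with h | h
    · exact (hmono h).trans (by simp)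
    · simpa [Real.dist_eq, abs_of_nonneg (sub_nonneg.2 h)] using hlip b a h
  have h0 : volume.real (E ∩ Set.Icc x x) = 0 := by
    rw [measureReal_def, measure_mono_null Set.inter_subset_right (by simp)]; rfl
  obtain ⟨t, ht, htv⟩ := intermediate_value_Icc hxy hcont.continuousOn
    (show v ∈ Set.Icc _ _ from ⟨by rw [h0]; exact hv0.le, hv⟩)
  simp only at htv
  have hne : (E ∩ Set.Icc x t).Nonempty := by
    by_contra hcon
    rw [Set.not_nonempty_iff_eq_empty] at hcon
    rw [hcon] at htv
    simp at htv
    exact hv0.ne htv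
  obtain ⟨z, hz, hzmax⟩ := (isCompact_Icc.inter_left hE).exists_isGreatest hne
  refine ⟨z, ⟨hz.1, hz.2.1, hz.2.2.trans ht.2⟩, ?_⟩
  rw [← htv]
  congr 1
  ext u
  constructor
  · exact fun hu => ⟨hu.1, hu.2.1, hu.2.2.trans hz.2.2⟩
  · exact fun hu => ⟨hu.1, hu.2.1, hzmax hu⟩

open Polynomial.Chebyshev in
/-- Remez' inequality at the left endpoint of an interval. -/
lemma abs_eval_left_le_chebyshevT {d : ℕ} {p : Polynomial ℝ} (hp : p.natDegree ≤ d)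
    {m : ℝ} {E : Set ℝ} (hE : IsClosed E) (hm : ∀ x ∈ E, |p.eval x| ≤ m) {x y lam : ℝ}
    (hxy : x < y) (hlam : 1 ≤ lam) (h : (y - x) / lam < volume.real (E ∩ Set.Icc x y)) :
    |p.eval x| ≤ chebyshevT d (2 * lam - 1) * m := by
  set s := (y - x) / lam with hs
  have hlam0 : 0 < lam := by linarith
  have hs0 : 0 < s := div_pos (by linarith) hlam0
  have hsl : s * lam = y - x := by rw [hs]; field_simp
  have hc : ∀ k, node d k ∈ Set.Icc (-1 : ℝ) 1 := fun k => node_mem_Icc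
  have hex : ∀ k, ∃ z ∈ E ∩ Set.Icc x y, volume.real (E ∩ Set.Icc x z) =
      volume.real (E ∩ Set.Icc x y) - s * (1 - node d k) / 2 := by
    intro k
    have h1 := (hc k).1
    have h2 := (hc k).2
    exact exists_mem_volume_inter_Icc_eq hE hxy.le (by nlinarith) (by nlinarith)
  choose v hvmem hv using hex
  have hfin : ∀ a b : ℝ, volume (E ∩ Set.Icc a b) ≠ ⊤ := fun a b =>
    measure_ne_top_of_subset Set.inter_subset_right (by simp)
  have hlip : ∀ a b : ℝ, a ≤ b →
      volume.real (E ∩ Set.Icc x b) ≤ volume.real (E ∩ Set.Icc x a) + (b - a) := by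
    intro a b hab
    have hsub : E ∩ Set.Icc x b ⊆ (E ∩ Set.Icc x a) ∪ Set.Icc a b := by
      rintro u ⟨hu, hu1, hu2⟩
      rcases le_total u a with h | h
      · exact Or.inl ⟨hu, hu1, h⟩
      · exact Or.inr ⟨h, hu2⟩
    calc volume.real (E ∩ Set.Icc x b) ≤ volume.real ((E ∩ Set.Icc x a) ∪ Set.Icc a b) :=
          measureReal_mono hsub (measure_union_ne_top (hfin _ _) (by simp))
      _ ≤ volume.real (E ∩ Set.Icc x a) + volume.real (Set.Icc a b) := measureReal_union_le _ _
      _ = _ := by rw [Real.volume_real_Icc_of_le hab]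
  have hmono : Monotone fun b => volume.real (E ∩ Set.Icc x b) := by
    intro a b hab
    refine measureReal_mono ?_ (hfin _ _)
    exact Set.inter_subset_inter_right _ (Set.Icc_subset_Icc_right hab)
  have hdist : ∀ j k, s * |node d k - node d j| / 2 ≤ |v k - v j| := by
    have hlip' : ∀ a b : ℝ, |volume.real (E ∩ Set.Icc x b) - volume.real (E ∩ Set.Icc x a)| ≤
        |b - a| := by
      intro a b
      rcases le_total a b with hab | hab
      · rw [abs_of_nonneg (sub_nonneg.2 (hmono hab)), abs_of_nonneg (sub_nonneg.2 hab)]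
        linarith [hlip a b hab]
      · rw [abs_of_nonpos (sub_nonpos.2 (hmono hab)), abs_of_nonpos (sub_nonpos.2 hab)]
        linarith [hlip b a hab]
    intro j k
    refine le_trans (le_of_eq ?_) (hlip' (v j) (v k))
    rw [hv, hv, show ∀ a b c : ℝ, a - s * (1 - b) / 2 - (a - s * (1 - c) / 2) =
      s / 2 * (b - c) by intros; ring, abs_mul, abs_of_pos (show 0 < s / 2 by positivity)]
    ring
  have hpos : ∀ j, v j - x ≤ s / 2 * ((2 * lam - 1) + node d j) := by
    intro j
    have h1 := hlip (v j) y (hvmem j).2.2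
    rw [hv] at h1
    nlinarith
  have hne : ∀ k ∈ Finset.range (d + 1), ∀ j ∈ (Finset.range (d + 1)).erase k,
      0 < |node d k - node d j| := by
    intro k hk j hj
    rw [Finset.mem_erase] at hj
    rw [abs_pos, sub_ne_zero]
    intro heq
    exact hj.1 ((strictAntiOn_node d).injOn hk hj.2 heq).symm
  have hinj : Set.InjOn v (Finset.range (d + 1)) := by
    intro k hk j hj hkj
    by_contra hcon
    have h1 := hne k hk j (Finset.mem_erase.2 ⟨Ne.symm hcon, hj⟩)
    have h2 := hdist j k
    rw [hkj, sub_self, abs_zero] at h2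
    nlinarith
  have hm0 : 0 ≤ m := (abs_nonneg _).trans (hm _ (hvmem 0).1)
  rw [Polynomial.eval_eq_sum_lagrange hp hinj, chebyshevT_eq_sum d (by linarith), Finset.sum_mul]
  refine (Finset.abs_sum_le_sum_abs _ _).trans (Finset.sum_le_sum fun k hk => ?_)
  rw [abs_mul, mul_comm, Finset.abs_prod]
  refine mul_le_mul ?_ (hm _ (hvmem k).1) (abs_nonneg _) ?_
  · refine Finset.prod_le_prod (fun _ _ => abs_nonneg _) fun j hj => ?_
    have h1 := hne k hk j hj
    have h2 := hdist j k
    have h3 := hpos j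
    have h4 := (hvmem j).2.1
    have h5 : 0 < s * |node d k - node d j| / 2 := by positivity
    rw [abs_div, abs_sub_comm, abs_of_nonneg (by linarith), div_le_div_iff₀ (by linarith) h1]
    calc (v j - x) * |node d k - node d j|
        ≤ (s / 2 * ((2 * lam - 1) + node d j)) * |node d k - node d j| := by gcongr
      _ = ((2 * lam - 1) + node d j) * (s * |node d k - node d j| / 2) := by ring
      _ ≤ ((2 * lam - 1) + node d j) * |v k - v j| := by
          have := (hc j).1
          gcongr
          linarith
  · refine Finset.prod_nonneg fun j _ => div_nonneg ?_ (abs_nonneg _)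
    have := (hc j).1
    linarith

/-- Remez' inequality at the right endpoint of an interval. -/
lemma abs_eval_right_le_chebyshevT {d : ℕ} {p : Polynomial ℝ} (hp : p.natDegree ≤ d)
    {m : ℝ} {E : Set ℝ} (hE : IsClosed E) (hm : ∀ x ∈ E, |p.eval x| ≤ m) {x y lam : ℝ}
    (hxy : x < y) (hlam : 1 ≤ lam) (h : (y - x) / lam < volume.real (E ∩ Set.Icc x y)) :
    |p.eval y| ≤ chebyshevT d (2 * lam - 1) * m := by
  have := abs_eval_left_le_chebyshevT (d := d) (p := p.comp (-Polynomial.X)) (x := -y) (y := -x)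
    (E := -E) (lam := lam) (m := m) ?_ hE.neg ?_ (by linarith) hlam ?_
  · simpa using this
  · rw [Polynomial.natDegree_comp]; simpa using hp
  · intro u hu; simpa using hm (-u) hu
  · have e : (-E) ∩ Set.Icc (-y) (-x) = -(E ∩ Set.Icc x y) := by
      rw [Set.inter_neg]; simp
    rw [e, measureReal_def, Measure.measure_neg, ← measureReal_def]
    convert h using 2
    ring

section PrekopaLeindler

open scoped ENNReal Pointwise

/-- One-dimensional Brunn–Minkowski inequality. -/
lemma volume_add_volume_le {A B C : Set ℝ} (hA : MeasurableSet A) (hB : MeasurableSet B)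
    (hAne : A.Nonempty) (hBne : B.Nonempty) (h : ∀ a ∈ A, ∀ b ∈ B, a + b ∈ C) :
    volume A + volume B ≤ volume C := by
  have hvadd : ∀ (c : ℝ) (S : Set ℝ), volume ((fun x => c + x) '' S) = volume S := by
    intro c S
    rw [Set.image_add_left, measure_preimage_add]
  have key : ∀ K₁ ⊆ A, ∀ K₂ ⊆ B, IsCompact K₁ → IsCompact K₂ →
      volume K₁ + volume K₂ ≤ volume C := by
    intro K₁ hK₁ K₂ hK₂ hc₁ hc₂
    rcases K₁.eq_empty_or_nonempty with rfl | hne₁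
    · obtain ⟨a, ha⟩ := hAne
      rw [measure_empty, zero_add, ← hvadd a]
      refine measure_mono ?_
      rintro _ ⟨b, hb, rfl⟩
      exact h a ha b (hK₂ hb)
    rcases K₂.eq_empty_or_nonempty with rfl | hne₂
    · obtain ⟨b, hb⟩ := hBne
      rw [measure_empty, add_zero, ← hvadd b]
      refine measure_mono ?_
      rintro _ ⟨a, ha, rfl⟩
      simpa [add_comm] using h a (hK₁ ha) b hb
    obtain ⟨p, hp, hpmax⟩ := hc₁.exists_isGreatest hne₁
    obtain ⟨q, hq, hqmin⟩ := hc₂.exists_isLeast hne₂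
    rw [← hvadd q K₁, ← hvadd p K₂, ← measure_union_add_inter _
      (hc₂.image (f := fun x => p + x) (continuous_const.add continuous_id)).measurableSet]
    have hinter : (fun x => q + x) '' K₁ ∩ (fun x => p + x) '' K₂ ⊆ {p + q} := by
      rintro x ⟨⟨a, ha, rfl⟩, ⟨b, hb, hab⟩⟩
      have h1 := hpmax ha
      have h2 := hqmin hb
      simp only [Set.mem_singleton_iff]
      simp only at hab
      linarith
    rw [measure_mono_null hinter (by simp), add_zero]
    refine measure_mono ?_
    rintro x (⟨a, ha, rfl⟩ | ⟨b, hb, rfl⟩)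
    · simpa [add_comm] using h a (hK₁ ha) q (hK₂ hq)
    · exact h p (hK₁ hp) b (hK₂ hb)
  rw [hA.measure_eq_iSup_isCompact, hB.measure_eq_iSup_isCompact]
  simp_rw [iSup_and']
  refine ENNReal.biSup_add_biSup_le' (p := fun K => K ⊆ A ∧ IsCompact K)
    (q := fun K => K ⊆ B ∧ IsCompact K) ⟨∅, by simp⟩ ⟨∅, by simp⟩ ?_
  intro K₁ h₁ K₂ h₂
  exact key K₁ h₁.1 K₂ h₂.1 h₁.2 h₂.2

/-- The Prékopa–Leindler inequality with weight `t` for the measure `μ`. -/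
def IsPrekopaLeindler {E : Type*} [AddCommGroup E] [Module ℝ E] [MeasurableSpace E]
    (μ : Measure E) (t : ℝ) : Prop :=
  ∀ f g h : E → ℝ≥0∞, Measurable f → Measurable g → Measurable h →
    (∀ x y, f x ^ (1 - t) * g y ^ t ≤ h ((1 - t) • x + t • y)) →
    (∫⁻ x, f x ∂μ) ^ (1 - t) * (∫⁻ x, g x ∂μ) ^ t ≤ ∫⁻ x, h x ∂μ

lemma IsPrekopaLeindler.prod {E F : Type*} [AddCommGroup E] [Module ℝ E] [MeasurableSpace E]
    [AddCommGroup F] [Module ℝ F] [MeasurableSpace F] {μ : Measure E} {ν : Measure F}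
    [SFinite μ] [SFinite ν] {t : ℝ} (hμ : IsPrekopaLeindler μ t) (hν : IsPrekopaLeindler ν t) :
    IsPrekopaLeindler (μ.prod ν) t := by
  intro f g h hf hg hh H
  rw [lintegral_prod _ hf.aemeasurable, lintegral_prod _ hg.aemeasurable,
    lintegral_prod _ hh.aemeasurable]
  refine hμ _ _ _ hf.lintegral_prod_right' hg.lintegral_prod_right' hh.lintegral_prod_right' ?_
  intro x x'
  refine hν _ _ _ (hf.comp measurable_prodMk_left) (hg.comp measurable_prodMk_left)
    (hh.comp measurable_prodMk_left) ?_
  intro y y'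
  exact H (x, y) (x', y')

lemma ENNReal.rpow_mul_rpow_le_add {t : ℝ} (ht0 : 0 < t) (ht1 : t < 1) (a b : ℝ≥0∞) :
    a ^ (1 - t) * b ^ t ≤ ENNReal.ofReal (1 - t) * a + ENNReal.ofReal t * b := by
  have h1 : (0 : ℝ) < 1 - t := by linarith
  rcases eq_or_ne a ⊤ with rfl | ha
  · rw [ENNReal.mul_top (by simpa using h1), top_add]; exact le_top
  rcases eq_or_ne b ⊤ with rfl | hb
  · rw [ENNReal.mul_top (by simpa using ht0), add_top]; exact le_top
  lift a to NNReal using ha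
  lift b to NNReal using hb
  rw [← ENNReal.coe_rpow_of_nonneg _ h1.le, ← ENNReal.coe_rpow_of_nonneg _ ht0.le,
    ENNReal.ofReal, ENNReal.ofReal]
  norm_cast
  have := NNReal.geom_mean_le_arith_mean2_weighted (1 - t).toNNReal t.toNNReal a b
    (by rw [← Real.toNNReal_add h1.le ht0.le]; simp)
  simpa [h1.le, ht0.le] using this

lemma lintegral_eq_lintegral_meas_lt_of_le_one {α : Type*} [MeasurableSpace α] (μ : Measure α)
    {f : α → ℝ≥0∞} (hf : Measurable f) (h1 : ∀ x, f x ≤ 1) :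
    ∫⁻ x, f x ∂μ = ∫⁻ s in Set.Ioo (0 : ℝ) 1, μ {x | ENNReal.ofReal s < f x} := by
  have hfin : ∀ x, f x ≠ ⊤ := fun x => ne_top_of_le_ne_top ENNReal.one_ne_top (h1 x)
  have e1 : ∫⁻ x, f x ∂μ = ∫⁻ x, ENNReal.ofReal (f x).toReal ∂μ := by
    simp_rw [ENNReal.ofReal_toReal (hfin _)]
  rw [e1, lintegral_eq_lintegral_meas_lt μ (Filter.Eventually.of_forall fun x => by simp)
    hf.ennreal_toReal.aemeasurable]
  have hsplit : Set.Ioi (0 : ℝ) = Set.Ioo 0 1 ∪ Set.Ici 1 := by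
    rw [Set.Ioo_union_Ici_eq_Ioi one_pos]
  have hdis : Disjoint (Set.Ioo (0 : ℝ) 1) (Set.Ici 1) := by
    rw [Set.disjoint_left]; intro x hx hx'; exact absurd hx.2 (not_lt.2 hx')
  rw [hsplit, lintegral_union measurableSet_Ici hdis]
  have hz : ∫⁻ s in Set.Ici (1 : ℝ), μ {a | s < (f a).toReal} = 0 := by
    rw [setLIntegral_congr_fun measurableSet_Ici (g := fun _ => 0)]
    · simp
    · intro s hs
      simp only
      convert measure_empty (μ := μ)
      ext x
      simp only [Set.mem_ofPred_eq, Set.mem_empty_iff_false, iff_false, not_lt]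
      exact (ENNReal.toReal_mono ENNReal.one_ne_top (h1 x)).trans (by simpa using hs)
  rw [hz, add_zero]
  refine setLIntegral_congr_fun measurableSet_Ioo ?_
  intro s hs
  simp only
  congr 1
  ext x
  simp only [Set.mem_ofPred_eq]
  rw [ENNReal.ofReal_lt_iff_lt_toReal hs.1.le (hfin x)]

lemma lintegral_add_le_of_le_one {t : ℝ} (ht0 : 0 < t) (ht1 : t < 1) {f g h : ℝ → ℝ≥0∞}
    (hf : Measurable f) (hg : Measurable g) (hh : Measurable h)
    (H : ∀ x y, f x ^ (1 - t) * g y ^ t ≤ h ((1 - t) • x + t • y))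
    (hf1 : ⨆ x, f x = 1) (hg1 : ⨆ x, g x = 1) :
    ENNReal.ofReal (1 - t) * (∫⁻ x, f x) + ENNReal.ofReal t * (∫⁻ x, g x) ≤ ∫⁻ x, h x := by
  have h1t : (0 : ℝ) < 1 - t := by linarith
  have hfle : ∀ x, f x ≤ 1 := fun x => hf1 ▸ le_iSup f x
  have hgle : ∀ x, g x ≤ 1 := fun x => hg1 ▸ le_iSup g x
  have hmin : ∫⁻ x, min (h x) 1 ≤ ∫⁻ x, h x := lintegral_mono fun x => min_le_left _ _
  refine le_trans ?_ hmin
  rw [lintegral_eq_lintegral_meas_lt_of_le_one _ hf hfle,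
    lintegral_eq_lintegral_meas_lt_of_le_one _ hg hgle,
    lintegral_eq_lintegral_meas_lt_of_le_one _ (hh.min measurable_const) fun x => min_le_right _ _]
  have hanti : ∀ u : ℝ → ℝ≥0∞, Measurable fun s : ℝ => volume {x | ENNReal.ofReal s < u x} := by
    intro u
    refine Antitone.measurable fun s s' hs => measure_mono fun x hx => ?_
    exact lt_of_le_of_lt (ENNReal.ofReal_le_ofReal hs) hx
  rw [← lintegral_const_mul _ (hanti f), ← lintegral_const_mul _ (hanti g),
    ← lintegral_add_left ((hanti f).const_mul _)]
  refine setLIntegral_mono' measurableSet_Ioo ?_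
  intro s hs
  have hs1 : ENNReal.ofReal s < 1 := by simpa using hs.2
  have hs0 : ENNReal.ofReal s ≠ 0 := by simpa using hs.1
  have hsT : ENNReal.ofReal s ≠ ⊤ := ENNReal.ofReal_ne_top
  have e : ∀ (c : ℝ) (hc : 0 < c) (S : Set ℝ),
      ENNReal.ofReal c * volume S = volume ((fun x => c * x) '' S) := by
    intro c hc S
    have := Measure.addHaar_smul (volume : Measure ℝ) c S
    rw [show (fun x => c * x) '' S = c • S from rfl, this]
    simp [abs_of_pos hc]
  rw [e _ h1t, e _ ht0]
  obtain ⟨x₀, hx₀⟩ := lt_iSup_iff.1 (hf1 ▸ hs1)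
  obtain ⟨y₀, hy₀⟩ := lt_iSup_iff.1 (hg1 ▸ hs1)
  have hm : ∀ (c : ℝ) (hc : 0 < c) (S : Set ℝ), MeasurableSet S →
      MeasurableSet ((fun x => c * x) '' S) := by
    intro c hc S hS
    exact (measurableEmbedding_mulLeft₀ hc.ne').measurableSet_image.2 hS
  refine volume_add_volume_le (hm _ h1t _ (measurableSet_lt measurable_const hf))
    (hm _ ht0 _ (measurableSet_lt measurable_const hg)) ⟨_, x₀, hx₀, rfl⟩ ⟨_, y₀, hy₀, rfl⟩ ?_
  rintro _ ⟨x, hx, rfl⟩ _ ⟨y, hy, rfl⟩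
  simp only [Set.mem_ofPred_eq] at hx hy ⊢
  rw [lt_min_iff]
  refine ⟨lt_of_lt_of_le ?_ (H x y), hs1⟩
  calc ENNReal.ofReal s = ENNReal.ofReal s ^ (1 - t) * ENNReal.ofReal s ^ t := by
        rw [← ENNReal.rpow_add _ _ hs0 hsT]; simp
    _ < f x ^ (1 - t) * g y ^ t :=
        ENNReal.mul_lt_mul (ENNReal.rpow_lt_rpow hx h1t) (ENNReal.rpow_lt_rpow hy ht0)

lemma isPrekopaLeindler_bounded {t : ℝ} (ht0 : 0 < t) (ht1 : t < 1) {f g h : ℝ → ℝ≥0∞}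
    (hf : Measurable f) (hg : Measurable g) (hh : Measurable h)
    (H : ∀ x y, f x ^ (1 - t) * g y ^ t ≤ h ((1 - t) • x + t • y))
    (hfT : ⨆ x, f x ≠ ⊤) (hgT : ⨆ x, g x ≠ ⊤) :
    (∫⁻ x, f x) ^ (1 - t) * (∫⁻ x, g x) ^ t ≤ ∫⁻ x, h x := by
  have h1t : (0 : ℝ) < 1 - t := by linarith
  set a := ⨆ x, f x with ha
  set b := ⨆ x, g x with hb
  rcases eq_or_ne a 0 with ha0 | ha0
  · have : ∀ x, f x = 0 := by simpa [ha, ENNReal.iSup_eq_zero] using ha0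
    simp [this, h1t]
  rcases eq_or_ne b 0 with hb0 | hb0
  · have : ∀ x, g x = 0 := by simpa [hb, ENNReal.iSup_eq_zero] using hb0
    simp [this, ht0]
  set c := a ^ (1 - t) * b ^ t with hc
  have hc0 : c ≠ 0 := by simp [hc, ENNReal.rpow_eq_zero_iff, ha0, hb0, hfT, hgT]
  have hcT : c ≠ ⊤ :=
    ENNReal.mul_ne_top (ENNReal.rpow_ne_top_of_nonneg h1t.le hfT)
      (ENNReal.rpow_ne_top_of_nonneg ht0.le hgT)
  have hcinv : c⁻¹ = a⁻¹ ^ (1 - t) * b⁻¹ ^ t := by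
    rw [hc, ENNReal.mul_inv (Or.inr (ENNReal.rpow_ne_top_of_nonneg ht0.le hgT))
      (Or.inl (ENNReal.rpow_ne_top_of_nonneg h1t.le hfT)), ENNReal.inv_rpow, ENNReal.inv_rpow]
  have key := lintegral_add_le_of_le_one ht0 ht1 (f := fun x => a⁻¹ * f x)
    (g := fun x => b⁻¹ * g x) (h := fun x => c⁻¹ * h x) (hf.const_mul _) (hg.const_mul _)
    (hh.const_mul _) ?_ ?_ ?_
  · rw [lintegral_const_mul _ hf, lintegral_const_mul _ hg, lintegral_const_mul _ hh] at key
    have key2 := (ENNReal.rpow_mul_rpow_le_add ht0 ht1 _ _).trans key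
    rw [ENNReal.mul_rpow_of_nonneg _ _ h1t.le, ENNReal.mul_rpow_of_nonneg _ _ ht0.le,
      mul_mul_mul_comm, ← hcinv] at key2
    exact (ENNReal.mul_le_mul_iff_right (ENNReal.inv_ne_zero.2 hcT)
      (ENNReal.inv_ne_top.2 hc0)).1 key2
  · intro x y
    rw [ENNReal.mul_rpow_of_nonneg _ _ h1t.le, ENNReal.mul_rpow_of_nonneg _ _ ht0.le,
      mul_mul_mul_comm, ← hcinv]
    exact mul_le_mul_right (H x y) _
  · rw [← ENNReal.mul_iSup, ENNReal.inv_mul_cancel ha0 hfT]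
  · rw [← ENNReal.mul_iSup, ENNReal.inv_mul_cancel hb0 hgT]

lemma isPrekopaLeindler_real {t : ℝ} (ht0 : 0 < t) (ht1 : t < 1) :
    IsPrekopaLeindler (volume : Measure ℝ) t := by
  intro f g h hf hg hh H
  have h1t : (0 : ℝ) < 1 - t := by linarith
  rcases eq_or_ne (∫⁻ x, f x) 0 with hf0 | hf0
  · simp [hf0, h1t]
  rcases eq_or_ne (∫⁻ x, g x) 0 with hg0 | hg0
  · simp [hg0, ht0]
  have hlim : ∀ u : ℝ → ℝ≥0∞, Measurable u →
      Filter.Tendsto (fun N : ℕ => ∫⁻ x, min (u x) N) Filter.atTop (nhds (∫⁻ x, u x)) := by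
    intro u hu
    refine lintegral_tendsto_of_tendsto_of_monotone
      (fun N => (hu.min measurable_const).aemeasurable) ?_ ?_
    · exact Filter.Eventually.of_forall fun x N N' hN => min_le_min_left _ (by exact_mod_cast hN)
    · refine Filter.Eventually.of_forall fun x => ?_
      simpa using (tendsto_const_nhds (x := u x)).min ENNReal.tendsto_nat_nhds_top
  have hbd : ∀ (u : ℝ → ℝ≥0∞) (N : ℕ), ⨆ x, min (u x) (N : ℝ≥0∞) ≠ ⊤ := fun u N =>
    ne_top_of_le_ne_top (ENNReal.natCast_ne_top N) (iSup_le fun x => min_le_right _ _)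
  have hT := ENNReal.Tendsto.mul ((hlim f hf).ennrpow_const (1 - t))
    (Or.inl (by simp [ENNReal.rpow_eq_zero_iff, hf0]; intro; linarith))
    ((hlim g hg).ennrpow_const t)
    (Or.inl (by simp [ENNReal.rpow_eq_zero_iff, hg0, ht0.le]))
  refine le_of_tendsto' hT fun N => ?_
  refine isPrekopaLeindler_bounded ht0 ht1 (hf.min measurable_const) (hg.min measurable_const) hh
    ?_ (hbd f N) (hbd g N)
  intro x y
  refine le_trans ?_ (H x y)
  gcongr <;> exact min_le_left _ _

lemma isPrekopaLeindler_pi {t : ℝ} (ht0 : 0 < t) (ht1 : t < 1) (n : ℕ) :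
    IsPrekopaLeindler (volume : Measure (Fin n → ℝ)) t := by
  induction n with
  | zero =>
    intro f g h hf hg hh H
    have e : ∀ u : (Fin 0 → ℝ) → ℝ≥0∞, ∫⁻ x, u x = u 0 := by
      intro u
      rw [volume_pi, Measure.pi_of_empty (fun _ : Fin 0 => (volume : Measure ℝ)) 0]
      simp
    rw [e, e, e]
    simpa using H 0 0
  | succ n ih =>
    have hP := (isPrekopaLeindler_real ht0 ht1).prod ih
    intro f g h hf hg hh H
    set φ := MeasurableEquiv.piFinSuccAbove (fun _ : Fin (n + 1) => ℝ) 0 with hφ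
    have hmp := (volume_preserving_piFinSuccAbove (fun _ : Fin (n + 1) => ℝ) 0).symm
    have e : ∀ u : (Fin (n + 1) → ℝ) → ℝ≥0∞, Measurable u →
        ∫⁻ x, u x = ∫⁻ y, u (φ.symm y) ∂((volume : Measure ℝ).prod volume) := by
      intro u hu
      exact (hmp.lintegral_comp hu).symm
    rw [e f hf, e g hg, e h hh]
    refine hP _ _ _ (hf.comp φ.symm.measurable) (hg.comp φ.symm.measurable)
      (hh.comp φ.symm.measurable) ?_
    intro x y
    convert H (φ.symm x) (φ.symm y) using 2
    ext i
    refine Fin.cases ?_ (fun j => ?_) i <;>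
    simp [hφ, MeasurableEquiv.piFinSuccAbove, Fin.insertNthEquiv]

end PrekopaLeindler

section OneDimensional

lemma one_sub_rpow_le {r v δ : ℝ} (hr : 0 < r) (hr1 : r < 1) (hrv : r ≤ v) (hv : v ≤ 1)
    (hδ0 : 0 ≤ δ) (hδ1 : δ ≤ 1) :
    1 - v ^ δ ≤ (1 - r ^ δ) / (1 - r) * (1 - v) := by
  have h1r : 0 < 1 - r := by linarith
  have ha : 0 ≤ (1 - v) / (1 - r) := div_nonneg (by linarith) h1r.le
  have hb : 0 ≤ (v - r) / (1 - r) := div_nonneg (by linarith) h1r.le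
  have hc := (Real.concaveOn_rpow hδ0 hδ1).2 (Set.mem_Ici.2 hr.le)
    (Set.mem_Ici.2 zero_le_one) ha hb (by field_simp; ring)
  have e : (1 - v) / (1 - r) * r + (v - r) / (1 - r) * 1 = v := by field_simp; ring
  simp only [smul_eq_mul, Real.one_rpow] at hc
  rw [e] at hc
  have e2 : (1 - r ^ δ) / (1 - r) * (1 - v) =
      1 - ((1 - v) / (1 - r) * r ^ δ + (v - r) / (1 - r) * 1) := by field_simp; ring
  linarith

/-- The measure of `E` between two points is controlled by the measures of the two rays
to the right of these points. -/
def RightTailBound (μ : Measure ℝ) (E B : Set ℝ) (δ : ℝ) : Prop :=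
  ∀ z, ∀ y ∈ B, z ≤ y → μ.real (E ∩ Set.Ioc z y) ≤
    μ.real (Set.Ioi z) - μ.real (Set.Ioi y) ^ δ * μ.real (Set.Ioi z) ^ (1 - δ)

/-- The measure of `E` between two points is controlled by the measures of the two rays
to the left of these points. -/
def LeftTailBound (μ : Measure ℝ) (E B : Set ℝ) (δ : ℝ) : Prop :=
  ∀ z, ∀ y ∈ B, y ≤ z → μ.real (E ∩ Set.Ioc y z) ≤
    μ.real (Set.Iic z) - μ.real (Set.Iic y) ^ δ * μ.real (Set.Iic z) ^ (1 - δ)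

lemma sub_rpow_mul_rpow_le {r δ u w : ℝ} (hr : 0 < r) (hr1 : r < 1) (hδ0 : 0 < δ) (hδ1 : δ < 1)
    (hu : 0 ≤ u) (huw : w ≤ u) (hw : r * u ≤ w) :
    u - w ^ δ * u ^ (1 - δ) ≤ (1 - r ^ δ) / (1 - r) * (u - w) := by
  rcases hu.eq_or_lt with rfl | hu
  · have : w = 0 := by linarith
    simp [this, hδ0.ne']
  · have hw0 : 0 ≤ w := by nlinarith
    have h := one_sub_rpow_le hr hr1 (v := w / u) (by rwa [le_div_iff₀ hu]) (by rwa [div_le_one hu])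
      hδ0.le hδ1.le
    rw [Real.div_rpow hw0 hu.le] at h
    rw [Real.rpow_sub hu, Real.rpow_one]
    have := mul_le_mul_of_nonneg_right h hu.le
    have hud : 0 < u ^ δ := by positivity
    calc u - w ^ δ * (u / u ^ δ) = (1 - w ^ δ / u ^ δ) * u := by field_simp
      _ ≤ (1 - r ^ δ) / (1 - r) * (1 - w / u) * u := this
      _ = (1 - r ^ δ) / (1 - r) * (u - w) := by
        rw [mul_assoc]; congr 1; field_simp

lemma continuous_measureReal_inter_Iic {μ : Measure ℝ} [IsFiniteMeasure μ] {C : NNReal}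
    (hC : μ ≤ C • volume) (S : Set ℝ) : Continuous fun y => μ.real (S ∩ Set.Iic y) := by
  refine LipschitzWith.continuous (K := C) (LipschitzWith.of_le_add_mul C fun a b => ?_)
  have h1 : S ∩ Set.Iic a ⊆ (S ∩ Set.Iic b) ∪ Set.Ioc b a := by
    rintro x ⟨hx, hxa⟩
    rcases le_or_gt x b with h | h
    · exact Or.inl ⟨hx, h⟩
    · exact Or.inr ⟨h, hxa⟩
  refine (measureReal_mono h1).trans ((measureReal_union_le _ _).trans ?_)
  gcongr
  have h2 : μ (Set.Ioc b a) ≤ C * ENNReal.ofReal (a - b) := by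
    refine (hC _).trans ?_
    rw [Measure.smul_apply, Real.volume_Ioc]; rfl
  have h3 : ((C : ENNReal) * ENNReal.ofReal (a - b)) ≠ ⊤ :=
    ENNReal.mul_ne_top ENNReal.coe_ne_top ENNReal.ofReal_ne_top
  refine (ENNReal.toReal_mono h3 h2).trans ?_
  rw [ENNReal.toReal_mul, ENNReal.coe_toReal]
  gcongr
  rw [Real.dist_eq]
  exact ENNReal.toReal_le_of_le_ofReal (abs_nonneg _) (ENNReal.ofReal_le_ofReal (le_abs_self _))

lemma measureReal_singleton_eq_zero {μ : Measure ℝ} {C : NNReal} (hC : μ ≤ C • volume) (x : ℝ) :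
    μ.real {x} = 0 := by
  have : μ {x} ≤ 0 := (hC _).trans (by simp)
  simp [measureReal_def, nonpos_iff_eq_zero.1 this]

variable {μ : Measure ℝ} [IsProbabilityMeasure μ] {C : NNReal} {E B : Set ℝ} {δ : ℝ}

lemma RightTailBound.measureReal_gap_le (hC : μ ≤ C • volume) (h : RightTailBound μ E B δ)
    (hr : 0 < μ.real B) (hr1 : μ.real B < 1) (hδ0 : 0 < δ) (hδ1 : δ < 1) {z y : ℝ} (hy : y ∈ B)
    (hzy : z ≤ y) (hgap : B ∩ Set.Ioo z y = ∅)
    (hf : μ.real (B ∩ Set.Iic z) ≤ μ.real B * μ.real (Set.Iic z)) :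
    μ.real (E ∩ Set.Ioc z y) ≤
      (1 - μ.real B ^ δ) / (1 - μ.real B) * μ.real (Set.Ioc z y) := by
  have e1 : μ.real (Set.Ioc z y) = μ.real (Set.Ioi z) - μ.real (Set.Ioi y) := by
    rw [← Set.Ioi_sdiff_Ioi, measureReal_sdiff (Set.Ioi_subset_Ioi hzy) measurableSet_Ioi]
  have e2 : μ.real (Set.Iic z) = 1 - μ.real (Set.Ioi z) := by
    rw [← Set.compl_Ioi, probReal_compl_eq_one_sub measurableSet_Ioi]
  have e3 : B ⊆ B ∩ Set.Iic z ∪ Set.Ioi y ∪ {y} := by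
    intro x hx
    rcases le_or_gt x z with hxz | hxz
    · exact Or.inl (Or.inl ⟨hx, hxz⟩)
    rcases lt_trichotomy x y with hxy | hxy | hxy
    · exact absurd (show x ∈ B ∩ Set.Ioo z y from ⟨hx, hxz, hxy⟩) (by simp [hgap])
    · exact Or.inr hxy
    · exact Or.inl (Or.inr hxy)
  have e4 := (measureReal_mono (μ := μ) e3).trans (measureReal_union_le _ _)
  have e5 := measureReal_union_le (μ := μ) (B ∩ Set.Iic z) (Set.Ioi y)
  rw [measureReal_singleton_eq_zero hC] at e4
  refine (h z y hy hzy).trans ?_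
  rw [e1]
  refine sub_rpow_mul_rpow_le hr hr1 hδ0 hδ1 measureReal_nonneg
    (measureReal_mono (Set.Ioi_subset_Ioi hzy)) ?_
  rw [e2] at hf
  linarith

lemma LeftTailBound.measureReal_gap_le (h : LeftTailBound μ E B δ) (hr : 0 < μ.real B)
    (hr1 : μ.real B < 1) (hδ0 : 0 < δ) (hδ1 : δ < 1) {z y : ℝ} (hy : y ∈ B)
    (hzy : y ≤ z) (hgap : B ∩ Set.Ioc y z = ∅)
    (hf : μ.real B * μ.real (Set.Iic z) ≤ μ.real (B ∩ Set.Iic z)) :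
    μ.real (E ∩ Set.Ioc y z) ≤
      (1 - μ.real B ^ δ) / (1 - μ.real B) * μ.real (Set.Ioc y z) := by
  have e1 : μ.real (Set.Ioc y z) = μ.real (Set.Iic z) - μ.real (Set.Iic y) := by
    rw [← Set.Iic_sdiff_Iic, measureReal_sdiff (Set.Iic_subset_Iic.2 hzy) measurableSet_Iic]
  have e3 : B ∩ Set.Iic z ⊆ Set.Iic y := by
    rintro x ⟨hx, hxz⟩
    by_contra hxy
    exact absurd (show x ∈ B ∩ Set.Ioc y z from ⟨hx, not_le.1 hxy, hxz⟩) (by simp [hgap])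
  have e4 := measureReal_mono (μ := μ) e3
  refine (h z y hy hzy).trans ?_
  rw [e1]
  exact sub_rpow_mul_rpow_le hr hr1 hδ0 hδ1 measureReal_nonneg
    (measureReal_mono (Set.Iic_subset_Iic.2 hzy)) (hf.trans e4)

lemma measureReal_le_of_tailBound (hC : μ ≤ C • volume) {a b : ℝ} (hab : a ≤ b)
    (hμ : μ (Set.Icc a b)ᶜ = 0) (hE : IsCompact E) (hB : IsCompact B) (hEab : E ⊆ Set.Icc a b)
    (hBab : B ⊆ Set.Icc a b) (hEB : Disjoint E B) (hδ0 : 0 < δ) (hδ1 : δ < 1)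
    (hR : RightTailBound μ E B δ) (hL : LeftTailBound μ E B δ) :
    μ.real E ≤ 1 - μ.real B ^ δ := by
  have hEm := hE.measurableSet
  have hBm := hB.measurableSet
  have hadd : μ.real E + μ.real B ≤ 1 := by
    rw [← measureReal_union hEB hBm]; exact measureReal_le_one
  rcases (measureReal_nonneg (μ := μ) (s := B)).eq_or_lt with hr | hr
  · rw [← hr, Real.zero_rpow hδ0.ne', sub_zero]
    exact measureReal_le_one
  rcases (measureReal_le_one (μ := μ) (s := B)).eq_or_lt with hr1 | hr1
  · rw [hr1, Real.one_rpow]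
    linarith
  set r := μ.real B with hrdef
  set κ := (1 - r ^ δ) / (1 - r) with hκ
  have hκ0 : 0 ≤ κ :=
    div_nonneg (sub_nonneg.2 (Real.rpow_le_one hr.le hr1.le hδ0.le)) (by linarith)
  have hsplit : ∀ (S : Set ℝ) (x y : ℝ), MeasurableSet S → x ≤ y →
      μ.real (S ∩ Set.Iic y) = μ.real (S ∩ Set.Iic x) + μ.real (S ∩ Set.Ioc x y) := by
    intro S x y hS hxy
    rw [← measureReal_union ?_ (hS.inter measurableSet_Ioc), ← Set.inter_union_distrib_left,
      Set.Iic_union_Ioc_eq_Iic hxy]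
    exact ((Set.Iic_disjoint_Ioc le_rfl).mono Set.inter_subset_right Set.inter_subset_right)
  have hcont := fun S => continuous_measureReal_inter_Iic hC S
  have hIic0 : μ.real (Set.Iic a) = 0 := by
    have h1 : Set.Iic a ⊆ (Set.Icc a b)ᶜ ∪ {a} := by
      intro x hx
      rcases (Set.mem_Iic.1 hx).eq_or_lt with rfl | h
      · exact Or.inr rfl
      · exact Or.inl fun h' => absurd h'.1 (not_le.2 h)
    have h2 := (measureReal_mono (μ := μ) h1).trans (measureReal_union_le _ _)
    rw [measureReal_singleton_eq_zero hC, measureReal_def (s := (Set.Icc a b)ᶜ), hμ] at h2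
    exact le_antisymm (by simpa using h2) measureReal_nonneg
  have hIic0' : ∀ S : Set ℝ, μ.real (S ∩ Set.Iic a) = 0 := fun S =>
    le_antisymm (hIic0 ▸ measureReal_mono Set.inter_subset_right) measureReal_nonneg
  set f : ℝ → ℝ := fun y => μ.real (B ∩ Set.Iic y) - r * μ.real (Set.univ ∩ Set.Iic y) with hf
  set ψ : ℝ → ℝ := fun y => μ.real (E ∩ Set.Iic y) - κ * μ.real (Bᶜ ∩ Set.Iic y) with hψ
  have hfc : Continuous f := (hcont B).sub (continuous_const.mul (hcont _))
  have hψc : Continuous ψ := (hcont E).sub (continuous_const.mul (hcont _))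
  have hBb : B ∩ Set.Iic b = B := Set.inter_eq_left.2 fun x hx => (hBab hx).2
  have hEb : E ∩ Set.Iic b = E := Set.inter_eq_left.2 fun x hx => (hEab hx).2
  have hfb : 0 ≤ f b := by
    simp only [hf, hBb, ← hrdef]
    nlinarith [measureReal_le_one (μ := μ) (s := Set.univ ∩ Set.Iic b)]
  have hψa : ψ a = 0 := by simp [hψ, hIic0']
  have hfa : f a = 0 := by simp only [hf, hIic0']; simp
  have hψE : ∀ x y, x ≤ y → E ∩ Set.Ioc x y = ∅ → ψ y ≤ ψ x := by
    intro x y hxy h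
    simp only [hψ]
    rw [hsplit E x y hEm hxy, hsplit _ x y hBm.compl hxy, h]
    simp only [measureReal_empty, add_zero]
    nlinarith [measureReal_nonneg (μ := μ) (s := Bᶜ ∩ Set.Ioc x y)]
  have hψκ : ∀ x y, x ≤ y → B ∩ Set.Ioo x y = ∅ →
      μ.real (E ∩ Set.Ioc x y) ≤ κ * μ.real (Set.Ioc x y) → ψ y ≤ ψ x := by
    intro x y hxy h hle
    have h1 : Set.Ioc x y ⊆ Bᶜ ∩ Set.Ioc x y ∪ {y} := by
      intro u hu
      rcases hu.2.eq_or_lt with rfl | huy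
      · exact Or.inr rfl
      · refine Or.inl ⟨fun huB => ?_, hu⟩
        exact absurd (show u ∈ B ∩ Set.Ioo x y from ⟨huB, hu.1, huy⟩) (by simp [h])
    have h2 := (measureReal_mono (μ := μ) h1).trans (measureReal_union_le _ _)
    rw [measureReal_singleton_eq_zero hC, add_zero] at h2
    simp only [hψ]
    rw [hsplit E x y hEm hxy, hsplit _ x y hBm.compl hxy]
    nlinarith [mul_le_mul_of_nonneg_left h2 hκ0]
  have hψb : ψ b ≤ 0 := by
    by_contra! hpos
    set D := {y ∈ Set.Icc a b | y ∈ B ∨ 0 ≤ f y} with hD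
    have hDc : IsCompact D := isCompact_Icc.inter_right
      (hB.isClosed.union (isClosed_le continuous_const hfc))
    obtain ⟨y, ⟨hyD, hyψ⟩, hymin⟩ := (hDc.inter_right
      (isClosed_le (continuous_const (y := ψ b)) hψc)).exists_isLeast
      ⟨b, ⟨⟨hab, le_rfl⟩, Or.inr hfb⟩, le_refl (ψ b)⟩
    simp only [Set.mem_ofPred_eq] at hyψ
    have hmin : ∀ x ∈ D, ψ b ≤ ψ x → y ≤ x := fun x hx hx' => hymin ⟨hx, hx'⟩
    have hay : a < y := by
      refine lt_of_le_of_ne hyD.1.1 ?_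
      rintro rfl
      linarith
    by_cases hyB : y ∈ B
    · have hne : (E ∩ Set.Icc a y).Nonempty := by
        by_contra hcon
        rw [Set.not_nonempty_iff_eq_empty] at hcon
        have := hψE a y hay.le (Set.eq_empty_of_subset_empty
          ((Set.inter_subset_inter_right _ Set.Ioc_subset_Icc_self).trans hcon.subset))
        linarith
      obtain ⟨e, ⟨heE, he⟩, hemax⟩ := (hE.inter_right isClosed_Icc).exists_isGreatest hne
      have hey : e < y := lt_of_le_of_ne he.2 fun h =>
        Set.disjoint_left.1 hEB heE (h ▸ hyB)
      have hEgap : ∀ u, e ≤ u → u ≤ y → ψ y ≤ ψ u := by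
        intro u hu huy
        refine hψE u y huy (Set.eq_empty_of_forall_notMem ?_)
        rintro x ⟨hxE, hx⟩
        have hxe : x ≤ e := hemax ⟨hxE, he.1.trans (hu.trans hx.1.le), hx.2⟩
        linarith [hx.1]
      have hnotD : ∀ u, e ≤ u → u < y → u ∉ D := fun u hu huy huD => by
        have := hmin u huD (hyψ.trans (hEgap u hu huy.le))
        linarith
      have hDa : (D ∩ Set.Icc a e).Nonempty :=
        ⟨a, ⟨⟨le_rfl, hab⟩, Or.inr hfa.ge⟩, le_rfl, he.1⟩
      obtain ⟨z, ⟨hzD, hz⟩, hzmax⟩ := (hDc.inter_right isClosed_Icc).exists_isGreatest hDa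
      have hnotD' : ∀ u, z < u → u < y → u ∉ D := by
        intro u hzu huy huD
        rcases le_or_gt u e with hue | hue
        · have : u ≤ z := hzmax ⟨huD, huD.1.1, hue⟩
          linarith
        · exact hnotD u hue.le huy huD
      have hIab : ∀ u, z < u → u < y → u ∈ Set.Icc a b := fun u h1 h2 =>
        ⟨hz.1.trans h1.le, h2.le.trans hyD.1.2⟩
      have hzy : z < y := hz.2.trans_lt hey
      have hfz : f z ≤ 0 := by
        refine le_of_tendsto (hfc.continuousWithinAt (s := Set.Ioi z)) ?_
        filter_upwards [Ioo_mem_nhdsGT hzy] with u hu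
        by_contra! hcon
        exact hnotD' u hu.1 hu.2 ⟨hIab u hu.1 hu.2, Or.inr hcon.le⟩
      have hgap : B ∩ Set.Ioo z y = ∅ := Set.eq_empty_of_forall_notMem fun u hu =>
        hnotD' u hu.2.1 hu.2.2 ⟨hIab u hu.2.1 hu.2.2, Or.inl hu.1⟩
      have h1 := hψκ z y hzy.le hgap (hR.measureReal_gap_le hC hr hr1 hδ0 hδ1 hyB hzy.le hgap
        (by simpa [hf] using hfz))
      have := hmin z hzD (hyψ.trans h1)
      linarith
    · have hfy : 0 ≤ f y := hyD.2.resolve_left hyB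
      have hne : (B ∩ Set.Icc a y).Nonempty := by
        by_contra hcon
        rw [Set.not_nonempty_iff_eq_empty] at hcon
        have h1 : B ∩ Set.Iic y = ∅ := Set.eq_empty_of_subset_empty fun x hx =>
          hcon.subset ⟨hx.1, (hBab hx.1).1, hx.2⟩
        simp only [hf, h1, measureReal_empty, zero_sub, Set.univ_inter] at hfy
        have h2 : μ.real (Set.Iic y) = 0 := by
          nlinarith [measureReal_nonneg (μ := μ) (s := Set.Iic y)]
        have h3 : ψ y ≤ 0 := by
          simp only [hψ]
          have h4 : μ.real (E ∩ Set.Iic y) ≤ μ.real (Set.Iic y) :=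
            measureReal_mono Set.inter_subset_right
          nlinarith [measureReal_nonneg (μ := μ) (s := Bᶜ ∩ Set.Iic y)]
        linarith
      obtain ⟨x, ⟨hxB, hx⟩, hxmax⟩ := (hB.inter_right isClosed_Icc).exists_isGreatest hne
      have hgap : B ∩ Set.Ioc x y = ∅ := Set.eq_empty_of_forall_notMem fun u hu => by
        have : u ≤ x := hxmax ⟨hu.1, hx.1.trans hu.2.1.le, hu.2.2⟩
        linarith [hu.2.1]
      have h1 := hψκ x y hx.2 (Set.eq_empty_of_subset_empty
          ((Set.inter_subset_inter_right _ Set.Ioo_subset_Ioc_self).trans hgap.subset))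
        (hL.measureReal_gap_le hr hr1 hδ0 hδ1 hxB hx.2 hgap (by simpa [hf] using hfy))
      have := hmin x ⟨⟨hx.1, hx.2.trans hyD.1.2⟩, Or.inl hxB⟩ (hyψ.trans h1)
      exact hyB (le_antisymm this hx.2 ▸ hxB)
  have h1 : μ.real (Bᶜ ∩ Set.Iic b) ≤ 1 - r := by
    rw [hrdef, ← probReal_compl_eq_one_sub hBm]
    exact measureReal_mono Set.inter_subset_left
  have h2 : μ.real E ≤ κ * μ.real (Bᶜ ∩ Set.Iic b) := by
    have := hψb
    simp only [hψ, hEb] at this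
    linarith
  have h3 : κ * (1 - r) = 1 - r ^ δ := by
    rw [hκ, div_mul_cancel₀]; linarith
  nlinarith [mul_le_mul_of_nonneg_left h1 hκ0]

end OneDimensional

section Hazard

/-- A bounded integrable density on the line satisfying the four point inequality implied by
log-concavity. -/
structure IsLogConcaveDensity (ρ : ℝ → ℝ) (C : NNReal) : Prop where
  measurable : Measurable ρ
  nonneg : ∀ x, 0 ≤ ρ x
  le_const : ∀ x, ρ x ≤ C
  integrable : Integrable ρ
  mul_le_mul : ∀ x y s, x ≤ y → 0 ≤ s → ρ x * ρ (y + s) ≤ ρ y * ρ (x + s)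

variable {ρ : ℝ → ℝ} {C : NNReal}

lemma IsLogConcaveDensity.comp_neg (h : IsLogConcaveDensity ρ C) :
    IsLogConcaveDensity (fun x => ρ (-x)) C where
  measurable := h.measurable.comp measurable_neg
  nonneg x := h.nonneg _
  le_const x := h.le_const _
  integrable := h.integrable.comp_neg
  mul_le_mul x y s hxy hs := by
    have := h.mul_le_mul (-(y + s)) (-(x + s)) s (by linarith) hs
    rw [show -(x + s) + s = -x by ring, show -(y + s) + s = -y by ring] at this
    linarith

/-- The integral of `ρ` over a right ray. -/
noncomputable def rightTail (ρ : ℝ → ℝ) (y : ℝ) : ℝ := ∫ t in Set.Ioi y, ρ t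

lemma IsLogConcaveDensity.mul_rightTail_le (h : IsLogConcaveDensity ρ C) {x y : ℝ} (hxy : x ≤ y) :
    ρ x * rightTail ρ y ≤ ρ y * rightTail ρ x := by
  have e : ∀ z, rightTail ρ z = ∫ s in Set.Ioi 0, ρ (z + s) := by
    intro z
    have := (measurePreserving_add_left volume z).setIntegral_preimage_emb
      (measurableEmbedding_addLeft z) ρ (Set.Ioi z)
    rw [rightTail, ← this]
    simp
  rw [e, e, ← integral_const_mul, ← integral_const_mul]
  have hi : ∀ c z, IntegrableOn (fun s => c * ρ (z + s)) (Set.Ioi 0) := fun c z =>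
    ((h.integrable.comp_add_left z).const_mul c).integrableOn
  exact setIntegral_mono_on (hi _ _) (hi _ _) measurableSet_Ioi
    fun s hs => h.mul_le_mul x y s hxy (le_of_lt hs)

lemma IsLogConcaveDensity.rightTail_sub (h : IsLogConcaveDensity ρ C) {x y : ℝ} (hxy : x ≤ y) :
    rightTail ρ x - rightTail ρ y = ∫ t in Set.Ioc x y, ρ t := by
  rw [rightTail, rightTail, ← Set.Ioc_union_Ioi_eq_Ioi hxy,
    setIntegral_union Set.Ioc_disjoint_Ioi_same measurableSet_Ioi h.integrable.integrableOn
      h.integrable.integrableOn]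
  ring

lemma IsLogConcaveDensity.rightTail_antitone (h : IsLogConcaveDensity ρ C) :
    Antitone (rightTail ρ) := fun x y hxy => by
  have := h.rightTail_sub hxy
  have h2 : 0 ≤ ∫ t in Set.Ioc x y, ρ t := integral_nonneg fun t => h.nonneg t
  linarith

lemma IsLogConcaveDensity.rightTail_nonneg (h : IsLogConcaveDensity ρ C) (x : ℝ) :
    0 ≤ rightTail ρ x := integral_nonneg fun t => h.nonneg t

lemma IsLogConcaveDensity.abs_rightTail_sub_le (h : IsLogConcaveDensity ρ C) {x y : ℝ}
    (hxy : x ≤ y) : rightTail ρ x - rightTail ρ y ≤ C * (y - x) := by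
  rw [h.rightTail_sub hxy]
  have : ∫ t in Set.Ioc x y, ρ t ≤ ∫ t in Set.Ioc x y, (C : ℝ) :=
    setIntegral_mono_on h.integrable.integrableOn (integrable_const _) measurableSet_Ioc
      fun t _ => h.le_const t
  simpa [hxy, mul_comm] using this

lemma IsLogConcaveDensity.lipschitzWith_rightTail (h : IsLogConcaveDensity ρ C) :
    LipschitzWith C (rightTail ρ) := by
  refine LipschitzWith.of_le_add_mul C fun x y => ?_
  rcases le_total x y with hxy | hxy
  · have := h.abs_rightTail_sub_le hxy
    rw [Real.dist_eq, abs_sub_comm, abs_of_nonneg (sub_nonneg.2 hxy)]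
    linarith
  · have := h.rightTail_antitone hxy
    have h2 : 0 ≤ C * dist x y := by positivity
    linarith

lemma IsLogConcaveDensity.integral_div_rightTail (h : IsLogConcaveDensity ρ C) {z y : ℝ}
    (hzy : z ≤ y) (hy : 0 < rightTail ρ y) :
    ∫ t in Set.Ioc z y, ρ t / rightTail ρ t =
      Real.log (rightTail ρ z) - Real.log (rightTail ρ y) := by
  have hpos : ∀ t ∈ Set.uIcc z y, rightTail ρ y ≤ rightTail ρ t := fun t ht => by
    rw [Set.uIcc_of_le hzy] at ht
    exact h.rightTail_antitone ht.2
  have hlip : LipschitzOnWith ((rightTail ρ y).toNNReal⁻¹ * C)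
      (fun t => Real.log (rightTail ρ t)) (Set.uIcc z y) := by
    refine LipschitzOnWith.of_le_add_mul _ fun u hu v hv => ?_
    have h1 := hpos u hu
    have h2 := hpos v hv
    have hv0 := hy.trans_le h2
    have h3 : Real.log (rightTail ρ u) - Real.log (rightTail ρ v) ≤
        rightTail ρ u / rightTail ρ v - 1 := by
      rw [← Real.log_div (hy.trans_le h1).ne' hv0.ne']
      exact Real.log_le_sub_one_of_pos (div_pos (hy.trans_le h1) hv0)
    have h4 : rightTail ρ u / rightTail ρ v - 1 ≤ (rightTail ρ y)⁻¹ * (C * dist u v) := by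
      have h5 := h.lipschitzWith_rightTail.dist_le_mul u v
      have h6 : rightTail ρ u - rightTail ρ v ≤ C * dist u v := (le_abs_self _).trans h5
      have h7 : (0 : ℝ) ≤ C * dist u v := by positivity
      calc rightTail ρ u / rightTail ρ v - 1
          = (rightTail ρ v)⁻¹ * (rightTail ρ u - rightTail ρ v) := by field_simp
        _ ≤ (rightTail ρ v)⁻¹ * (C * dist u v) := by gcongr
        _ ≤ _ := by gcongr
    rw [NNReal.coe_mul, NNReal.coe_inv, Real.coe_toNNReal _ hy.le]
    linarith
  have hac := hlip.absolutelyContinuousOnInterval.integral_deriv_eq_sub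
  rw [← intervalIntegral.integral_of_le hzy]
  have hd : ∀ᵐ t, t ∈ Set.uIoc z y →
      ρ t / rightTail ρ t = -deriv (fun t => Real.log (rightTail ρ t)) t := by
    filter_upwards [LocallyIntegrable.ae_hasDerivAt_integral h.integrable.locallyIntegrable]
      with t ht htz
    have ht' := ht z
    have e : rightTail ρ = fun u => rightTail ρ z - ∫ s in z..u, ρ s := by
      funext u
      rcases le_total z u with hu | hu
      · rw [intervalIntegral.integral_of_le hu, ← h.rightTail_sub hu]; ring
      · rw [intervalIntegral.integral_of_ge hu, ← h.rightTail_sub hu]; ring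
    have h1 : HasDerivAt (rightTail ρ) (-ρ t) t := by
      rw [e]; simpa using ht'.const_sub (rightTail ρ z)
    have h2 : rightTail ρ t ≠ 0 := (hy.trans_le (hpos t (Set.uIoc_subset_uIcc htz))).ne'
    rw [(h1.log h2).deriv, neg_div, neg_neg]
  rw [intervalIntegral.integral_congr_ae hd, intervalIntegral.integral_neg, hac]
  ring

lemma setLIntegral_le_of_monotoneOn {h : ℝ → ℝ} {z y : ℝ} (hm : Measurable h)
    (h0 : ∀ t, 0 ≤ h t) (hmono : MonotoneOn h (Set.Ioc z y)) {E : Set ℝ} {δ : ℝ} (hδ : 0 ≤ δ)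
    (hE : ∀ u ≤ y, volume (E ∩ Set.Icc u y) ≤ ENNReal.ofReal (δ * (y - u))) :
    ∫⁻ t in E ∩ Set.Ioc z y, ENNReal.ofReal (h t) ≤
      ENNReal.ofReal δ * ∫⁻ t in Set.Ioc z y, ENNReal.ofReal (h t) := by
  rw [lintegral_eq_lintegral_meas_lt _ (Filter.Eventually.of_forall h0) hm.aemeasurable,
    lintegral_eq_lintegral_meas_lt _ (Filter.Eventually.of_forall h0) hm.aemeasurable,
    ← lintegral_const_mul' _ _ ENNReal.ofReal_ne_top]
  refine lintegral_mono fun s => ?_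
  have hms : MeasurableSet {t | s < h t} := measurableSet_lt measurable_const hm
  rw [Measure.restrict_apply hms, Measure.restrict_apply hms]
  set S := {t | s < h t} ∩ Set.Ioc z y with hS
  rcases S.eq_empty_or_nonempty with hS0 | hSne
  · have : {t | s < h t} ∩ (E ∩ Set.Ioc z y) = ∅ :=
      Set.eq_empty_of_subset_empty fun t ht => hS0.subset ⟨ht.1, ht.2.2⟩
    simp [this]
  have hbdd : BddBelow S := ⟨z, fun t ht => ht.2.1.le⟩
  have huy : sInf S ≤ y := by
    obtain ⟨t, ht⟩ := hSne
    exact (csInf_le hbdd ht).trans ht.2.2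
  have h1 : Set.Ioc (sInf S) y ⊆ S := by
    intro t ht
    obtain ⟨v, hv, hvt⟩ := exists_lt_of_csInf_lt hSne ht.1
    have htm : t ∈ Set.Ioc z y := ⟨hv.2.1.trans hvt, ht.2⟩
    exact ⟨lt_of_lt_of_le hv.1 (hmono hv.2 htm hvt.le), htm⟩
  have h2 : {t | s < h t} ∩ (E ∩ Set.Ioc z y) ⊆ E ∩ Set.Icc (sInf S) y := fun t ht =>
    ⟨ht.2.1, csInf_le hbdd ⟨ht.1, ht.2.2⟩, ht.2.2.2⟩
  calc volume ({t | s < h t} ∩ (E ∩ Set.Ioc z y)) ≤ ENNReal.ofReal (δ * (y - sInf S)) :=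
        (measure_mono h2).trans (hE _ huy)
    _ = ENNReal.ofReal δ * volume (Set.Ioc (sInf S) y) := by
        rw [Real.volume_Ioc, ENNReal.ofReal_mul hδ]
    _ ≤ _ := by gcongr

lemma IsLogConcaveDensity.setIntegral_le (h : IsLogConcaveDensity ρ C) {E : Set ℝ}
    (hEm : MeasurableSet E) {δ : ℝ} (hδ0 : 0 < δ) (hδ1 : δ < 1) {z y : ℝ} (hzy : z ≤ y)
    (hE : ∀ u ≤ y, volume (E ∩ Set.Icc u y) ≤ ENNReal.ofReal (δ * (y - u))) :
    ∫ t in E ∩ Set.Ioc z y, ρ t ≤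
      rightTail ρ z - rightTail ρ y ^ δ * rightTail ρ z ^ (1 - δ) := by
  rcases (h.rightTail_nonneg y).eq_or_lt with hy | hy
  · rw [← hy, Real.zero_rpow hδ0.ne', zero_mul, sub_zero]
    exact setIntegral_mono_set h.integrable.integrableOn
      (Filter.Eventually.of_forall h.nonneg) (Filter.Eventually.of_forall fun t ht => ht.2.1)
  have hz : rightTail ρ y ≤ rightTail ρ z := h.rightTail_antitone hzy
  have hz0 := hy.trans_le hz
  set k : ℝ → ℝ := fun t => ρ t / rightTail ρ t with hk
  have hRc : Continuous (rightTail ρ) := h.lipschitzWith_rightTail.continuous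
  have hkm : Measurable k := h.measurable.div hRc.measurable
  have hk0 : ∀ t, 0 ≤ k t := fun t => div_nonneg (h.nonneg t) (h.rightTail_nonneg t)
  have hRpos : ∀ t ≤ y, 0 < rightTail ρ t := fun t ht => hy.trans_le (h.rightTail_antitone ht)
  have hkmono : MonotoneOn k (Set.Ioc z y) := by
    intro u hu v hv huv
    simp only [hk]
    rw [div_le_div_iff₀ (hRpos u hu.2) (hRpos v hv.2)]
    exact h.mul_rightTail_le huv
  have hki : IntegrableOn k (Set.Ioc z y) := by
    refine Measure.integrableOn_of_bounded (M := C / rightTail ρ y) (by simp)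
      hkm.aestronglyMeasurable ?_
    filter_upwards [ae_restrict_mem measurableSet_Ioc] with t ht
    rw [Real.norm_of_nonneg (hk0 t)]
    exact div_le_div₀ C.2 (h.le_const t) hy (h.rightTail_antitone ht.2)
  have hcake := setLIntegral_le_of_monotoneOn hkm hk0 hkmono hδ0.le hE
  have hcake' : ∫ t in E ∩ Set.Ioc z y, k t ≤ δ * ∫ t in Set.Ioc z y, k t := by
    rw [← ofReal_integral_eq_lintegral_ofReal (hki.mono_set Set.inter_subset_right)
      (Filter.Eventually.of_forall hk0), ← ofReal_integral_eq_lintegral_ofReal hki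
      (Filter.Eventually.of_forall hk0), ← ENNReal.ofReal_mul hδ0.le] at hcake
    exact (ENNReal.ofReal_le_ofReal_iff (mul_nonneg hδ0.le (integral_nonneg hk0))).1 hcake
  obtain ⟨c, hc, hcR⟩ := intermediate_value_Icc' hzy hRc.continuousOn
    (show rightTail ρ y ^ δ * rightTail ρ z ^ (1 - δ) ∈ Set.Icc (rightTail ρ y) (rightTail ρ z) by
      have e : ∀ u : ℝ, 0 < u → u ^ δ * u ^ (1 - δ) = u := fun u hu => by
        rw [← Real.rpow_add hu]; simp
      constructor
      · calc rightTail ρ y = rightTail ρ y ^ δ * rightTail ρ y ^ (1 - δ) := (e _ hy).symm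
          _ ≤ _ := by gcongr
      · calc _ ≤ rightTail ρ z ^ δ * rightTail ρ z ^ (1 - δ) := by gcongr
          _ = rightTail ρ z := e _ hz0)
  have hkc : ∫ t in Set.Ioc z c, k t = δ * ∫ t in Set.Ioc z y, k t := by
    rw [h.integral_div_rightTail hc.1 (hRpos c hc.2), h.integral_div_rightTail hzy hy, hcR,
      Real.log_mul (by positivity) (by positivity), Real.log_rpow hy, Real.log_rpow hz0]
    ring
  rw [← hcR, h.rightTail_sub hc.1]
  set g : ℝ → ℝ := fun t => ρ t - rightTail ρ c * k t with hg
  have hgi : IntegrableOn g (Set.Ioc z y) := h.integrable.integrableOn.sub (hki.const_mul _)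
  have hsubc : Set.Ioc z c ⊆ Set.Ioc z y := Set.Ioc_subset_Ioc_right hc.2
  have hgE : ∫ t in E ∩ Set.Ioc z y, g t ≤ ∫ t in Set.Ioc z c, g t := by
    rw [← integral_indicator (hEm.inter measurableSet_Ioc), ← integral_indicator measurableSet_Ioc]
    refine integral_mono ((integrable_indicator_iff (hEm.inter measurableSet_Ioc)).2
      (hgi.mono_set Set.inter_subset_right)) ((integrable_indicator_iff measurableSet_Ioc).2
      (hgi.mono_set hsubc)) fun t => ?_
    have hgt : t ≤ y → g t = k t * (rightTail ρ t - rightTail ρ c) := fun hty => by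
      have := (hRpos t hty).ne'
      simp only [hg, hk]; field_simp
    by_cases htE : t ∈ E ∩ Set.Ioc z y <;> by_cases htc : t ∈ Set.Ioc z c
    · simp [htE, htc]
    · rw [Set.indicator_of_mem htE, Set.indicator_of_notMem htc, hgt htE.2.2]
      have : c ≤ t := by
        by_contra! hcon
        exact htc ⟨htE.2.1, hcon.le⟩
      exact mul_nonpos_of_nonneg_of_nonpos (hk0 t) (sub_nonpos.2 (h.rightTail_antitone this))
    · rw [Set.indicator_of_notMem htE, Set.indicator_of_mem htc, hgt (htc.2.trans hc.2)]
      exact mul_nonneg (hk0 t) (sub_nonneg.2 (h.rightTail_antitone htc.2))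
    · simp [htE, htc]
  simp only [hg] at hgE
  rw [integral_sub h.integrable.integrableOn ((hki.mono_set Set.inter_subset_right).const_mul _),
    integral_sub h.integrable.integrableOn ((hki.mono_set hsubc).const_mul _),
    integral_const_mul, integral_const_mul] at hgE
  have := mul_le_mul_of_nonneg_left (hcake'.trans hkc.ge) (h.rightTail_nonneg c)
  linarith

end Hazard

section PolynomialLine

variable {ρ : ℝ → ℝ} {C : NNReal}

lemma IsLogConcaveDensity.measureReal_withDensity (h : IsLogConcaveDensity ρ C) {S : Set ℝ}
    (hS : MeasurableSet S) :
    (volume.withDensity fun x => ENNReal.ofReal (ρ x)).real S = ∫ x in S, ρ x := by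
  rw [measureReal_def, withDensity_apply _ hS, ← ofReal_integral_eq_lintegral_ofReal
    h.integrable.integrableOn (Filter.Eventually.of_forall h.nonneg),
    ENNReal.toReal_ofReal (integral_nonneg h.nonneg)]

lemma IsLogConcaveDensity.rightTailBound (h : IsLogConcaveDensity ρ C) {E B : Set ℝ}
    (hEm : MeasurableSet E) {δ : ℝ} (hδ0 : 0 < δ) (hδ1 : δ < 1)
    (hE : ∀ y ∈ B, ∀ u ≤ y, volume (E ∩ Set.Icc u y) ≤ ENNReal.ofReal (δ * (y - u))) :
    RightTailBound (volume.withDensity fun x => ENNReal.ofReal (ρ x)) E B δ := by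
  intro z y hy hzy
  rw [h.measureReal_withDensity measurableSet_Ioi, h.measureReal_withDensity measurableSet_Ioi,
    h.measureReal_withDensity (hEm.inter measurableSet_Ioc)]
  exact h.setIntegral_le hEm hδ0 hδ1 hzy (hE y hy)

lemma IsLogConcaveDensity.leftTailBound (h : IsLogConcaveDensity ρ C) {E B : Set ℝ}
    (hEm : MeasurableSet E) {δ : ℝ} (hδ0 : 0 < δ) (hδ1 : δ < 1)
    (hE : ∀ y ∈ B, ∀ u, y ≤ u → volume (E ∩ Set.Icc y u) ≤ ENNReal.ofReal (δ * (u - y))) :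
    LeftTailBound (volume.withDensity fun x => ENNReal.ofReal (ρ x)) E B δ := by
  intro z y hy hyz
  have hneg : ∀ S : Set ℝ, ∫ x in -S, ρ (-x) = ∫ x in S, ρ x := fun S =>
    (Measure.measurePreserving_neg volume).setIntegral_preimage_emb
      (Homeomorph.neg ℝ).measurableEmbedding ρ S
  have htail : ∀ u, rightTail (fun x => ρ (-x)) (-u) = ∫ x in Set.Iic u, ρ x := fun u => by
    rw [rightTail, integral_comp_neg_Ioi, neg_neg]
  have hEneg : ∫ t in -E ∩ Set.Ioc (-z) (-y), ρ (-t) = ∫ t in E ∩ Set.Ioc y z, ρ t := by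
    have e : -E ∩ Set.Ioc (-z) (-y) = -(E ∩ Set.Ico y z) := by
      rw [Set.inter_neg]; simp
    rw [e, hneg]
    exact setIntegral_congr_set ((ae_eq_refl E).inter Ico_ae_eq_Ioc)
  have key := h.comp_neg.setIntegral_le hEm.neg hδ0 hδ1 (neg_le_neg hyz) fun u hu => ?_
  · rw [hEneg, htail, htail] at key
    rwa [h.measureReal_withDensity measurableSet_Iic, h.measureReal_withDensity measurableSet_Iic,
      h.measureReal_withDensity (hEm.inter measurableSet_Ioc)]
  · have e : -E ∩ Set.Icc u (-y) = -(E ∩ Set.Icc y (-u)) := by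
      rw [Set.inter_neg]; simp
    rw [e, Measure.measure_neg]
    convert hE y hy (-u) (by linarith) using 2
    ring

/-- The one dimensional distribution inequality. -/
lemma IsLogConcaveDensity.integral_sublevel_le (h : IsLogConcaveDensity ρ C)
    (h1 : ∫ x, ρ x = 1) {a b : ℝ} (hab : ∀ x ∉ Set.Icc a b, ρ x = 0) {d : ℕ} (hd : d ≠ 0)
    {p : Polynomial ℝ} (hp : p.natDegree ≤ d) {lam m₁ m₂ : ℝ} (hlam : 1 < lam) (hm₁ : 0 ≤ m₁)
    (hm : chebyshevT d (2 * lam - 1) * m₁ < m₂) :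
    ∫ x in {x | |p.eval x| ≤ m₁}, ρ x ≤ 1 - (∫ x in {x | m₂ ≤ |p.eval x|}, ρ x) ^ (1 / lam) := by
  have hlam0 : 0 < lam := by linarith
  have hle : a ≤ b := by
    by_contra! hcon
    have : ∀ x, ρ x = 0 := fun x => hab x (by simp [Set.Icc_eq_empty (not_le.2 hcon)])
    simp [this] at h1
  have hT : 1 < chebyshevT d (2 * lam - 1) := one_lt_chebyshevT hd (by linarith)
  have hm12 : m₁ < m₂ := by nlinarith
  have hEc : IsClosed {x | |p.eval x| ≤ m₁} := isClosed_le p.continuous.abs continuous_const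
  have hBc : IsClosed {x | m₂ ≤ |p.eval x|} := isClosed_le continuous_const p.continuous.abs
  have hinter : ∀ S : Set ℝ, MeasurableSet S → ∫ x in Set.Icc a b ∩ S, ρ x = ∫ x in S, ρ x := by
    intro S hS
    refine (setIntegral_eq_of_subset_of_forall_sdiff_eq_zero hS Set.inter_subset_right ?_).symm
    intro x hx
    exact hab x fun hx' => hx.2 ⟨hx', hx.1⟩
  rw [← hinter _ hEc.measurableSet, ← hinter _ hBc.measurableSet]
  set E := Set.Icc a b ∩ {x | |p.eval x| ≤ m₁} with hE
  set B := Set.Icc a b ∩ {x | m₂ ≤ |p.eval x|} with hB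
  have hEK : IsCompact E := isCompact_Icc.inter_right hEc
  have hBK : IsCompact B := isCompact_Icc.inter_right hBc
  have hδ0 : 0 < 1 / lam := by positivity
  have hδ1 : 1 / lam < 1 := by rw [div_lt_one hlam0]; exact hlam
  have hfin : ∀ u v, volume (E ∩ Set.Icc u v) ≠ ⊤ := fun u v =>
    (measure_mono Set.inter_subset_right).trans_lt measure_Icc_lt_top |>.ne
  have hEm : ∀ x ∈ E, |p.eval x| ≤ m₁ := fun x hx => hx.2
  have hR : ∀ y ∈ B, ∀ u ≤ y,
      volume (E ∩ Set.Icc u y) ≤ ENNReal.ofReal (1 / lam * (y - u)) := by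
    intro y hy u huy
    rcases huy.eq_or_lt with rfl | huy
    · exact (measure_mono Set.inter_subset_right).trans (by simp)
    refine (ENNReal.le_ofReal_iff_toReal_le (hfin _ _) (by nlinarith)).2 ?_
    by_contra! hcon
    have := abs_eval_right_le_chebyshevT hp hEK.isClosed hEm huy hlam.le
      (by rwa [measureReal_def, div_eq_inv_mul, ← one_div])
    exact absurd (hy.2.trans this) (not_le.2 hm)
  have hL : ∀ y ∈ B, ∀ u, y ≤ u →
      volume (E ∩ Set.Icc y u) ≤ ENNReal.ofReal (1 / lam * (u - y)) := by
    intro y hy u huy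
    rcases huy.eq_or_lt with rfl | huy
    · exact (measure_mono Set.inter_subset_right).trans (by simp)
    refine (ENNReal.le_ofReal_iff_toReal_le (hfin _ _) (by nlinarith)).2 ?_
    by_contra! hcon
    have := abs_eval_left_le_chebyshevT hp hEK.isClosed hEm huy hlam.le
      (by rwa [measureReal_def, div_eq_inv_mul, ← one_div])
    exact absurd (hy.2.trans this) (not_le.2 hm)
  set μ := volume.withDensity fun x => ENNReal.ofReal (ρ x) with hμ
  have hprob : IsProbabilityMeasure μ := by
    refine ⟨?_⟩
    rw [hμ, withDensity_apply _ MeasurableSet.univ, Measure.restrict_univ,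
      ← ofReal_integral_eq_lintegral_ofReal h.integrable (Filter.Eventually.of_forall h.nonneg), h1,
      ENNReal.ofReal_one]
  have hC : μ ≤ C • volume := by
    refine Measure.le_iff.2 fun S hS => ?_
    rw [hμ, withDensity_apply _ hS, Measure.smul_apply]
    calc ∫⁻ x in S, ENNReal.ofReal (ρ x) ≤ ∫⁻ x in S, (C : ENNReal) :=
          lintegral_mono fun x => ENNReal.ofReal_le_coe.2 (h.le_const x)
      _ = C • volume S := by simp
  have hμab : μ (Set.Icc a b)ᶜ = 0 := by
    rw [hμ, withDensity_apply _ measurableSet_Icc.compl]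
    refine setLIntegral_eq_zero measurableSet_Icc.compl fun x hx => ?_
    simp [hab x hx]
  rw [← h.measureReal_withDensity hEK.measurableSet, ← h.measureReal_withDensity hBK.measurableSet]
  refine measureReal_le_of_tailBound hC hle hμab hEK hBK Set.inter_subset_left
    Set.inter_subset_left ?_ hδ0 hδ1 (h.rightTailBound hEK.measurableSet hδ0 hδ1 hR)
    (h.leftTailBound hEK.measurableSet hδ0 hδ1 hL)
  rw [Set.disjoint_left]
  intro x hx hx'
  exact absurd (hx'.2.trans hx.2) (not_le.2 hm12)

end PolynomialLine

section Slices

open scoped ENNReal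

/-- The volume of the slice of `K` on which the `i`-th coordinate equals `s`. -/
noncomputable def sliceVolume {n : ℕ} (K : Set (Fin (n + 1) → ℝ)) (i : Fin (n + 1)) (s : ℝ) :
    ℝ≥0∞ :=
  volume {y : Fin n → ℝ | i.insertNth s y ∈ K}

variable {n : ℕ} {K : Set (Fin (n + 1) → ℝ)} {i : Fin (n + 1)}

lemma measurableSet_slice (hK : MeasurableSet K) (s : ℝ) :
    MeasurableSet {y : Fin n → ℝ | i.insertNth s y ∈ K} :=
  (Continuous.finInsertNth (A := fun _ : Fin (n + 1) => ℝ) i continuous_const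
    continuous_id).measurable hK

lemma measurableSet_preimage_insertNth (hK : MeasurableSet K) :
    MeasurableSet {q : ℝ × (Fin n → ℝ) | i.insertNth q.1 q.2 ∈ K} :=
  (Continuous.finInsertNth (A := fun _ : Fin (n + 1) => ℝ) i continuous_fst
    continuous_snd).measurable hK

lemma measurable_sliceVolume (hK : MeasurableSet K) : Measurable (sliceVolume K i) :=
  measurable_measure_prodMk_left (measurableSet_preimage_insertNth hK)

lemma setLIntegral_sliceVolume (hK : MeasurableSet K) {S : Set ℝ} (hS : MeasurableSet S) :
    ∫⁻ s in S, sliceVolume K i s = volume (K ∩ {x | x i ∈ S}) := by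
  have hmp := volume_preserving_piFinSuccAbove (fun _ : Fin (n + 1) => ℝ) i
  have hKS : MeasurableSet (K ∩ {x | x i ∈ S}) := hK.inter (measurable_pi_apply i hS)
  set Q : Set (ℝ × (Fin n → ℝ)) := {q | i.insertNth q.1 q.2 ∈ K ∩ {x | x i ∈ S}} with hQ
  have e : K ∩ {x | x i ∈ S} =
      MeasurableEquiv.piFinSuccAbove (fun _ : Fin (n + 1) => ℝ) i ⁻¹' Q := by
    ext x
    have hx : i.insertNth (α := fun _ => ℝ) (x i) (i.removeNth x) = x :=
      Fin.insertNth_self_removeNth i x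
    change x ∈ _ ↔ i.insertNth (α := fun _ => ℝ) (x i) (i.removeNth x) ∈ K ∩ {x | x i ∈ S}
    rw [hx]
  rw [e, hmp.measure_preimage_equiv, Measure.volume_eq_prod,
    Measure.prod_apply (measurableSet_preimage_insertNth hKS), ← lintegral_indicator hS]
  refine lintegral_congr fun s => ?_
  by_cases hs : s ∈ S
  · rw [Set.indicator_of_mem hs, sliceVolume]
    congr 1
    ext y
    simp [hs]
  · rw [Set.indicator_of_notMem hs]
    simp [hs]

lemma sliceVolume_rpow_mul_le (hK : MeasurableSet K) (hc : Convex ℝ K) {t : ℝ} (ht0 : 0 < t)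
    (ht1 : t < 1) (u w : ℝ) :
    sliceVolume K i u ^ (1 - t) * sliceVolume K i w ^ t ≤
      sliceVolume K i ((1 - t) * u + t * w) := by
  have h1t : 0 < 1 - t := by linarith
  have h := isPrekopaLeindler_pi ht0 ht1 n
    ({y | i.insertNth u y ∈ K}.indicator 1) ({y | i.insertNth w y ∈ K}.indicator 1)
    ({y | i.insertNth ((1 - t) * u + t * w) y ∈ K}.indicator 1)
    (measurable_one.indicator (measurableSet_slice hK _))
    (measurable_one.indicator (measurableSet_slice hK _))
    (measurable_one.indicator (measurableSet_slice hK _)) ?_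
  · simp only [lintegral_indicator_one (measurableSet_slice hK _)] at h
    exact h
  · intro x y
    by_cases hx : x ∈ {y | i.insertNth u y ∈ K}
    · by_cases hy : y ∈ {y | i.insertNth w y ∈ K}
      · have e : i.insertNth (α := fun _ => ℝ) ((1 - t) * u + t * w) ((1 - t) • x + t • y) =
            (1 - t) • i.insertNth (α := fun _ => ℝ) u x +
              t • i.insertNth (α := fun _ => ℝ) w y := by
          ext j
          refine Fin.succAboveCases i ?_ ?_ j
          · simp
          · intro j; simp
        have hxy : (1 - t) • x + t • y ∈
            {y | i.insertNth (α := fun _ => ℝ) ((1 - t) * u + t * w) y ∈ K} := by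
          rw [Set.mem_ofPred_eq, e]
          exact hc hx hy h1t.le ht0.le (by ring)
        simp only [Set.indicator_of_mem hx, Set.indicator_of_mem hy, Set.indicator_of_mem hxy]
        simp
      · rw [Set.indicator_of_notMem hy, ENNReal.zero_rpow_of_pos ht0, mul_zero]
        exact bot_le
    · rw [Set.indicator_of_notMem hx, ENNReal.zero_rpow_of_pos h1t, zero_mul]
      exact bot_le

lemma sliceVolume_mul_le (hK : MeasurableSet K) (hc : Convex ℝ K) {x y s : ℝ} (hxy : x ≤ y)
    (hs : 0 ≤ s) : sliceVolume K i x * sliceVolume K i (y + s) ≤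
      sliceVolume K i y * sliceVolume K i (x + s) := by
  rcases hxy.eq_or_lt with rfl | hxy
  · exact le_rfl
  rcases hs.eq_or_lt with rfl | hs
  · simp [mul_comm]
  set t := (y - x) / (y + s - x) with ht
  have hpos : 0 < y + s - x := by linarith
  have ht0 : 0 < t := div_pos (by linarith) hpos
  have ht1 : t < 1 := by rw [ht, div_lt_one hpos]; linarith
  have e1 : (1 - t) * x + t * (y + s) = y := by rw [ht]; field_simp; ring
  have e2 : (1 - (1 - t)) * x + (1 - t) * (y + s) = x + s := by rw [ht]; field_simp; ring
  have h1 := sliceVolume_rpow_mul_le (i := i) hK hc ht0 ht1 x (y + s)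
  have h2 := sliceVolume_rpow_mul_le (i := i) hK hc (t := 1 - t) (by linarith) (by linarith)
    x (y + s)
  rw [e1] at h1
  rw [e2, sub_sub_cancel] at h2
  have e : ∀ v : ℝ≥0∞, v = v ^ (1 - t) * v ^ t := fun v => by
    rw [← ENNReal.rpow_add_of_nonneg _ _ (by linarith) ht0.le]; simp
  calc sliceVolume K i x * sliceVolume K i (y + s)
      = (sliceVolume K i x ^ (1 - t) * sliceVolume K i (y + s) ^ t) *
        (sliceVolume K i x ^ t * sliceVolume K i (y + s) ^ (1 - t)) := by
        conv_lhs => rw [e (sliceVolume K i x), e (sliceVolume K i (y + s))]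
        ring
    _ ≤ _ := mul_le_mul' h1 h2

lemma exists_isLogConcaveDensity (hK : IsCompact K) (hc : Convex ℝ K) (i : Fin (n + 1))
    (hvol : 0 < volume.real K) :
    ∃ (ρ : ℝ → ℝ) (C : NNReal) (a b : ℝ), IsLogConcaveDensity ρ C ∧
      (∀ x ∉ Set.Icc a b, ρ x = 0) ∧ ∀ S, MeasurableSet S →
        ∫ x in S, ρ x = volume.real (K ∩ {x | x i ∈ S}) / volume.real K := by
  have hKm := hK.measurableSet
  set K' : Set (Fin n → ℝ) := i.removeNth '' K with hK'
  have hK'c : IsCompact K' := hK.image (by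
    refine continuous_pi fun j => ?_
    exact continuous_apply (i.succAbove j))
  have hle : ∀ s, sliceVolume K i s ≤ volume K' := fun s => measure_mono fun y hy =>
    ⟨_, hy, Fin.removeNth_insertNth (α := fun _ => ℝ) i s y⟩
  have htop : ∀ s, sliceVolume K i s ≠ ⊤ := fun s =>
    ne_top_of_le_ne_top hK'c.measure_lt_top.ne (hle s)
  obtain ⟨a, b, hab⟩ : ∃ a b, ∀ x ∈ K, x i ∈ Set.Icc a b := by
    have hc : IsCompact ((fun x : Fin (n + 1) → ℝ => x i) '' K) := hK.image (continuous_apply i)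
    obtain ⟨a, ha⟩ := hc.bddBelow
    obtain ⟨b, hb⟩ := hc.bddAbove
    exact ⟨a, b, fun x hx => ⟨ha ⟨x, hx, rfl⟩, hb ⟨x, hx, rfl⟩⟩⟩
  have hm : Measurable (sliceVolume K i) := measurable_sliceVolume hKm
  have hslice : ∀ S, MeasurableSet S →
      ∫ x in S, (sliceVolume K i x).toReal / volume.real K =
        volume.real (K ∩ {x | x i ∈ S}) / volume.real K := by
    intro S hS
    rw [integral_div, integral_toReal hm.aemeasurable
      (Filter.Eventually.of_forall fun x => (htop x).lt_top), setLIntegral_sliceVolume hKm hS,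
      ← measureReal_def]
  refine ⟨fun s => (sliceVolume K i s).toReal / volume.real K,
    ⟨(volume K').toReal / volume.real K, by positivity⟩, a, b,
    ⟨hm.ennreal_toReal.div_const _, fun x => by positivity, fun x => ?_, ?_, ?_⟩, ?_, hslice⟩
  · change _ / _ ≤ _ / _
    gcongr
    exacts [hK'c.measure_lt_top.ne, hle x]
  · refine Integrable.div_const (integrable_toReal_of_lintegral_ne_top hm.aemeasurable ?_) _
    rw [← setLIntegral_univ, setLIntegral_sliceVolume hKm MeasurableSet.univ]
    exact ne_top_of_le_ne_top hK.measure_lt_top.ne (measure_mono Set.inter_subset_left)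
  · intro x y s hxy hs
    have h := sliceVolume_mul_le (i := i) hKm hc hxy hs
    have h2 := ENNReal.toReal_mono (ENNReal.mul_ne_top (htop _) (htop _)) h
    rw [ENNReal.toReal_mul, ENNReal.toReal_mul] at h2
    rw [div_mul_div_comm, div_mul_div_comm]
    gcongr
  · intro x hx
    have : {y : Fin n → ℝ | i.insertNth x y ∈ K} = ∅ := by
      refine Set.eq_empty_of_forall_notMem fun y hy => hx ?_
      simpa using hab _ hy
    simp [sliceVolume, this]

/-- The distribution inequality for polynomials depending on a single coordinate. -/
lemma volume_sublevel_coord_le (hK : IsCompact K) (hc : Convex ℝ K) (i : Fin (n + 1))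
    (hvol : 0 < volume.real K) {d : ℕ} (hd : d ≠ 0) {p : Polynomial ℝ} (hp : p.natDegree ≤ d)
    {lam m₁ m₂ : ℝ} (hlam : 1 < lam) (hm₁ : 0 ≤ m₁)
    (hm : chebyshevT d (2 * lam - 1) * m₁ < m₂) :
    volume.real (K ∩ {x | |p.eval (x i)| ≤ m₁}) / volume.real K ≤
      1 - (volume.real (K ∩ {x | m₂ ≤ |p.eval (x i)|}) / volume.real K) ^ (1 / lam) := by
  obtain ⟨ρ, C, a, b, hρ, hab, hslice⟩ := exists_isLogConcaveDensity hK hc i hvol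
  have h1 : ∫ x, ρ x = 1 := by
    rw [← setIntegral_univ, hslice _ MeasurableSet.univ]
    simp [hvol.ne']
  have := hρ.integral_sublevel_le h1 hab hd hp hlam hm₁ hm
  rwa [hslice _ (isClosed_le p.continuous.abs continuous_const).measurableSet,
    hslice _ (isClosed_le continuous_const p.continuous.abs).measurableSet] at this

end Slices

section Localization

variable {n : ℕ}

/-- The closed half-space through `a` bounded by a hyperplane with normal vector
`cos θ e_i + sin θ e_j`. -/
def rotatedHalfSpace (i j : Fin n) (a : Fin n → ℝ) (θ : ℝ) : Set (Fin n → ℝ) :=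
  {x | 0 ≤ Real.cos θ * (x i - a i) + Real.sin θ * (x j - a j)}

lemma isClosed_rotatedHalfSpace (i j : Fin n) (a : Fin n → ℝ) (θ : ℝ) :
    IsClosed (rotatedHalfSpace i j a θ) :=
  isClosed_le continuous_const (by fun_prop)

lemma convex_rotatedHalfSpace (i j : Fin n) (a : Fin n → ℝ) (θ : ℝ) :
    Convex ℝ (rotatedHalfSpace i j a θ) := by
  intro x hx y hy s t hs ht hst
  simp only [rotatedHalfSpace, Set.mem_ofPred_eq, Pi.add_apply, Pi.smul_apply, smul_eq_mul] at *
  have hs' : s = 1 - t := by linarith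
  have := add_nonneg (mul_nonneg hs hx) (mul_nonneg ht hy)
  rw [hs'] at this ⊢
  linarith

lemma volume_boundary_rotatedHalfSpace {i j : Fin n} (hij : i ≠ j) (a : Fin n → ℝ) (θ : ℝ) :
    volume {x : Fin n → ℝ | Real.cos θ * (x i - a i) + Real.sin θ * (x j - a j) = 0} = 0 := by
  set L : (Fin n → ℝ) →ₗ[ℝ] ℝ :=
    Real.cos θ • LinearMap.proj i + Real.sin θ • LinearMap.proj j with hL
  have hker : LinearMap.ker L ≠ ⊤ := by
    intro h
    rw [LinearMap.ker_eq_top] at h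
    have h1 := LinearMap.congr_fun h (Pi.single i 1)
    have h2 := LinearMap.congr_fun h (Pi.single j 1)
    simp [hL, hij, hij.symm] at h1 h2
    have := Real.sin_sq_add_cos_sq θ
    simp [h1, h2] at this
  have h0 := Measure.addHaar_submodule volume (LinearMap.ker L) hker
  have e : {x : Fin n → ℝ | Real.cos θ * (x i - a i) + Real.sin θ * (x j - a j) = 0} =
      (fun x => x + (-a)) ⁻¹' (LinearMap.ker L : Set (Fin n → ℝ)) := by
    ext x
    simp [hL, sub_eq_add_neg]
  rw [e, measure_preimage_add_right, h0]

lemma measure_inter_rotatedHalfSpace_add {i j : Fin n} (hij : i ≠ j) (a : Fin n → ℝ) (θ : ℝ)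
    {S : Set (Fin n → ℝ)} (hSfin : volume S ≠ ⊤) :
    volume.real (S ∩ rotatedHalfSpace i j a θ) +
      volume.real (S ∩ rotatedHalfSpace i j a (θ + Real.pi)) = volume.real S := by
  have hfin : ∀ T, T ⊆ S → volume T ≠ ⊤ := fun T hT => ne_top_of_le_ne_top hSfin (measure_mono hT)
  have e : volume.real (S ∩ rotatedHalfSpace i j a (θ + Real.pi)) =
      volume.real (S \ rotatedHalfSpace i j a θ) := by
    refine measureReal_congr ?_
    refine Filter.EventuallyEq.inter (ae_eq_refl S) ?_
    have h0 : ∀ᵐ x : Fin n → ℝ,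
        Real.cos θ * (x i - a i) + Real.sin θ * (x j - a j) ≠ 0 := by
      rw [ae_iff]
      simpa using volume_boundary_rotatedHalfSpace hij a θ
    filter_upwards [h0] with x hx
    refine propext ?_
    change 0 ≤ Real.cos (θ + Real.pi) * (x i - a i) + Real.sin (θ + Real.pi) * (x j - a j) ↔
      ¬ 0 ≤ Real.cos θ * (x i - a i) + Real.sin θ * (x j - a j)
    rw [Real.cos_add_pi, Real.sin_add_pi, not_le]
    constructor
    · intro h
      exact lt_of_le_of_ne (by linarith) hx
    · intro h
      linarith
  rw [e]
  exact measureReal_inter_add_sdiff (isClosed_rotatedHalfSpace i j a θ).measurableSet hSfin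

lemma continuous_measureReal_inter_rotatedHalfSpace {i j : Fin n} (hij : i ≠ j) (a : Fin n → ℝ)
    {S : Set (Fin n → ℝ)} (hSfin : volume S ≠ ⊤) :
    Continuous fun θ => volume.real (S ∩ rotatedHalfSpace i j a θ) := by
  have hHm : ∀ θ, MeasurableSet (rotatedHalfSpace i j a θ) := fun θ =>
    (isClosed_rotatedHalfSpace i j a θ).measurableSet
  have hfin : IsFiniteMeasure (volume.restrict S) := ⟨by simpa using hSfin.lt_top⟩
  have e : (fun θ => volume.real (S ∩ rotatedHalfSpace i j a θ)) = fun θ =>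
      ∫ x in S, (rotatedHalfSpace i j a θ).indicator (fun _ => (1 : ℝ)) x := by
    funext θ
    rw [integral_indicator (hHm θ)]
    simp [measureReal_restrict_apply (hHm θ), Set.inter_comm]
  rw [e]
  refine continuous_iff_continuousAt.2 fun θ => ?_
  refine continuousAt_of_dominated (bound := fun _ => 1)
    (Filter.Eventually.of_forall fun t =>
      (measurable_const.indicator (hHm t)).aestronglyMeasurable)
    (Filter.Eventually.of_forall fun t => Filter.Eventually.of_forall fun x => ?_)
    (integrable_const _) ?_
  · by_cases hx : x ∈ rotatedHalfSpace i j a t <;> simp [hx]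
  · have h0 : ∀ᵐ x : Fin n → ℝ,
        Real.cos θ * (x i - a i) + Real.sin θ * (x j - a j) ≠ 0 := by
      rw [ae_iff]
      simpa using volume_boundary_rotatedHalfSpace hij a θ
    filter_upwards [ae_restrict_of_ae h0] with x hx
    have hc : Continuous fun t => Real.cos t * (x i - a i) + Real.sin t * (x j - a j) := by
      fun_prop
    rcases lt_or_gt_of_ne hx with h | h
    · refine ContinuousAt.congr (f := fun _ => (0 : ℝ)) continuousAt_const ?_
      filter_upwards [hc.continuousAt.eventually_lt_const h] with t ht
      exact (Set.indicator_of_notMem (s := rotatedHalfSpace i j a t) (not_le.2 ht)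
        (fun _ => (1 : ℝ))).symm
    · refine ContinuousAt.congr (f := fun _ => (1 : ℝ)) continuousAt_const ?_
      filter_upwards [hc.continuousAt.eventually_const_lt h] with t ht
      exact (Set.indicator_of_mem (s := rotatedHalfSpace i j a t) ht.le
        (fun _ => (1 : ℝ))).symm

/-- Compact convex sets in which `B` has proportion exactly `r` and `E` has proportion
greater than `c`. -/
structure IsHeavy (E B : Set (Fin n → ℝ)) (r c : ℝ) (F : Set (Fin n → ℝ)) : Prop where
  isCompact : IsCompact F
  convex : Convex ℝ F
  volume_eq : volume.real (B ∩ F) = r * volume.real F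
  lt_volume : c * volume.real F < volume.real (E ∩ F)

variable {E B F : Set (Fin n → ℝ)} {r c : ℝ}

lemma IsHeavy.exists_rotatedHalfSpace (h : IsHeavy E B r c F) {i j : Fin n} (hij : i ≠ j)
    (a : Fin n → ℝ) : ∃ θ, IsHeavy E B r c (F ∩ rotatedHalfSpace i j a θ) := by
  have hfin : volume F ≠ ⊤ := h.isCompact.measure_lt_top.ne
  have hBfin : volume (B ∩ F) ≠ ⊤ := ne_top_of_le_ne_top hfin (measure_mono Set.inter_subset_right)
  have hEfin : volume (E ∩ F) ≠ ⊤ := ne_top_of_le_ne_top hfin (measure_mono Set.inter_subset_right)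
  set g : ℝ → ℝ := fun θ => volume.real (B ∩ F ∩ rotatedHalfSpace i j a θ) -
    r * volume.real (F ∩ rotatedHalfSpace i j a θ) with hg
  have hgc : Continuous g :=
    (continuous_measureReal_inter_rotatedHalfSpace hij a hBfin).sub
      (continuous_const.mul (continuous_measureReal_inter_rotatedHalfSpace hij a hfin))
  have hganti : ∀ θ, g θ + g (θ + Real.pi) = 0 := fun θ => by
    have h1 := measure_inter_rotatedHalfSpace_add hij a θ hBfin
    have h2 := measure_inter_rotatedHalfSpace_add hij a θ hfin
    have h3 := h.volume_eq
    simp only [hg]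
    rw [← h1, ← h2] at h3
    linarith
  obtain ⟨θ, -, hθ⟩ : ∃ θ ∈ Set.uIcc 0 (0 + Real.pi), g θ = 0 := by
    refine intermediate_value_uIcc hgc.continuousOn ?_
    have := hganti 0
    rw [Set.mem_uIcc]
    rcases le_total (g 0) 0 with h0 | h0
    · left; constructor <;> linarith
    · right; constructor <;> linarith
  have hθ' : g (θ + Real.pi) = 0 := by linarith [hganti θ]
  have h1 := measure_inter_rotatedHalfSpace_add hij a θ hEfin
  have h2 := measure_inter_rotatedHalfSpace_add hij a θ hfin
  have h3 := h.lt_volume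
  have key : ∀ t, g t = 0 → c * volume.real (F ∩ rotatedHalfSpace i j a t) <
      volume.real (E ∩ F ∩ rotatedHalfSpace i j a t) →
      IsHeavy E B r c (F ∩ rotatedHalfSpace i j a t) := fun t ht htc =>
    ⟨h.isCompact.inter_right (isClosed_rotatedHalfSpace i j a t),
      h.convex.inter (convex_rotatedHalfSpace i j a t), by
        rw [← Set.inter_assoc]; simp only [hg] at ht; linarith, by rwa [← Set.inter_assoc]⟩
  by_cases hcase : c * volume.real (F ∩ rotatedHalfSpace i j a θ) <
      volume.real (E ∩ F ∩ rotatedHalfSpace i j a θ)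
  · exact ⟨θ, key θ hθ hcase⟩
  · refine ⟨θ + Real.pi, key _ hθ' ?_⟩
    rw [← h1, ← h2] at h3
    linarith

lemma exists_rat_pair_of_isOpen {U : Set (ℝ × ℝ)} (hU : IsOpen U) (hne : U.Nonempty) :
    ∃ s t : ℚ, ((s : ℝ), (t : ℝ)) ∈ U := by
  have hd : DenseRange (Prod.map (Rat.cast : ℚ → ℝ) (Rat.cast : ℚ → ℝ)) :=
    Rat.denseRange_cast.prodMap Rat.denseRange_cast
  obtain ⟨⟨s, t⟩, h⟩ := hd.exists_mem_open hU hne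
  exact ⟨s, t, h⟩

/-- Three points whose projections to a coordinate plane are not collinear cannot lie in a common
half-plane through each rational point of that plane. -/
lemma collinear_of_subset_rotatedHalfSpace {K : Set (Fin n → ℝ)} {i j : Fin n} (hij : i ≠ j)
    (hK : ∀ a : Fin n → ℚ, ∃ θ, K ⊆ rotatedHalfSpace i j (fun k => (a k : ℝ)) θ)
    {p q x : Fin n → ℝ} (hp : p ∈ K) (hq : q ∈ K) (hx : x ∈ K) :
    (x i - p i) * (q j - p j) = (x j - p j) * (q i - p i) := by
  by_contra hne
  set D := (x i - p i) * (q j - p j) - (x j - p j) * (q i - p i) with hD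
  have hD0 : D ≠ 0 := sub_ne_zero.2 hne
  set α : ℝ × ℝ → ℝ := fun z => ((z.1 - p i) * (q j - p j) - (z.2 - p j) * (q i - p i)) / D with hα
  set β : ℝ × ℝ → ℝ := fun z => ((x i - p i) * (z.2 - p j) - (x j - p j) * (z.1 - p i)) / D with hβ
  have hαc : Continuous α := by fun_prop
  have hβc : Continuous β := by fun_prop
  obtain ⟨s, t, ⟨h1, h2⟩, h3⟩ := exists_rat_pair_of_isOpen
    (U := ({z | 0 < α z} ∩ {z | 0 < β z}) ∩ {z | α z + β z < 1})
    (((isOpen_lt continuous_const hαc).inter (isOpen_lt continuous_const hβc)).inter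
      (isOpen_lt (hαc.add hβc) continuous_const)) (by
      refine ⟨((p i + q i + x i) / 3, (p j + q j + x j) / 3), ?_⟩
      have ha : α ((p i + q i + x i) / 3, (p j + q j + x j) / 3) = 1 / 3 := by
        simp only [hα]
        rw [div_eq_iff hD0, hD]
        ring
      have hb : β ((p i + q i + x i) / 3, (p j + q j + x j) / 3) = 1 / 3 := by
        simp only [hβ]
        rw [div_eq_iff hD0, hD]
        ring
      simp only [Set.mem_inter_iff, Set.mem_ofPred_eq, ha, hb]
      norm_num)
  simp only [Set.mem_ofPred_eq] at h1 h2 h3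
  obtain ⟨θ, hθ⟩ := hK fun k => if k = i then s else t
  have hval : ∀ y ∈ K, 0 ≤ Real.cos θ * (y i - s) + Real.sin θ * (y j - t) := fun y hy => by
    simpa [rotatedHalfSpace, hij.symm] using hθ hy
  have hs : α (s, t) * (x i - p i) + β (s, t) * (q i - p i) = s - p i := by
    simp only [hα, hβ]
    field_simp
    rw [hD]
    ring
  have ht : α (s, t) * (x j - p j) + β (s, t) * (q j - p j) = t - p j := by
    simp only [hα, hβ]
    field_simp
    rw [hD]
    ring
  set a := α (s, t)
  set b := β (s, t)
  set u := Real.cos θ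
  set v := Real.sin θ
  have vp := hval p hp
  have vq := hval q hq
  have vx := hval x hx
  have hsum : (1 - a - b) * (u * (p i - s) + v * (p j - t)) + a * (u * (x i - s) + v * (x j - t)) +
      b * (u * (q i - s) + v * (q j - t)) = 0 := by
    linear_combination u * hs + v * ht
  have hc : 0 < 1 - a - b := by linarith
  have np := mul_nonneg hc.le vp
  have nq := mul_nonneg h2.le vq
  have nx := mul_nonneg h1.le vx
  have ep : u * (p i - s) + v * (p j - t) = 0 :=
    (mul_eq_zero.1 (by linarith : (1 - a - b) * _ = 0)).resolve_left hc.ne'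
  have eq : u * (q i - s) + v * (q j - t) = 0 :=
    (mul_eq_zero.1 (by linarith : b * _ = 0)).resolve_left h2.ne'
  have ex : u * (x i - s) + v * (x j - t) = 0 :=
    (mul_eq_zero.1 (by linarith : a * _ = 0)).resolve_left h1.ne'
  have hu : u * D = 0 := by
    rw [hD]
    linear_combination (q j - p j) * (ex - ep) - (x j - p j) * (eq - ep)
  have hv : v * D = 0 := by
    rw [hD]
    linear_combination (x i - p i) * (eq - ep) - (q i - p i) * (ex - ep)
  have hcs := Real.cos_sq_add_sin_sq θ
  change u ^ 2 + v ^ 2 = 1 at hcs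
  rw [(mul_eq_zero.1 hu).resolve_right hD0, (mul_eq_zero.1 hv).resolve_right hD0] at hcs
  norm_num at hcs

lemma IsHeavy.exists_antitone (h : IsHeavy E B r c F) :
    ∃ G : ℕ → Set (Fin n → ℝ), Antitone G ∧ G 0 = F ∧ (∀ k, IsHeavy E B r c (G k)) ∧
      ∀ i j : Fin n, i ≠ j → ∀ a : Fin n → ℚ,
        ∃ k θ, G k ⊆ rotatedHalfSpace i j (fun l => (a l : ℝ)) θ := by
  rcases isEmpty_or_nonempty (Fin n) with hn | hn
  · exact ⟨fun _ => F, fun _ _ _ => le_rfl, rfl, fun _ => h, fun i => hn.elim i⟩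
  obtain ⟨e, he⟩ := exists_surjective_nat (Fin n × Fin n × (Fin n → ℚ))
  have step : ∀ (k : ℕ) (F' : {F // IsHeavy E B r c F}), ∃ F'' : {F // IsHeavy E B r c F},
      F''.1 ⊆ F'.1 ∧ ((e k).1 ≠ (e k).2.1 → ∃ θ,
        F''.1 ⊆ rotatedHalfSpace (e k).1 (e k).2.1 (fun l => ((e k).2.2 l : ℝ)) θ) := by
    rintro k ⟨F', hF'⟩
    by_cases hij : (e k).1 = (e k).2.1
    · exact ⟨⟨F', hF'⟩, le_rfl, fun h => absurd hij h⟩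
    · obtain ⟨θ, hθ⟩ := hF'.exists_rotatedHalfSpace hij fun l => ((e k).2.2 l : ℝ)
      exact ⟨⟨_, hθ⟩, Set.inter_subset_left, fun _ => ⟨θ, Set.inter_subset_right⟩⟩
  choose f hf1 hf2 using step
  let G : ℕ → {F // IsHeavy E B r c F} := fun k => Nat.rec ⟨F, h⟩ f k
  refine ⟨fun k => (G k).1, antitone_nat_of_succ_le fun k => hf1 k (G k), rfl,
    fun k => (G k).2, fun i j hij a => ?_⟩
  obtain ⟨k, hk⟩ := he (i, j, a)
  obtain ⟨θ, hθ⟩ := hf2 k (G k) (by rw [hk]; exact hij)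
  rw [hk] at hθ
  exact ⟨k + 1, θ, hθ⟩

/-- **Localization**: a heavy set contains heavy subsets concentrating near a line. -/
lemma IsHeavy.exists_line {E B F : Set (Fin (n + 1) → ℝ)} (h : IsHeavy E B r c F) :
    ∃ (i : Fin (n + 1)) (p w : Fin (n + 1) → ℝ), ∀ U, IsOpen U →
      {x | x = p + (x i - p i) • w} ⊆ U → ∃ F', IsHeavy E B r c F' ∧ F' ⊆ F ∧ F' ⊆ U := by
  obtain ⟨G, hG, hG0, hheavy, hcut⟩ := h.exists_antitone
  have hcol : ∀ {p q x : Fin (n + 1) → ℝ}, p ∈ ⋂ k, G k → q ∈ ⋂ k, G k → x ∈ ⋂ k, G k →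
      ∀ i j, (x i - p i) * (q j - p j) = (x j - p j) * (q i - p i) := by
    intro p q x hp hq hx i j
    rcases eq_or_ne i j with rfl | hij
    · rfl
    refine collinear_of_subset_rotatedHalfSpace hij (fun a => ?_) hp hq hx
    obtain ⟨k, θ, hk⟩ := hcut i j hij a
    exact ⟨θ, (Set.iInter_subset _ k).trans hk⟩
  have hline : ∃ (i : Fin (n + 1)) (p w : Fin (n + 1) → ℝ),
      ⋂ k, G k ⊆ {x | x = p + (x i - p i) • w} := by
    rcases (⋂ k, G k).eq_empty_or_nonempty with h0 | ⟨p, hp⟩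
    · exact ⟨0, 0, 0, by simp [h0]⟩
    by_cases hq : ∃ q ∈ ⋂ k, G k, q ≠ p
    · obtain ⟨q, hq, hqp⟩ := hq
      obtain ⟨i, hi⟩ := Function.ne_iff.1 hqp
      refine ⟨i, p, (q i - p i)⁻¹ • (q - p), fun x hx => ?_⟩
      have hi' : q i - p i ≠ 0 := sub_ne_zero.2 hi
      funext j
      have := hcol hp hq hx i j
      simp only [Pi.add_apply, Pi.smul_apply, Pi.sub_apply, smul_eq_mul]
      field_simp
      linarith
    · push Not at hq
      exact ⟨0, p, 0, fun x hx => by simpa using hq x hx⟩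
  obtain ⟨i, p, w, hsub⟩ := hline
  refine ⟨i, p, w, fun U hU hUsub => ?_⟩
  obtain ⟨k, hk⟩ := exists_subset_nhds_of_isCompact (V := G) hG.directed_ge
    (fun k => (hheavy k).isCompact) fun x hx => hU.mem_nhds (hUsub (hsub hx))
  exact ⟨G k, hheavy k, hG0 ▸ hG (Nat.zero_le k), hk⟩

end Localization

section MultivariatePolynomial

variable {n d : ℕ} {P : MvPolynomial (Fin (n + 1)) ℝ} {F : Set (Fin (n + 1) → ℝ)} {lam m : ℝ}

/-- Restricting a multivariate polynomial to a line. -/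
lemma MvPolynomial.exists_polynomial_eval_line {σ : Type*} (P : MvPolynomial σ ℝ)
    (hP : P.totalDegree ≤ d) (p w : σ → ℝ) (c : ℝ) :
    ∃ q : Polynomial ℝ, q.natDegree ≤ d ∧
      ∀ s, q.eval s = MvPolynomial.eval (p + (s - c) • w) P := by
  refine ⟨MvPolynomial.aeval
    (fun k => Polynomial.C (p k - c * w k) + Polynomial.C (w k) * Polynomial.X) P, ?_, fun s => ?_⟩
  · refine (MvPolynomial.aeval_natDegree_le P hP _ fun k => ?_).trans (mul_one d).le
    rw [add_comm]
    exact Polynomial.natDegree_linear_le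
  · have := MvPolynomial.map_aeval
      (fun k => Polynomial.C (p k - c * w k) + Polynomial.C (w k) * Polynomial.X)
      (Polynomial.evalRingHom s) P
    rw [Polynomial.coe_evalRingHom] at this
    rw [this]
    change MvPolynomial.eval₂ _ _ P = MvPolynomial.eval₂ _ _ P
    congr 1
    · ext; simp
    · ext k
      simp
      ring

lemma volume_sublevel_le_of_lt (hF : IsCompact F) (hFc : Convex ℝ F) (hFvol : volume.real F = 1)
    (hd : d ≠ 0) (hP : P.totalDegree ≤ d) (hm : 0 < m) {T : ℝ} (hlam : 1 < lam)
    (hT : chebyshevT d (2 * lam - 1) < T) :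
    volume.real ({x | |MvPolynomial.eval x P| ≤ m} ∩ F) ≤
      1 - volume.real ({x | T * m ≤ |MvPolynomial.eval x P|} ∩ F) ^ (1 / lam) := by
  have hcont : Continuous fun x : Fin (n + 1) → ℝ => |MvPolynomial.eval x P| :=
    (MvPolynomial.continuous_eval P).abs
  set E := {x | |MvPolynomial.eval x P| ≤ m}
  set B := {x | T * m ≤ |MvPolynomial.eval x P|}
  set r := volume.real (B ∩ F)
  have hr0 : 0 ≤ r := measureReal_nonneg
  have hr1 : r ≤ 1 := hFvol ▸ measureReal_mono Set.inter_subset_right hF.measure_lt_top.ne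
  have hc0 : 0 ≤ 1 - r ^ (1 / lam) :=
    sub_nonneg.2 (Real.rpow_le_one hr0 hr1 (by positivity))
  by_contra! hlt
  have hheavy : IsHeavy E B r (1 - r ^ (1 / lam)) F :=
    ⟨hF, hFc, by rw [hFvol, mul_one], by rwa [hFvol, mul_one]⟩
  obtain ⟨i, p, w, hloc⟩ := hheavy.exists_line
  obtain ⟨q, hq, hqe⟩ := MvPolynomial.exists_polynomial_eval_line P hP p w (p i)
  have hT1 : 1 < chebyshevT d (2 * lam - 1) := one_lt_chebyshevT hd (by linarith)
  set T' := chebyshevT d (2 * lam - 1)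
  obtain ⟨η, hη0, hη⟩ : ∃ η > 0, T' * (m + η) < T * m - η := by
    refine ⟨(T - T') * m / (2 * (1 + T')), ?_, ?_⟩
    · have := sub_pos.2 hT
      positivity
    · have h1 : (T - T') * m / (2 * (1 + T')) * (1 + T') = (T - T') * m / 2 := by
        field_simp
      have := mul_pos (sub_pos.2 hT) hm
      linarith
  obtain ⟨F', hF', -, hF'U⟩ := hloc
    {x | |q.eval (x i)| - η < |MvPolynomial.eval x P| ∧
      |MvPolynomial.eval x P| < |q.eval (x i)| + η} (by
      have hqc : Continuous fun x : Fin (n + 1) → ℝ => |q.eval (x i)| :=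
        (q.continuous.comp (continuous_apply i)).abs
      exact (isOpen_lt (hqc.sub continuous_const) hcont).inter
        (isOpen_lt hcont (hqc.add continuous_const))) (by
      intro x hx
      have e : q.eval (x i) = MvPolynomial.eval x P := by
        rw [hqe]
        exact congrArg (fun y => MvPolynomial.eval y P) (Set.mem_ofPred_eq ▸ hx).symm
      constructor <;> rw [e] <;> linarith)
  have hfin : volume F' ≠ ⊤ := hF'.isCompact.measure_lt_top.ne
  have hV : 0 < volume.real F' := by
    refine lt_of_lt_of_le ((mul_nonneg hc0 measureReal_nonneg).trans_lt hF'.lt_volume) ?_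
    exact measureReal_mono Set.inter_subset_right hfin
  have key := volume_sublevel_coord_le hF'.isCompact hF'.convex i hV hd hq hlam
    (by positivity : 0 ≤ m + η) hη
  have hE : volume.real (E ∩ F') ≤ volume.real (F' ∩ {x | |q.eval (x i)| ≤ m + η}) := by
    refine measureReal_mono ?_ (ne_top_of_le_ne_top hfin (measure_mono Set.inter_subset_left))
    rintro x ⟨hx, hxF⟩
    have hx' : |MvPolynomial.eval x P| ≤ m := hx
    exact ⟨hxF, (by linarith [(hF'U hxF).1] : |q.eval (x i)| ≤ m + η)⟩
  have hB : volume.real (B ∩ F') ≤ volume.real (F' ∩ {x | T * m - η ≤ |q.eval (x i)|}) := by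
    refine measureReal_mono ?_ (ne_top_of_le_ne_top hfin (measure_mono Set.inter_subset_left))
    rintro x ⟨hx, hxF⟩
    have hx' : T * m ≤ |MvPolynomial.eval x P| := hx
    exact ⟨hxF, (by linarith [(hF'U hxF).2] : T * m - η ≤ |q.eval (x i)|)⟩
  have h1 : 1 - r ^ (1 / lam) <
      volume.real (F' ∩ {x | |q.eval (x i)| ≤ m + η}) / volume.real F' := by
    rw [lt_div_iff₀ hV]
    exact hF'.lt_volume.trans_le hE
  have h2 : r ≤ volume.real (F' ∩ {x | T * m - η ≤ |q.eval (x i)|}) / volume.real F' := by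
    rw [le_div_iff₀ hV, ← hF'.volume_eq]
    exact hB
  have h3 := Real.rpow_le_rpow hr0 h2 (by positivity : 0 ≤ 1 / lam)
  linarith

theorem volume_sublevel_le (hF : IsCompact F) (hFc : Convex ℝ F) (hFvol : volume.real F = 1)
    (hd : d ≠ 0) (hP : P.totalDegree ≤ d) (hm : 0 < m) (hlam : 1 < lam) :
    volume.real ({x | |MvPolynomial.eval x P| ≤ m} ∩ F) ≤
      1 - volume.real
        ({x | chebyshevT d (2 * lam - 1) * m ≤ |MvPolynomial.eval x P|} ∩ F) ^ (1 / lam) := by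
  set r := volume.real ({x | chebyshevT d (2 * lam - 1) * m ≤ |MvPolynomial.eval x P|} ∩ F)
  have hr0 : 0 ≤ r := measureReal_nonneg
  have hlim : Filter.Tendsto (fun t : ℝ => 1 - r ^ (1 / t)) (nhdsWithin lam (Set.Iio lam))
      (nhds (1 - r ^ (1 / lam))) := by
    have h0 : lam ≠ 0 := by positivity
    have : ContinuousAt (fun t : ℝ => 1 - r ^ (1 / t)) lam := by
      refine continuousAt_const.sub ?_
      exact ContinuousAt.rpow continuousAt_const (continuousAt_const.div continuousAt_id h0)
        (Or.inr (by positivity))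
    exact this.mono_left nhdsWithin_le_nhds
  refine ge_of_tendsto hlim ?_
  filter_upwards [Ioo_mem_nhdsLT hlam] with t ht
  refine volume_sublevel_le_of_lt hF hFc hFvol hd hP hm ht.1 ?_
  exact strictMonoOn_chebyshevT hd (by simp; linarith [ht.1]) (by simp; linarith)
    (by linarith [ht.2])

end MultivariatePolynomial

/-- Sharp distribution inequalities:
`Vol{|P| > T_d(2λ-1) M(P)} ≤ e^{-λ}` and `Vol{|P| < M(P)/T_d(2λ-1)} ≤ 1 - e^{-1/λ}`. -/
theorem sharp_distribution_inequalities {n : ℕ} (d : ℕ) (P : MvPolynomial (Fin n) ℝ)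
    (hPd : P.totalDegree ≤ d) (hPnc : ∀ c : ℝ, P ≠ MvPolynomial.C c)
    (F : Set (EuclideanSpace ℝ (Fin n))) (hFcomp : IsCompact F) (hFconv : Convex ℝ F)
    (hFvol : volume F = 1)
    (M : ℝ) (hM : 0 < M)
    (hMdef : volume {x ∈ F | M ≤ |MvPolynomial.eval (fun i => x i) P|} =
      ENNReal.ofReal (Real.exp (-1)))
    (lam : ℝ) (hlam : 1 < lam) :
    (volume {x ∈ F |
        chebyshevT d (2 * lam - 1) * M < |MvPolynomial.eval (fun i => x i) P|}).toReal ≤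
      Real.exp (-lam) ∧
    (volume {x ∈ F |
        |MvPolynomial.eval (fun i => x i) P| < M / chebyshevT d (2 * lam - 1)}).toReal ≤
      1 - Real.exp (-1 / lam) := by
  have hd : d ≠ 0 := by
    rintro rfl
    exact hPnc _ (MvPolynomial.totalDegree_eq_zero_iff_eq_C.1 (Nat.le_zero.1 hPd))
  obtain _ | n := n
  · exact absurd (MvPolynomial.eq_C_of_isEmpty P) (hPnc _)
  set e := EuclideanSpace.equiv (Fin (n + 1)) ℝ
  have he : MeasurePreserving e.symm := PiLp.volume_preserving_toLp (Fin (n + 1))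
  have hemb : MeasurableEmbedding e.symm := e.symm.toHomeomorph.measurableEmbedding
  have hvol : ∀ S, volume (e.symm ⁻¹' S) = volume S := fun S =>
    he.measure_preimage_emb hemb S
  set F₀ : Set (Fin (n + 1) → ℝ) := e.symm ⁻¹' F
  have hF₀ : IsCompact F₀ := e.symm.toHomeomorph.isCompact_preimage.2 hFcomp
  have hF₀c : Convex ℝ F₀ := hFconv.linear_preimage e.symm.toLinearMap
  have hF₀v : volume.real F₀ = 1 := by simp [measureReal_def, F₀, hvol, hFvol]
  have hset : ∀ p : ℝ → Prop,
      volume {x ∈ F | p |MvPolynomial.eval (fun i => x i) P|} =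
        volume ({x | p |MvPolynomial.eval x P|} ∩ F₀) := fun p => by
    rw [← hvol, Set.inter_comm]
    rfl
  have hfin : volume F₀ ≠ ⊤ := hF₀.measure_lt_top.ne
  have hfin' : ∀ S, volume (S ∩ F₀) ≠ ⊤ := fun S =>
    ne_top_of_le_ne_top hfin (measure_mono Set.inter_subset_right)
  rw [hset (fun t => M ≤ t)] at hMdef
  rw [hset (fun t => chebyshevT d (2 * lam - 1) * M < t),
    hset (fun t => t < M / chebyshevT d (2 * lam - 1))]
  have hMr : volume.real ({x | M ≤ |MvPolynomial.eval x P|} ∩ F₀) = Real.exp (-1) := by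
    rw [measureReal_def, hMdef, ENNReal.toReal_ofReal (Real.exp_pos _).le]
  have hT : 0 < chebyshevT d (2 * lam - 1) :=
    zero_lt_one.trans (one_lt_chebyshevT hd (by linarith))
  set T := chebyshevT d (2 * lam - 1) with hTdef
  have hlam0 : 0 < lam := by positivity
  constructor
  · refine (measureReal_mono (s₂ := {x | T * M ≤ |MvPolynomial.eval x P|} ∩ F₀)
      (Set.inter_subset_inter_left _ (Set.ofPred_subset_ofPred.2 fun x hx => hx.le))
      (hfin' _)).trans ?_
    have h := volume_sublevel_le hF₀ hF₀c hF₀v hd hPd hM hlam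
    rw [← hTdef] at h
    set r := volume.real ({x | T * M ≤ |MvPolynomial.eval x P|} ∩ F₀)
    have hr0 : 0 ≤ r := measureReal_nonneg
    have hcover : 1 ≤ volume.real ({x | |MvPolynomial.eval x P| ≤ M} ∩ F₀) +
        volume.real ({x | M ≤ |MvPolynomial.eval x P|} ∩ F₀) := by
      rw [← hF₀v]
      refine (measureReal_mono (fun x hx => ?_) ?_).trans (measureReal_union_le _ _)
      · exact (le_total |MvPolynomial.eval x P| M).imp (⟨·, hx⟩) (⟨·, hx⟩)
      · exact (measure_union_lt_top (hfin' _).lt_top (hfin' _).lt_top).ne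
    have hle : r ^ (1 / lam) ≤ Real.exp (-1) := by linarith
    calc r = (r ^ (1 / lam)) ^ lam := by
          rw [← Real.rpow_mul hr0, one_div_mul_cancel hlam0.ne', Real.rpow_one]
      _ ≤ Real.exp (-1) ^ lam := Real.rpow_le_rpow (by positivity) hle hlam0.le
      _ = Real.exp (-lam) := by rw [← Real.exp_mul, neg_one_mul]
  · refine (measureReal_mono (s₂ := {x | |MvPolynomial.eval x P| ≤ M / T} ∩ F₀)
      (Set.inter_subset_inter_left _ (Set.ofPred_subset_ofPred.2 fun x hx => hx.le))
      (hfin' _)).trans ?_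
    have h := volume_sublevel_le hF₀ hF₀c hF₀v hd hPd (div_pos hM hT) hlam
    rw [← hTdef, mul_div_cancel₀ _ hT.ne', hMr, ← Real.exp_mul, mul_one_div] at h
    exact h
end

section
/- Let F ⊂ ℝⁿ be a compact convex set of volume 1, let P be a non-constant polynomial on ℝⁿ of degree at most d, and let M(P) be the unique positive number with Vol{x ∈ F : |P(x)| ≥ M(P)} = 1/e. Then for every q ≥ 1/d, (∫_F |P(x)|^q dx)^{1/q} ≤ (12qd)^d · M(P). -/
open MeasureTheory

open Polynomial in
/-- Lagrange interpolation formula, in evaluated form. -/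
lemma eval_eq_sum_lagrange {ι : Type*} [DecidableEq ι] {s : Finset ι} {v : ι → ℝ}
    (hv : Set.InjOn v s) {p : ℝ[X]} (hp : p.degree < s.card) (x : ℝ) :
    p.eval x = ∑ i ∈ s, p.eval (v i) * ∏ j ∈ s.erase i, ((x - v j) / (v i - v j)) := by
  conv_lhs => rw [Lagrange.eq_interpolate hv hp, Lagrange.interpolate_apply]
  simp only [eval_finsetSum, eval_mul, eval_C, Lagrange.basis, eval_prod,
    Lagrange.basisDivisor, eval_sub, eval_X]
  refine Finset.sum_congr rfl fun i _ => ?_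
  congr 1
  refine Finset.prod_congr rfl fun j _ => ?_
  rw [div_eq_inv_mul]

open Polynomial in
lemma eval_chebyshev_T_le {x : ℝ} (hx : 1 ≤ x) (d : ℕ) :
    (Chebyshev.T ℝ d).eval x ≤ (2 * x) ^ d := by
  have h := Real.cosh_arcosh hx
  have h0 := Real.arcosh_nonneg hx
  set θ := Real.arcosh x
  rw [← h, Chebyshev.T_real_cosh]
  calc Real.cosh (((d : ℤ) : ℝ) * θ) ≤ Real.exp (d * θ) := by
        rw [Real.cosh_eq]
        have : Real.exp (-(((d : ℤ) : ℝ) * θ)) ≤ Real.exp (d * θ) := by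
          apply Real.exp_le_exp.2
          have : (0 : ℝ) ≤ d * θ := by positivity
          push_cast
          linarith
        push_cast at this ⊢
        linarith
    _ = Real.exp θ ^ d := by rw [← Real.exp_nat_mul]
    _ ≤ (2 * Real.cosh θ) ^ d := by
        gcongr
        rw [Real.cosh_eq]
        linarith [Real.exp_pos (-θ)]

open Polynomial Polynomial.Chebyshev in
/-- The Lagrange coefficients at the Chebyshev nodes, taken with absolute denominators, sum
up to the value of the Chebyshev polynomial. -/
lemma sum_prod_abs_node (d : ℕ) (y : ℝ) :
    ∑ i ∈ Finset.range (d + 1), ∏ j ∈ (Finset.range (d + 1)).erase i,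
      ((y - node d j) / |node d i - node d j|) = (T ℝ d).eval y := by
  rw [eval_eq_sum_lagrange (s := Finset.range (d + 1)) (strictAntiOn_node d).injOn
    (by rw [degree_T]; simp; norm_cast; omega)]
  refine Finset.sum_congr rfl fun i hi => ?_
  have hi' : i ≤ d := Nat.lt_succ_iff.1 (Finset.mem_range.1 hi)
  rw [eval_T_real_node (Finset.mem_Iic.2 hi'), Finset.prod_div_distrib, Finset.prod_div_distrib,
    ← Finset.abs_prod]
  have h := zero_lt_prod_node_sub_node hi'
  set Q := ∏ j ∈ (Finset.range (d + 1)).erase i, (node d i - node d j)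
  have : |Q| = (-1) ^ i * Q := by
    rw [← abs_of_pos h, abs_mul, abs_neg_one_pow, one_mul]
  rw [this, mul_div_assoc', div_eq_div_iff h.ne' (by rintro h0; simp [h0] at h)]
  have h1 : ((-1 : ℝ) ^ i) * (-1) ^ i = 1 := by rw [← mul_pow]; simp
  linear_combination (- (∏ j ∈ (Finset.range (d + 1)).erase i, (y - node d j)) * Q) * h1

lemma volume_real_inter_Iic_sub_le {Z : Set ℝ} (hZ : IsCompact Z) {a b : ℝ} (hab : a ≤ b) :
    volume.real (Z ∩ Set.Iic b) - volume.real (Z ∩ Set.Iic a) ≤ b - a := by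
  have hfin : volume (Z ∩ Set.Iic a) < ⊤ :=
    (measure_mono Set.inter_subset_left).trans_lt hZ.measure_lt_top
  have h : Z ∩ Set.Iic b ⊆ (Z ∩ Set.Iic a) ∪ Set.Ioc a b := by
    rintro z ⟨hz, hzb⟩
    by_cases hza : z ≤ a
    · exact Or.inl ⟨hz, hza⟩
    · exact Or.inr ⟨not_le.1 hza, hzb⟩
  have h2 := (measureReal_mono (μ := volume) h
    (measure_union_lt_top hfin (by simp)).ne).trans (measureReal_union_le _ _)
  rw [Real.volume_real_Ioc_of_le hab] at h2
  linarith

lemma volume_real_inter_Iic_mono {Z : Set ℝ} (hZ : IsCompact Z) {a b : ℝ} (hab : a ≤ b) :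
    volume.real (Z ∩ Set.Iic a) ≤ volume.real (Z ∩ Set.Iic b) :=
  measureReal_mono (Set.inter_subset_inter_right Z (Set.Iic_subset_Iic.2 hab))
    ((measure_mono Set.inter_subset_left).trans_lt hZ.measure_lt_top).ne

lemma abs_volume_real_inter_Iic_sub_le {Z : Set ℝ} (hZ : IsCompact Z) (a b : ℝ) :
    |volume.real (Z ∩ Set.Iic a) - volume.real (Z ∩ Set.Iic b)| ≤ |a - b| := by
  rcases le_total a b with h | h
  · have := volume_real_inter_Iic_mono hZ h
    rw [abs_of_nonpos (by linarith), abs_of_nonpos (by linarith)]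
    linarith [volume_real_inter_Iic_sub_le hZ h]
  · have := volume_real_inter_Iic_mono hZ h
    rw [abs_of_nonneg (by linarith), abs_of_nonneg (by linarith)]
    linarith [volume_real_inter_Iic_sub_le hZ h]

/-- A compact set of reals of length greater than `m` has a point with exactly the length `ξ` of
the set to its left, for every `ξ` in `[0, m]`. -/
lemma exists_mem_volume_inter_Iic {Z : Set ℝ} (hZ : IsCompact Z) (hZ1 : Z ⊆ Set.Icc 0 1)
    {m ξ : ℝ} (hm : ENNReal.ofReal m < volume Z) (h0 : 0 ≤ ξ) (h1 : ξ ≤ m) :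
    ∃ x ∈ Z, volume.real (Z ∩ Set.Iic x) = ξ := by
  have hξ : ξ < volume.real Z := by
    refine h1.trans_lt ?_
    have := (ENNReal.toReal_lt_toReal (by simp) hZ.measure_lt_top.ne).2 hm
    rwa [ENNReal.toReal_ofReal (h0.trans h1)] at this
  have hcont : Continuous fun x => volume.real (Z ∩ Set.Iic x) :=
    (LipschitzWith.of_dist_le_mul (K := 1) fun a b => by
      simpa [Real.dist_eq] using abs_volume_real_inter_Iic_sub_le hZ a b).continuous
  have hl : volume.real (Z ∩ Set.Iic (-1)) = 0 := by
    have : Z ∩ Set.Iic (-1) = ∅ := by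
      ext z
      simp only [Set.mem_inter_iff, Set.mem_Iic, Set.mem_empty_iff_false, iff_false, not_and]
      intro hz
      linarith [(hZ1 hz).1]
    simp [this]
  have hr : volume.real (Z ∩ Set.Iic 1) = volume.real Z := by
    have : Z ∩ Set.Iic 1 = Z := Set.inter_eq_left.2 fun z hz => (hZ1 hz).2
    rw [this]
  obtain ⟨a, -, ha⟩ : ξ ∈ (fun x => volume.real (Z ∩ Set.Iic x)) '' Set.Icc (-1) 1 :=
    intermediate_value_Icc (by norm_num) hcont.continuousOn
      ⟨by simpa only [hl] using h0, by simpa only [hr] using hξ.le⟩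
  have hne : (Z ∩ Set.Ici a).Nonempty := by
    by_contra hne
    have : Z ∩ Set.Iic a = Z := Set.inter_eq_left.2 fun z hz => by
      by_contra hza
      exact hne ⟨z, hz, (le_total z a).resolve_left hza⟩
    simp only [this] at ha
    linarith
  obtain ⟨x, hx, hxmin⟩ := (hZ.inter_right isClosed_Ici).exists_isLeast hne
  refine ⟨x, hx.1, le_antisymm ?_ (ha.symm.le.trans (volume_real_inter_Iic_mono hZ hx.2))⟩
  have hsub : Z ∩ Set.Iic x ⊆ (Z ∩ Set.Iic a) ∪ {x} := by
    rintro z ⟨hz, hzx⟩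
    rcases le_total z a with hza | hza
    · exact Or.inl ⟨hz, hza⟩
    · exact Or.inr (le_antisymm hzx (hxmin ⟨hz, hza⟩))
  have hfin : volume (Z ∩ Set.Iic a) < ⊤ :=
    (measure_mono Set.inter_subset_left).trans_lt hZ.measure_lt_top
  have := (measureReal_mono (μ := volume) hsub
    (measure_union_lt_top hfin (by simp)).ne).trans (measureReal_union_le _ _)
  simp only [measureReal_def (μ := volume) (s := {x}), Real.volume_singleton, ENNReal.toReal_zero,
    add_zero] at this
  exact this.trans ha.le

open Polynomial in
/-- **Remez inequality**, for an endpoint of the interval. -/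
theorem remez_endpoint {d : ℕ} {p : ℝ[X]} (hd : p.natDegree ≤ d) {Z : Set ℝ} (hZ : IsCompact Z)
    (hZ1 : Z ⊆ Set.Icc 0 1) {m M : ℝ} (hm : 0 < m) (hmZ : ENNReal.ofReal m < volume Z)
    (hM : ∀ x ∈ Z, |p.eval x| ≤ M) : |p.eval 1| ≤ (4 / m) ^ d * M := by
  have hm1 : m ≤ 1 := by
    have h := hmZ.trans_le (measure_mono hZ1)
    rw [Real.volume_Icc] at h
    have := (ENNReal.ofReal_lt_ofReal_iff (by norm_num)).1 h
    linarith
  set ξ : ℕ → ℝ := fun i => m * (1 + Chebyshev.node d i) / 2 with hξ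
  have hx : ∀ i, ∃ x ∈ Z, volume.real (Z ∩ Set.Iic x) = ξ i := by
    intro i
    have := Chebyshev.node_mem_Icc (n := d) (i := i)
    refine exists_mem_volume_inter_Iic hZ hZ1 hmZ ?_ ?_
    · have : 0 ≤ 1 + Chebyshev.node d i := by linarith [this.1]
      positivity
    · simp only [hξ]; nlinarith [this.2]
  choose x hxZ hxξ using hx
  have hspread : ∀ i j, |ξ i - ξ j| ≤ |x i - x j| := fun i j => by
    rw [← hxξ i, ← hxξ j]
    exact abs_volume_real_inter_Iic_sub_le hZ _ _
  have hend : ∀ j, 1 - x j ≤ 1 - ξ j := by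
    intro j
    have h1 : Z ∩ Set.Iic (x j) ⊆ Set.Icc 0 (x j) := fun z hz => ⟨(hZ1 hz.1).1, hz.2⟩
    have h2 := measureReal_mono (μ := volume) h1 (by simp)
    rw [Real.volume_real_Icc_of_le (hZ1 (hxZ j)).1, hxξ] at h2
    linarith
  have hM0 : 0 ≤ M := (abs_nonneg _).trans (hM _ (hxZ 0))
  have hξne : ∀ i ∈ Finset.range (d + 1), ∀ j ∈ (Finset.range (d + 1)).erase i, ξ i ≠ ξ j := by
    intro i hi j hj h
    have : Chebyshev.node d i = Chebyshev.node d j := by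
      simp only [hξ] at h
      have := mul_left_cancel₀ hm.ne'
          (by linarith : m * (1 + Chebyshev.node d i) = m * (1 + Chebyshev.node d j))
      linarith
    exact (Finset.ne_of_mem_erase hj)
      ((Chebyshev.strictAntiOn_node d).injOn hi (Finset.mem_of_mem_erase hj) this).symm
  have hxinj : Set.InjOn x (Finset.range (d + 1)) := by
    intro i hi j hj hij
    by_contra hne
    refine hξne i hi j (Finset.mem_erase.2 ⟨fun h => hne h.symm, hj⟩) ?_
    have := hspread i j
    rw [hij, sub_self, abs_zero] at this
    exact sub_eq_zero.1 (abs_eq_zero.1 (le_antisymm this (abs_nonneg _)))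
  have hy : 1 ≤ 2 / m - 1 := by
    have : 2 ≤ 2 / m := by rw [le_div_iff₀ hm]; linarith
    linarith
  calc |p.eval 1|
      = |∑ i ∈ Finset.range (d + 1), p.eval (x i) *
          ∏ j ∈ (Finset.range (d + 1)).erase i, ((1 - x j) / (x i - x j))| := by
        rw [← eval_eq_sum_lagrange hxinj]
        rw [Finset.card_range]
        exact (degree_le_of_natDegree_le hd).trans_lt (by norm_cast; omega)
    _ ≤ ∑ i ∈ Finset.range (d + 1), M * ∏ j ∈ (Finset.range (d + 1)).erase i,
          ((2 / m - 1 - Chebyshev.node d j) / |Chebyshev.node d i - Chebyshev.node d j|) := by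
        refine (Finset.abs_sum_le_sum_abs _ _).trans (Finset.sum_le_sum fun i hi => ?_)
        rw [abs_mul, Finset.abs_prod]
        refine mul_le_mul (hM _ (hxZ i)) ?_ (Finset.prod_nonneg fun _ _ => abs_nonneg _) hM0
        refine Finset.prod_le_prod (fun _ _ => abs_nonneg _) fun j hj => ?_
        have e1 : (2 / m - 1 - Chebyshev.node d j) / |Chebyshev.node d i - Chebyshev.node d j|
            = (1 - ξ j) / |ξ i - ξ j| := by
          have : ξ i - ξ j = (m / 2) * (Chebyshev.node d i - Chebyshev.node d j) := by
            simp only [hξ]; ring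
          rw [this, abs_mul, abs_of_pos (by positivity : (0 : ℝ) < m / 2)]
          have : 1 - ξ j = (m / 2) * (2 / m - 1 - Chebyshev.node d j) := by
            simp only [hξ]; field_simp; ring
          rw [this, mul_div_mul_left _ _ (by positivity)]
        rw [e1, abs_div, abs_of_nonneg (by linarith [(hZ1 (hxZ j)).2] : 0 ≤ 1 - x j)]
        exact div_le_div₀ (by linarith [(hZ1 (hxZ j)).2, hend j]) (hend j)
          (abs_pos.2 (sub_ne_zero.2 (hξne i hi j hj))) (hspread i j)
    _ = M * (Chebyshev.T ℝ d).eval (2 / m - 1) := by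
        rw [← Finset.mul_sum, sum_prod_abs_node]
    _ ≤ M * (4 / m) ^ d := by
        gcongr
        refine (eval_chebyshev_T_le hy d).trans ?_
        gcongr
        rw [show (4 : ℝ) / m = 2 * (2 / m) by ring]
        linarith
    _ = (4 / m) ^ d * M := mul_comm _ _

open ProbabilityTheory Filter Topology in
/-- The quantile function of a probability density: it transports the uniform distribution on
`(0, 1)` to the density, and its derivative is the inverse of the density. -/
lemma exists_quantile {f : ℝ → ENNReal} (hf : Measurable f) (hf1 : ∫⁻ x, f x = 1) :
    ∃ X : ℝ → ℝ, Measurable X ∧ MonotoneOn X (Set.Ioo 0 1) ∧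
      ∀ᵐ u ∂volume.restrict (Set.Ioo 0 1), f (X u) ≠ 0 ∧ f (X u) ≠ ⊤ ∧
        HasDerivWithinAt X (f (X u)).toReal⁻¹ (Set.Ioo 0 1) u := by
  set μ : Measure ℝ := volume.withDensity f with hμ
  have hprob : IsProbabilityMeasure μ := ⟨by simp [hμ, hf1]⟩
  set F : ℝ → ℝ := fun x => cdf μ x with hF
  have hmono : Monotone F := monotone_cdf μ
  have hac : μ ≪ volume := withDensity_absolutelyContinuous _ _
  have hatom : ∀ x, μ {x} = 0 := fun x => hac (by simp)
  have hcont : Continuous F := by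
    rw [continuous_iff_continuousAt]
    intro x
    rw [hmono.continuousAt_iff_leftLim_eq_rightLim]
    have h := (cdf μ).measure_singleton x
    rw [measure_cdf, hatom] at h
    have h2 := (cdf μ).rightLim_eq x
    have h3 := (monotone_cdf μ).leftLim_le (le_refl x)
    have h4 := ENNReal.ofReal_eq_zero.1 h.symm
    change Function.leftLim (cdf μ) x = Function.rightLim (cdf μ) x
    rw [h2]
    linarith
  have hex : ∀ u ∈ Set.Ioo (0 : ℝ) 1, ∃ x, ∀ y, x ≤ y ↔ u ≤ F y := by
    intro u hu
    have hne : {y | u ≤ F y}.Nonempty :=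
      (((tendsto_cdf_atTop μ).eventually (lt_mem_nhds hu.2)).exists).imp fun _ h => h.le
    obtain ⟨b, hb⟩ := ((tendsto_cdf_atBot μ).eventually (gt_mem_nhds hu.1)).exists
    have hbdd : BddBelow {y | u ≤ F y} := ⟨b, fun y hy => by
      by_contra hyb
      exact absurd (hy.trans (hmono (not_le.1 hyb).le)) (not_le.2 hb)⟩
    have hclosed : IsClosed {y | u ≤ F y} := isClosed_le continuous_const hcont
    refine ⟨sInf {y | u ≤ F y}, fun y => ⟨fun h => ?_, fun h => csInf_le hbdd h⟩⟩
    exact (hclosed.csInf_mem hne hbdd).trans (hmono h)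
  choose! X hX using hex
  have hFX : ∀ u ∈ Set.Ioo (0 : ℝ) 1, F (X u) = u := by
    intro u hu
    refine le_antisymm ?_ ((hX u hu _).1 le_rfl)
    refine le_of_tendsto (hcont.continuousAt.tendsto.mono_left
      (nhdsWithin_le_nhds (s := Set.Iio (X u)))) ?_
    filter_upwards [self_mem_nhdsWithin] with y hy
    by_contra h
    exact absurd ((hX u hu y).2 (not_le.1 h).le) (not_le.2 hy)
  have hXmono : MonotoneOn X (Set.Ioo 0 1) := fun u hu v hv huv =>
    (hX u hu _).2 (huv.trans (hFX v hv).ge)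
  have hXmeas : Measurable ((Set.Ioo (0 : ℝ) 1).indicator X) := by
    refine measurable_of_Iic fun a => ?_
    have : (Set.Ioo (0 : ℝ) 1).indicator X ⁻¹' Set.Iic a =
        (Set.Ioo 0 1).ite (Set.Iic (F a)) {_u | 0 ≤ a} := by
      ext u
      by_cases hu : u ∈ Set.Ioo (0 : ℝ) 1
      · rw [Set.mem_preimage, Set.indicator_of_mem hu]
        simp [Set.ite, hu, hX u hu a]
      · rw [Set.mem_preimage, Set.indicator_of_notMem hu]
        simp [Set.ite, hu]
    rw [this]
    exact measurableSet_Ioo.ite measurableSet_Iic (MeasurableSet.const _)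
  refine ⟨(Set.Ioo (0 : ℝ) 1).indicator X, ?_, ?_, ?_⟩
  · exact hXmeas
  · exact hXmono.congr fun u hu => (Set.indicator_of_mem hu X).symm
  have hmap : (volume.restrict (Set.Ioo (0 : ℝ) 1)).map ((Set.Ioo (0 : ℝ) 1).indicator X) = μ := by
    have : IsProbabilityMeasure (volume.restrict (Set.Ioo (0 : ℝ) 1)) := ⟨by simp⟩
    refine Measure.ext_of_Iic _ _ fun a => ?_
    rw [Measure.map_apply hXmeas measurableSet_Iic,
      Measure.restrict_apply (hXmeas measurableSet_Iic), ← ofReal_cdf μ a]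
    have hset : (Set.Ioo (0 : ℝ) 1).indicator X ⁻¹' Set.Iic a ∩ Set.Ioo 0 1 =
        Set.Ioo 0 1 ∩ Set.Iic (F a) := by
      ext u
      simp only [Set.mem_inter_iff, Set.mem_preimage, Set.mem_Iic]
      constructor
      · rintro ⟨h, hu⟩
        rw [Set.indicator_of_mem hu] at h
        exact ⟨hu, (hX u hu a).1 h⟩
      · rintro ⟨hu, h⟩
        rw [Set.indicator_of_mem hu]
        exact ⟨(hX u hu a).2 h, hu⟩
    rw [hset]
    have hF1 : F a ≤ 1 := cdf_le_one μ a
    refine le_antisymm ?_ ?_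
    · calc volume (Set.Ioo 0 1 ∩ Set.Iic (F a)) ≤ volume (Set.Ioc 0 (F a)) :=
            measure_mono fun u hu => ⟨hu.1.1, hu.2⟩
        _ = ENNReal.ofReal (F a) := by simp
    · calc ENNReal.ofReal (F a) = volume (Set.Ioo 0 (F a)) := by simp
        _ ≤ volume (Set.Ioo 0 1 ∩ Set.Iic (F a)) :=
            measure_mono fun u hu => ⟨⟨hu.1, hu.2.trans_le hF1⟩, hu.2.le⟩
  have hder : ∀ᵐ x ∂μ, f x ≠ 0 ∧ f x ≠ ⊤ ∧ HasDerivAt F (f x).toReal x := by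
    have h1 : ∀ᵐ x ∂μ, f x ≠ 0 := by
      rw [ae_withDensity_iff hf]
      exact ae_of_all _ fun x hx => hx
    have h2 : ∀ᵐ x ∂μ, f x ≠ ⊤ :=
      hac.ae_le ((ae_lt_top hf (by simp [hf1])).mono fun x hx => hx.ne)
    have h3 : ∀ᵐ x ∂μ, HasDerivAt F (f x).toReal x := by
      refine hac.ae_le ?_
      have h := (cdf μ).ae_hasDerivAt
      rw [measure_cdf] at h
      filter_upwards [h, Measure.rnDeriv_withDensity volume hf] with x hx hx2
      rwa [hx2] at hx
    filter_upwards [h1, h2, h3] with x a b c using ⟨a, b, c⟩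
  rw [← hmap] at hder
  have hder2 := ae_of_ae_map hXmeas.aemeasurable hder
  filter_upwards [hder2, ae_restrict_mem measurableSet_Ioo,
    hXmono.ae_differentiableWithinAt measurableSet_Ioo] with u hu hu01 hdiff
  refine ⟨hu.1, hu.2.1, ?_⟩
  have hFd := hu.2.2
  rw [Set.indicator_of_mem hu01] at hFd ⊢
  have hXd := hdiff.hasDerivWithinAt
  have hcomp := (hFd.comp_hasDerivWithinAt u hXd).congr_of_mem (f₁ := id)
    (fun v hv => (hFX v hv).symm) hu01
  have huniq := (uniqueDiffWithinAt_Ioo hu01).eq_deriv _ hcomp (hasDerivWithinAt_id u _)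
  rw [eq_inv_of_mul_eq_one_right huniq] at hXd
  exact hXd.congr_of_mem (fun v hv => Set.indicator_of_mem hv X) hu01

/-- A Prékopa–Leindler inequality with several interpolation times: `ν` is a measure on the set
`[0, 1]` of times, and the pointwise hypothesis is only required on average over the times. -/
def AveragedPrekopaLeindler (ν : Measure ℝ) (E : Type*) [AddCommGroup E] [Module ℝ E]
    [MeasureSpace E] : Prop :=
  ∀ (f g : E → ENNReal) (h : ℝ → E → ENNReal), Measurable f → Measurable g →
    Measurable (Function.uncurry h) → ∫⁻ x, f x = 1 → ∫⁻ x, g x = 1 →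
    (∀ x y, f x ≠ 0 → f x ≠ ⊤ → g y ≠ 0 → g y ≠ ⊤ →
      1 ≤ ∫⁻ s, h s (s • x + (1 - s) • y) * (f x ^ (-s) * g y ^ (-(1 - s))) ∂ν) →
    1 ≤ ∫⁻ s, (∫⁻ z, h s z) ∂ν

lemma ENNReal.rpow_mul_rpow_le_ofReal {a b : ENNReal} (ha : a ≠ 0) (ha' : a ≠ ⊤) (hb : b ≠ 0)
    (hb' : b ≠ ⊤) {s : ℝ} (hs : s ∈ Set.Icc (0 : ℝ) 1) :
    a ^ (-s) * b ^ (-(1 - s)) ≤ ENNReal.ofReal (s * a.toReal⁻¹ + (1 - s) * b.toReal⁻¹) := by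
  have ha0 := ENNReal.toReal_pos ha ha'
  have hb0 := ENNReal.toReal_pos hb hb'
  conv_lhs => rw [← ENNReal.ofReal_toReal ha', ← ENNReal.ofReal_toReal hb']
  rw [ENNReal.ofReal_rpow_of_pos ha0, ENNReal.ofReal_rpow_of_pos hb0,
    ← ENNReal.ofReal_mul (by positivity)]
  refine ENNReal.ofReal_le_ofReal ?_
  rw [Real.rpow_neg ha0.le, Real.rpow_neg hb0.le, ← Real.inv_rpow ha0.le, ← Real.inv_rpow hb0.le]
  exact Real.geom_mean_le_arith_mean2_weighted hs.1 (by linarith [hs.2]) (by positivity)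
    (by positivity) (by ring)

lemma averagedPrekopaLeindler_real {ν : Measure ℝ} [SFinite ν]
    (hν : ∀ᵐ s ∂ν, s ∈ Set.Icc (0 : ℝ) 1) : AveragedPrekopaLeindler ν ℝ := by
  intro f g h hf hg hh hf1 hg1 hfgh
  obtain ⟨X, hXm, hXmono, hX⟩ := exists_quantile hf hf1
  obtain ⟨Y, hYm, hYmono, hY⟩ := exists_quantile hg hg1
  obtain ⟨t, ht, htm, ht0⟩ : ∃ t ⊆ {u ∈ Set.Ioo (0 : ℝ) 1 |
      (f (X u) ≠ 0 ∧ f (X u) ≠ ⊤ ∧ HasDerivWithinAt X (f (X u)).toReal⁻¹ (Set.Ioo 0 1) u) ∧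
      (g (Y u) ≠ 0 ∧ g (Y u) ≠ ⊤ ∧ HasDerivWithinAt Y (g (Y u)).toReal⁻¹ (Set.Ioo 0 1) u)},
      MeasurableSet t ∧ volume (Set.Ioo (0 : ℝ) 1 \ t) = 0 := by
    have h := (ae_restrict_mem measurableSet_Ioo).and (hX.and hY)
    obtain ⟨t, h1, h2, h3⟩ := exists_measurable_superset_of_null h
    refine ⟨tᶜ, ?_, h2.compl, ?_⟩
    · rw [Set.compl_subset_comm]
      exact h1
    · rw [Measure.restrict_apply h2] at h3
      rwa [Set.sdiff_eq, compl_compl, Set.inter_comm]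
  have ht1 : volume t = 1 := by
    refine le_antisymm ?_ ?_
    · exact (measure_mono fun u hu => (ht hu).1).trans (by simp : volume (Set.Ioo (0 : ℝ) 1) ≤ 1)
    · calc (1 : ENNReal) = volume (Set.Ioo (0 : ℝ) 1) := by simp
        _ ≤ volume (t ∪ Set.Ioo (0 : ℝ) 1 \ t) :=
            measure_mono (by intro u hu; by_cases h : u ∈ t <;> simp [h, hu.1, hu.2])
        _ ≤ volume t + 0 := by rw [← ht0]; exact measure_union_le _ _
        _ = volume t := add_zero _
  set k : ℝ → ℝ → ENNReal := fun s u =>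
    h s (s • X u + (1 - s) • Y u) * (f (X u) ^ (-s) * g (Y u) ^ (-(1 - s))) with hk
  have hkm : Measurable (Function.uncurry k) := by
    have h1 : Measurable fun p : ℝ × ℝ => h p.1 (p.1 • X p.2 + (1 - p.1) • Y p.2) :=
      hh.comp (by fun_prop : Measurable fun p : ℝ × ℝ => (p.1, p.1 • X p.2 + (1 - p.1) • Y p.2))
    exact h1.mul (by fun_prop)
  have hle : ∀ᵐ s ∂ν, ∫⁻ u in t, k s u ≤ ∫⁻ z, h s z := by
    filter_upwards [hν] with s hs
    have hs' : 0 ≤ 1 - s := by linarith [hs.2]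
    have hder : ∀ u ∈ t, HasDerivWithinAt (fun u => s • X u + (1 - s) • Y u)
        (s * (f (X u)).toReal⁻¹ + (1 - s) * (g (Y u)).toReal⁻¹) t u := fun u hu =>
      (((ht hu).2.1.2.2.const_smul s).add ((ht hu).2.2.2.2.const_smul (1 - s))).mono
        fun v hv => (ht hv).1
    have hmono : MonotoneOn (fun u => s • X u + (1 - s) • Y u) t := fun u hu v hv huv =>
      add_le_add (smul_le_smul_of_nonneg_left (hXmono (ht hu).1 (ht hv).1 huv) hs.1)
        (smul_le_smul_of_nonneg_left (hYmono (ht hu).1 (ht hv).1 huv) hs')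
    calc ∫⁻ u in t, k s u
        ≤ ∫⁻ u in t, ENNReal.ofReal (s * (f (X u)).toReal⁻¹ + (1 - s) * (g (Y u)).toReal⁻¹) *
            h s (s • X u + (1 - s) • Y u) := by
          refine setLIntegral_mono' htm fun u hu => ?_
          rw [mul_comm (ENNReal.ofReal _)]
          exact mul_le_mul' le_rfl (ENNReal.rpow_mul_rpow_le_ofReal (ht hu).2.1.1 (ht hu).2.1.2.1
            (ht hu).2.2.1 (ht hu).2.2.2.1 hs)
      _ = ∫⁻ z in (fun u => s • X u + (1 - s) • Y u) '' t, h s z :=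
          (lintegral_image_eq_lintegral_deriv_mul_of_monotoneOn htm hder hmono _).symm
      _ ≤ ∫⁻ z, h s z := setLIntegral_le_lintegral _ _
  calc (1 : ENNReal) = ∫⁻ u in t, 1 := by simp [ht1]
    _ ≤ ∫⁻ u in t, ∫⁻ s, k s u ∂ν := setLIntegral_mono' htm fun u hu =>
        hfgh _ _ (ht hu).2.1.1 (ht hu).2.1.2.1 (ht hu).2.2.1 (ht hu).2.2.2.1
    _ = ∫⁻ s, (∫⁻ u in t, k s u) ∂ν :=
        lintegral_lintegral_swap (f := fun u s => k s u) (hkm.comp measurable_swap).aemeasurable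
    _ ≤ ∫⁻ s, (∫⁻ z, h s z) ∂ν := lintegral_mono_ae hle

lemma AveragedPrekopaLeindler.prod {ν : Measure ℝ} {E₁ E₂ : Type*}
    [AddCommGroup E₁] [Module ℝ E₁] [MeasureSpace E₁] [AddCommGroup E₂] [Module ℝ E₂]
    [MeasureSpace E₂] [SFinite (volume : Measure E₁)] [SFinite (volume : Measure E₂)]
    [MeasurableAdd₂ E₁] [MeasurableSMul₂ ℝ E₁] [MeasurableAdd₂ E₂] [MeasurableSMul₂ ℝ E₂]
    (h₁ : AveragedPrekopaLeindler ν E₁) (h₂ : AveragedPrekopaLeindler ν E₂) :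
    AveragedPrekopaLeindler ν (E₁ × E₂) := by
  intro f g h hf hg hh hf1 hg1 hfgh
  rw [Measure.volume_eq_prod, lintegral_prod _ hf.aemeasurable] at hf1
  rw [Measure.volume_eq_prod, lintegral_prod _ hg.aemeasurable] at hg1
  have hHm : Measurable (Function.uncurry fun s x => ∫⁻ y, h s (x, y)) := by
    have : Measurable fun p : (ℝ × E₁) × E₂ => h p.1.1 (p.1.2, p.2) :=
      hh.comp (by fun_prop : Measurable fun p : (ℝ × E₁) × E₂ => (p.1.1, (p.1.2, p.2)))
    exact this.lintegral_prod_right'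
  have key := h₁ (fun x => ∫⁻ y, f (x, y)) (fun x => ∫⁻ y, g (x, y)) (fun s x => ∫⁻ y, h s (x, y))
    hf.lintegral_prod_right' hg.lintegral_prod_right' hHm hf1 hg1 ?_
  · refine key.trans_eq (lintegral_congr fun s => ?_)
    rw [Measure.volume_eq_prod, lintegral_prod]
    exact (hh.comp measurable_prodMk_left).aemeasurable
  intro x x' hx0 hxt hx'0 hx't
  set a := ∫⁻ y, f (x, y)
  set b := ∫⁻ y, g (x', y)
  have hfx : Measurable fun y => f (x, y) := hf.comp measurable_prodMk_left
  have hgx : Measurable fun y => g (x', y) := hg.comp measurable_prodMk_left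
  have key2 := h₂ (fun y => f (x, y) * a⁻¹) (fun y => g (x', y) * b⁻¹)
    (fun s y => h s (s • x + (1 - s) • x', y) * (a ^ (-s) * b ^ (-(1 - s)))) ?_ ?_ ?_ ?_ ?_ ?_
  · refine key2.trans_eq (lintegral_congr fun s => ?_)
    exact lintegral_mul_const _ (hh.comp
      (by fun_prop : Measurable fun y : E₂ => (s, (s • x + (1 - s) • x', y))))
  · exact hfx.mul_const _
  · exact hgx.mul_const _
  · refine Measurable.mul (hh.comp (by fun_prop : Measurable fun p : ℝ × E₂ =>
      (p.1, (p.1 • x + (1 - p.1) • x', p.2)))) ?_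
    fun_prop
  · rw [lintegral_mul_const a⁻¹ hfx, ENNReal.mul_inv_cancel hx0 hxt]
  · rw [lintegral_mul_const b⁻¹ hgx, ENNReal.mul_inv_cancel hx'0 hx't]
  · intro y y' hy0 hyt hy'0 hy't
    have hy0' := left_ne_zero_of_mul hy0
    have hy'0' := left_ne_zero_of_mul hy'0
    have hyt' : f (x, y) ≠ ⊤ := fun h => hyt (by
      rw [h, ENNReal.top_mul (ENNReal.inv_ne_zero.2 hxt)])
    have hy't' : g (x', y') ≠ ⊤ := fun h => hy't (by
      rw [h, ENNReal.top_mul (ENNReal.inv_ne_zero.2 hx't)])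
    refine (hfgh (x, y) (x', y') hy0' hyt' hy'0' hy't').trans_eq (lintegral_congr fun s => ?_)
    have hsplit : ∀ (c e : ENNReal) (r : ℝ), c ≠ 0 → c ≠ ⊤ → e ≠ 0 → e ≠ ⊤ →
        c ^ r = e ^ r * (c * e⁻¹) ^ r := by
      intro c e r hc hc' he he'
      rw [← ENNReal.mul_rpow_of_ne_top he' (ENNReal.mul_ne_top hc' (ENNReal.inv_ne_top.2 he)),
        mul_left_comm, ENNReal.mul_inv_cancel he he', mul_one]
    rw [hsplit (f (x, y)) a _ hy0' hyt' hx0 hxt, hsplit (g (x', y')) b _ hy'0' hy't' hx'0 hx't]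
    simp only [Prod.smul_mk, Prod.mk_add_mk]
    ring

lemma AveragedPrekopaLeindler.of_measurePreserving {ν : Measure ℝ} {E₁ E₂ : Type*}
    [AddCommGroup E₁] [Module ℝ E₁] [MeasureSpace E₁] [AddCommGroup E₂] [Module ℝ E₂]
    [MeasureSpace E₂] (e : E₁ →ₗ[ℝ] E₂) (he : MeasurePreserving e)
    (h₁ : AveragedPrekopaLeindler ν E₁) : AveragedPrekopaLeindler ν E₂ := by
  intro f g h hf hg hh hf1 hg1 hfgh
  have key := h₁ (fun x => f (e x)) (fun x => g (e x)) (fun s x => h s (e x))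
    (hf.comp he.measurable) (hg.comp he.measurable)
    (hh.comp (measurable_id.prodMap he.measurable))
    (by rw [he.lintegral_comp hf, hf1]) (by rw [he.lintegral_comp hg, hg1]) ?_
  · refine key.trans_eq (lintegral_congr fun s => ?_)
    exact he.lintegral_comp (hh.comp measurable_prodMk_left)
  · intro x y hx hx' hy hy'
    simpa using hfgh (e x) (e y) hx hx' hy hy'

lemma averagedPrekopaLeindler_pi {ν : Measure ℝ} [SFinite ν]
    (hν : ∀ᵐ s ∂ν, s ∈ Set.Icc (0 : ℝ) 1) (n : ℕ) : AveragedPrekopaLeindler ν (Fin n → ℝ) := by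
  induction n with
  | zero =>
    intro f g h hf hg hh hf1 hg1 hfgh
    have hd : (volume : Measure (Fin 0 → ℝ)) = Measure.dirac 0 := by
      rw [volume_pi, Measure.pi_of_empty _ 0]
    rw [hd, lintegral_dirac' _ hf] at hf1
    rw [hd, lintegral_dirac' _ hg] at hg1
    have := hfgh 0 0 (hf1.trans_ne one_ne_zero) (hf1.trans_ne ENNReal.one_ne_top)
      (hg1.trans_ne one_ne_zero) (hg1.trans_ne ENNReal.one_ne_top)
    simp only [hf1, hg1, ENNReal.one_rpow, mul_one] at this
    refine this.trans_eq (lintegral_congr fun s => ?_)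
    have hhs : Measurable (h s) := hh.comp measurable_prodMk_left
    rw [hd, lintegral_dirac' _ hhs]
    congr 1
    exact Subsingleton.elim _ _
  | succ n ih =>
    have hp := (volume_preserving_piFinSuccAbove (fun _ : Fin (n + 1) => ℝ) 0).symm
    let e : (ℝ × (Fin n → ℝ)) →ₗ[ℝ] (Fin (n + 1) → ℝ) :=
      (Fin.consLinearEquiv ℝ (fun _ => ℝ)).toLinearMap
    refine ((averagedPrekopaLeindler_real hν).prod ih).of_measurePreserving e ?_
    have he : ⇑e = ⇑(MeasurableEquiv.piFinSuccAbove (fun _ : Fin (n + 1) => ℝ) 0).symm := by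
      funext p
      exact (Fin.insertNth_zero (α := fun _ : Fin (n + 1) => ℝ) p.1 p.2).symm
    rw [he]
    exact hp

lemma averagedPrekopaLeindler_euclideanSpace {ν : Measure ℝ} [SFinite ν]
    (hν : ∀ᵐ s ∂ν, s ∈ Set.Icc (0 : ℝ) 1) (n : ℕ) :
    AveragedPrekopaLeindler ν (EuclideanSpace ℝ (Fin n)) :=
  (averagedPrekopaLeindler_pi hν n).of_measurePreserving
    (WithLp.linearEquiv 2 ℝ (Fin n → ℝ)).symm.toLinearMap
    (PiLp.volume_preserving_toLp (Fin n))

/-- The restriction of a polynomial to the line through two points. -/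
lemma exists_polynomial_eval_segment {n d : ℕ} {P : MvPolynomial (Fin n) ℝ}
    (hPd : P.totalDegree ≤ d) (x y : EuclideanSpace ℝ (Fin n)) :
    ∃ p : Polynomial ℝ, p.natDegree ≤ d ∧ ∀ s : ℝ,
      p.eval s = MvPolynomial.eval (fun i => (s • x + (1 - s) • y) i) P := by
  refine ⟨MvPolynomial.aeval
    (fun i => Polynomial.C (x i - y i) * Polynomial.X + Polynomial.C (y i)) P, ?_, fun s => ?_⟩
  · refine (MvPolynomial.aeval_natDegree_le P hPd _ (n := 1) fun i => ?_).trans_eq (mul_one d)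
    exact Polynomial.natDegree_linear_le
  · have : (Polynomial.evalRingHom s).comp (MvPolynomial.aeval (R := ℝ) fun i =>
        Polynomial.C (x i - y i) * Polynomial.X + Polynomial.C (y i)).toRingHom =
        MvPolynomial.eval (fun i => (s • x + (1 - s) • y) i) := by
      ext i
      · simp
      · simp; ring
    exact congrArg (fun φ => φ P) this

/-- On a segment of a convex set, a polynomial which is very large at one end point is large
at most of the points. -/
lemma le_volume_segment {n d : ℕ} {P : MvPolynomial (Fin n) ℝ} (hPd : P.totalDegree ≤ d)
    {F : Set (EuclideanSpace ℝ (Fin n))} (hF : Convex ℝ F) {M m σ : ℝ} (hm : 0 < m)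
    (hσ1 : σ ≤ 1) {x y : EuclideanSpace ℝ (Fin n)} (hx : x ∈ F) (hy : y ∈ F)
    (hPx : (4 / m) ^ d * M < |MvPolynomial.eval (fun i => x i) P|) :
    ENNReal.ofReal (σ - m) ≤ volume.restrict (Set.Icc 0 σ)
      {s : ℝ | s • x + (1 - s) • y ∈
        {z ∈ F | M ≤ |MvPolynomial.eval (fun i => z i) P|}} := by
  obtain ⟨p, hpd, hp⟩ := exists_polynomial_eval_segment hPd x y
  set Z : Set ℝ := Set.Icc 0 1 ∩ {s | |p.eval s| ≤ M} with hZdef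
  have hZ : IsCompact Z := isCompact_Icc.inter_right
    (isClosed_le p.continuous.abs continuous_const)
  have hZm : volume Z ≤ ENNReal.ofReal m := by
    by_contra h
    have h1 := remez_endpoint hpd hZ Set.inter_subset_left hm (not_le.1 h) (fun s hs => hs.2)
    rw [hp 1] at h1
    simp only [one_smul, sub_self, zero_smul, add_zero] at h1
    exact absurd h1 (not_le.2 hPx)
  set S : Set ℝ := {s : ℝ | s • x + (1 - s) • y ∈
        {z ∈ F | M ≤ |MvPolynomial.eval (fun i => z i) P|}} with hS
  have hcover : Set.Icc 0 σ ⊆ (S ∩ Set.Icc 0 σ) ∪ Z := by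
    intro s hs
    by_cases h : |p.eval s| ≤ M
    · exact Or.inr ⟨⟨hs.1, hs.2.trans hσ1⟩, h⟩
    · refine Or.inl ⟨⟨hF hx hy hs.1 (by linarith [hs.2]) (by ring), ?_⟩, hs⟩
      rw [← hp s]
      exact (not_le.1 h).le
  have h2 : ENNReal.ofReal σ ≤ volume (S ∩ Set.Icc 0 σ) + ENNReal.ofReal m :=
    calc ENNReal.ofReal σ = volume (Set.Icc 0 σ) := by simp
      _ ≤ volume ((S ∩ Set.Icc 0 σ) ∪ Z) := measure_mono hcover
      _ ≤ volume (S ∩ Set.Icc 0 σ) + volume Z := measure_union_le _ _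
      _ ≤ _ := by gcongr
  rw [ENNReal.ofReal_sub _ hm.le, Measure.restrict_apply' measurableSet_Icc]
  exact tsub_le_iff_right.2 h2

lemma lintegral_ofReal_exp_mul_Icc {a σ : ℝ} (ha : 0 < a) (hσ : 0 ≤ σ) :
    ∫⁻ s in Set.Icc 0 σ, ENNReal.ofReal (Real.exp (a * s)) =
      ENNReal.ofReal (a⁻¹ * (Real.exp (a * σ) - 1)) := by
  have hc : Continuous fun s : ℝ => Real.exp (a * s) := by fun_prop
  rw [← ofReal_integral_eq_lintegral_ofReal
    (hc.continuousOn.integrableOn_compact isCompact_Icc)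
    (ae_of_all _ fun s => (Real.exp_pos _).le),
    integral_Icc_eq_integral_Ioc, ← intervalIntegral.integral_of_le hσ,
    intervalIntegral.integral_comp_mul_left _ ha.ne', integral_exp]
  simp

/-- Exponential tail of a polynomial on a convex body: it exceeds `(4eL)^d` times the threshold
`M` with probability at most `e^{-L}`. -/
theorem volume_lt_abs_eval_le_exp {n d : ℕ} {P : MvPolynomial (Fin n) ℝ}
    (hPd : P.totalDegree ≤ d) {F : Set (EuclideanSpace ℝ (Fin n))} (hFm : IsClosed F)
    (hF : Convex ℝ F) (hFvol : volume F = 1) {M : ℝ} (hM : 0 < M)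
    (hMdef : volume {x ∈ F | M ≤ |MvPolynomial.eval (fun i => x i) P|} =
      ENNReal.ofReal (Real.exp (-1))) {L : ℝ} (hL : 1 ≤ L) :
    volume {x ∈ F | (4 * Real.exp 1 * L) ^ d * M < |MvPolynomial.eval (fun i => x i) P|} ≤
      ENNReal.ofReal (Real.exp (-L)) := by
  have hc : Continuous fun x : EuclideanSpace ℝ (Fin n) =>
      |MvPolynomial.eval (fun i => x i) P| :=
    (P.continuous_eval.comp (by fun_prop)).abs
  set E : Set (EuclideanSpace ℝ (Fin n)) :=
    {x ∈ F | M ≤ |MvPolynomial.eval (fun i => x i) P|} with hE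
  set A : Set (EuclideanSpace ℝ (Fin n)) :=
    {x ∈ F | (4 * Real.exp 1 * L) ^ d * M < |MvPolynomial.eval (fun i => x i) P|} with hA
  have hEm : MeasurableSet E :=
    hFm.measurableSet.inter (isClosed_le continuous_const hc).measurableSet
  have hAm : MeasurableSet A :=
    hFm.measurableSet.inter (isOpen_lt continuous_const hc).measurableSet
  have he1 : 2 ≤ Real.exp 1 := by linarith [Real.add_one_le_exp 1]
  have hAE : A ⊆ E := fun x hx => ⟨hx.1, (hx.2.trans_le' (le_mul_of_one_le_left hM.le
    (one_le_pow₀ (by nlinarith)))).le⟩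
  by_contra hcon
  rw [not_le] at hcon
  have hA1 : volume A ≤ ENNReal.ofReal (Real.exp (-1)) := hMdef ▸ measure_mono hAE
  obtain ⟨L', hL'⟩ : ∃ L' : ℝ, volume A = ENNReal.ofReal (Real.exp (-L')) := by
    have hfin : volume A ≠ ⊤ := ne_top_of_le_ne_top ENNReal.ofReal_ne_top hA1
    refine ⟨-Real.log (volume A).toReal, ?_⟩
    rw [neg_neg, Real.exp_log (ENNReal.toReal_pos hcon.ne_bot hfin), ENNReal.ofReal_toReal hfin]
  rw [hL'] at hA1 hcon
  have hL'1 : 1 ≤ L' := by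
    have := (ENNReal.ofReal_le_ofReal_iff (Real.exp_pos _).le).1 hA1
    linarith [Real.exp_le_exp.1 this]
  have hL'L : L' < L := by
    have := (ENNReal.ofReal_lt_ofReal_iff (Real.exp_pos _)).1 hcon
    linarith [Real.exp_lt_exp.1 this]
  set σ : ℝ := L'⁻¹ with hσ
  have hσ0 : 0 < σ := by positivity
  have hσ1 : σ ≤ 1 := inv_le_one_of_one_le₀ hL'1
  set m : ℝ := (Real.exp 1 * L)⁻¹ with hmdef
  have hm : 0 < m := by positivity
  have hmσ : Real.exp 1 * m < σ := by
    rw [hmdef, mul_inv, mul_inv_cancel_left₀ (Real.exp_pos 1).ne']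
    exact inv_strictAnti₀ (by linarith) hL'L
  have hσm : 0 < σ - m := by nlinarith
  have h4m : 4 / m = 4 * Real.exp 1 * L := by rw [hmdef, div_inv_eq_mul, mul_assoc]
  have key := averagedPrekopaLeindler_euclideanSpace (ν := volume.restrict (Set.Icc 0 σ))
    ((ae_restrict_mem measurableSet_Icc).mono fun s hs => ⟨hs.1, hs.2.trans hσ1⟩) n
    (A.indicator fun _ => ENNReal.ofReal (Real.exp L')) (F.indicator fun _ => 1)
    (fun s z => ENNReal.ofReal (σ - m)⁻¹ * ENNReal.ofReal (Real.exp (L' * s)) *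
      E.indicator (fun _ => 1) z)
    (measurable_const.indicator hAm) (measurable_const.indicator hFm.measurableSet) ?_ ?_ ?_ ?_
  · have : ∀ s, ∫⁻ z, ENNReal.ofReal (σ - m)⁻¹ * ENNReal.ofReal (Real.exp (L' * s)) *
        E.indicator (fun _ => 1) z ∂(volume : Measure (EuclideanSpace ℝ (Fin n))) =
        ENNReal.ofReal (σ - m)⁻¹ * ENNReal.ofReal (Real.exp (-1)) *
          ENNReal.ofReal (Real.exp (L' * s)) := by
      intro s
      rw [lintegral_const_mul _ (measurable_const.indicator hEm), lintegral_indicator hEm,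
        setLIntegral_one, hMdef]
      ring
    simp only [this] at key
    rw [lintegral_const_mul _ (by fun_prop), lintegral_ofReal_exp_mul_Icc (by linarith) hσ0.le,
      ← ENNReal.ofReal_mul (by positivity), ← ENNReal.ofReal_mul (by positivity),
      ENNReal.one_le_ofReal, hσ, mul_inv_cancel₀ (by linarith), ← hσ, mul_assoc,
      inv_mul_eq_div, one_le_div hσm, Real.exp_neg] at key
    have h3 : (Real.exp 1)⁻¹ * (σ * (Real.exp 1 - 1)) = σ - (Real.exp 1)⁻¹ * σ := by
      field_simp
    have h4 : m < (Real.exp 1)⁻¹ * σ := by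
      rw [inv_mul_eq_div, lt_div_iff₀ (Real.exp_pos 1)]
      linarith
    linarith
  · refine Measurable.mul (by fun_prop) ?_
    exact (measurable_const.indicator hEm).comp measurable_snd
  · rw [lintegral_indicator hAm, setLIntegral_const, hL', ← ENNReal.ofReal_mul (by positivity),
      ← Real.exp_add]
    simp
  · rw [lintegral_indicator hFm.measurableSet, setLIntegral_one, hFvol]
  · intro x y hx _ hy _
    have hxA : x ∈ A := Set.mem_of_indicator_ne_zero hx
    have hyF : y ∈ F := Set.mem_of_indicator_ne_zero hy
    rw [Set.indicator_of_mem hxA, Set.indicator_of_mem hyF]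
    have hseg := le_volume_segment hPd hF (M := M) hm hσ1 hxA.1 hyF (h4m ▸ hxA.2)
    set S : Set ℝ := {s : ℝ | s • x + (1 - s) • y ∈ E} with hS
    have hSm : MeasurableSet S := hEm.preimage (by fun_prop)
    have : ∀ s : ℝ, ENNReal.ofReal (σ - m)⁻¹ * ENNReal.ofReal (Real.exp (L' * s)) *
        E.indicator (fun _ => 1) (s • x + (1 - s) • y) *
        (ENNReal.ofReal (Real.exp L') ^ (-s) * 1 ^ (-(1 - s))) =
        ENNReal.ofReal (σ - m)⁻¹ * S.indicator (fun _ => 1) s := by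
      intro s
      have h5 : ENNReal.ofReal (Real.exp (L' * s)) * ENNReal.ofReal (Real.exp L') ^ (-s) = 1 := by
        rw [ENNReal.ofReal_rpow_of_pos (Real.exp_pos _), ← Real.exp_mul,
          ← ENNReal.ofReal_mul (Real.exp_pos _).le, ← Real.exp_add]
        simp
      have h6 : E.indicator (fun _ => (1 : ENNReal)) (s • x + (1 - s) • y) =
        S.indicator (fun _ => 1) s := rfl
      rw [h6, ENNReal.one_rpow, mul_one]
      calc _ = ENNReal.ofReal (σ - m)⁻¹ * S.indicator (fun _ => 1) s *
          (ENNReal.ofReal (Real.exp (L' * s)) * ENNReal.ofReal (Real.exp L') ^ (-s)) := by ring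
        _ = _ := by rw [h5, mul_one]
    simp only [this]
    rw [lintegral_const_mul _ (measurable_const.indicator hSm), lintegral_indicator hSm,
      setLIntegral_one]
    calc (1 : ENNReal) = ENNReal.ofReal (σ - m)⁻¹ * ENNReal.ofReal (σ - m) := by
          rw [← ENNReal.ofReal_mul (by positivity), inv_mul_cancel₀ hσm.ne', ENNReal.ofReal_one]
      _ ≤ _ := by gcongr

lemma ofReal_mul_lintegral_Ioc_rpow {p c : ℝ} (hp : 0 < p) (hc : 0 ≤ c) :
    ENNReal.ofReal p * ∫⁻ t in Set.Ioc 0 c, ENNReal.ofReal (t ^ (p - 1)) =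
      ENNReal.ofReal (c ^ p) := by
  have hint := intervalIntegral.intervalIntegrable_rpow' (a := 0) (b := c) (r := p - 1)
    (by linarith)
  rw [← ofReal_integral_eq_lintegral_ofReal hint.1
    ((ae_restrict_mem measurableSet_Ioc).mono fun t ht => Real.rpow_nonneg ht.1.le _),
    ← intervalIntegral.integral_of_le hc, integral_rpow (Or.inl (by linarith)),
    ← ENNReal.ofReal_mul hp.le]
  congr 1
  rw [sub_add_cancel, Real.zero_rpow hp.ne', sub_zero]
  field_simp

lemma rpow_mul_exp_neg_le {p t : ℝ} (hp : 1 ≤ p) (ht : 0 < t) :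
    p * (t ^ (p - 1) * Real.exp (-t)) ≤
      p ^ p * Real.exp (1 - p) * Real.exp (-p⁻¹ * t) := by
  have hp0 : 0 < p := by linarith
  have h1 : t / p ≤ Real.exp (t / p - 1) := by linarith [Real.add_one_le_exp (t / p - 1)]
  have h2 : (t / p) ^ (p - 1) ≤ Real.exp ((t / p - 1) * (p - 1)) := by
    rw [Real.exp_mul]
    exact Real.rpow_le_rpow (by positivity) h1 (by linarith)
  rw [Real.div_rpow ht.le hp0.le, div_le_iff₀ (by positivity)] at h2
  calc p * (t ^ (p - 1) * Real.exp (-t))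
      ≤ p * (Real.exp ((t / p - 1) * (p - 1)) * p ^ (p - 1) * Real.exp (-t)) := by gcongr
    _ = (p * p ^ (p - 1)) * (Real.exp ((t / p - 1) * (p - 1)) * Real.exp (-t)) := by ring
    _ = p ^ p * (Real.exp (1 - p) * Real.exp (-p⁻¹ * t)) := by
      rw [← Real.exp_add, ← Real.exp_add]
      congr 2
      · rw [Real.rpow_sub_one hp0.ne']
        field_simp
      · field_simp
        ring
    _ = _ := by ring

/-- Moments of a function with exponential tails. -/
lemma lintegral_rpow_le_of_tail {Ω : Type*} [MeasurableSpace Ω] {μ : Measure Ω}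
    [IsProbabilityMeasure μ] {V : Ω → ℝ} (hV : Measurable V) (hV0 : ∀ ω, 0 ≤ V ω) {b p : ℝ}
    (hb : 0 ≤ b) (hp : 1 ≤ p)
    (h1 : ∀ t, b < t → t ≤ 1 → μ {ω | t < V ω} ≤ ENNReal.ofReal (Real.exp (-1)))
    (h2 : ∀ t, 1 < t → μ {ω | t < V ω} ≤ ENNReal.ofReal (Real.exp (-t))) :
    ∫⁻ ω, ENNReal.ofReal (V ω ^ p) ∂μ ≤ ENNReal.ofReal
      (b ^ p + Real.exp (-1) + p ^ p * Real.exp (1 - p) * (p * Real.exp (-p⁻¹))) := by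
  have hp0 : 0 < p := by linarith
  have hm : Measurable fun t : ℝ => ENNReal.ofReal (t ^ (p - 1)) := by fun_prop
  rw [lintegral_rpow_eq_lintegral_meas_lt_mul μ (ae_of_all _ hV0) hV.aemeasurable hp0]
  have hsub : Set.Ioi (0 : ℝ) ⊆ Set.Ioc 0 b ∪ (Set.Ioc (max b 0) 1 ∪ Set.Ioi 1) := by
    intro t ht
    by_cases h : t ≤ b
    · exact Or.inl ⟨ht, h⟩
    · by_cases h' : t ≤ 1
      · exact Or.inr (Or.inl ⟨max_lt (not_le.1 h) ht, h'⟩)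
      · exact Or.inr (Or.inr (not_le.1 h'))
  have hA : ENNReal.ofReal p * ∫⁻ t in Set.Ioc 0 b,
      μ {ω | t < V ω} * ENNReal.ofReal (t ^ (p - 1)) ≤ ENNReal.ofReal (b ^ p) := by
    rw [← ofReal_mul_lintegral_Ioc_rpow hp0 hb]
    gcongr with t
    exact mul_le_of_le_one_left' prob_le_one
  have hB : ENNReal.ofReal p * ∫⁻ t in Set.Ioc (max b 0) 1,
      μ {ω | t < V ω} * ENNReal.ofReal (t ^ (p - 1)) ≤ ENNReal.ofReal (Real.exp (-1)) := by
    calc ENNReal.ofReal p * ∫⁻ t in Set.Ioc (max b 0) 1,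
          μ {ω | t < V ω} * ENNReal.ofReal (t ^ (p - 1))
        ≤ ENNReal.ofReal p * ∫⁻ t in Set.Ioc (max b 0) 1,
          ENNReal.ofReal (Real.exp (-1)) * ENNReal.ofReal (t ^ (p - 1)) := by
          refine mul_le_mul_right (setLIntegral_mono (by fun_prop) fun t ht => ?_) _
          exact mul_le_mul_left (h1 t ((le_max_left b 0).trans_lt ht.1) ht.2) _
      _ ≤ ENNReal.ofReal p * ∫⁻ t in Set.Ioc 0 1,
          ENNReal.ofReal (Real.exp (-1)) * ENNReal.ofReal (t ^ (p - 1)) := by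
          refine mul_le_mul_right (lintegral_mono_set ?_) _
          exact Set.Ioc_subset_Ioc_left (le_max_right b 0)
      _ = ENNReal.ofReal (Real.exp (-1)) := by
          rw [lintegral_const_mul _ hm, mul_left_comm,
            ofReal_mul_lintegral_Ioc_rpow hp0 zero_le_one, Real.one_rpow, ENNReal.ofReal_one,
            mul_one]
  have hC : ENNReal.ofReal p * ∫⁻ t in Set.Ioi 1,
      μ {ω | t < V ω} * ENNReal.ofReal (t ^ (p - 1)) ≤
      ENNReal.ofReal (p ^ p * Real.exp (1 - p) * (p * Real.exp (-p⁻¹))) := by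
    have hneg : -p⁻¹ < 0 := by simpa using hp0
    calc ENNReal.ofReal p * ∫⁻ t in Set.Ioi 1,
          μ {ω | t < V ω} * ENNReal.ofReal (t ^ (p - 1))
        ≤ ∫⁻ t in Set.Ioi 1, ENNReal.ofReal
            (p ^ p * Real.exp (1 - p) * Real.exp (-p⁻¹ * t)) := by
          rw [← lintegral_const_mul' _ _ ENNReal.ofReal_ne_top]
          refine setLIntegral_mono (by fun_prop) fun t ht => ?_
          have ht0 : (0 : ℝ) < t := zero_lt_one.trans ht
          refine le_trans ?_ (ENNReal.ofReal_le_ofReal (rpow_mul_exp_neg_le hp ht0))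
          rw [ENNReal.ofReal_mul hp0.le, ENNReal.ofReal_mul (by positivity),
            mul_comm (ENNReal.ofReal (t ^ (p - 1)))]
          exact mul_le_mul_right (mul_le_mul_left (h2 t ht) _) _
      _ = _ := by
          rw [← ofReal_integral_eq_lintegral_ofReal
            ((integrableOn_exp_mul_Ioi hneg 1).const_mul _)
            (ae_of_all _ fun t => by positivity), integral_const_mul,
            integral_exp_mul_Ioi hneg]
          congr 2
          field_simp
  calc ENNReal.ofReal p * ∫⁻ t in Set.Ioi 0, μ {ω | t < V ω} * ENNReal.ofReal (t ^ (p - 1))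
      ≤ ENNReal.ofReal p * ((∫⁻ t in Set.Ioc 0 b, μ {ω | t < V ω} * ENNReal.ofReal (t ^ (p - 1)))
        + ((∫⁻ t in Set.Ioc (max b 0) 1, μ {ω | t < V ω} * ENNReal.ofReal (t ^ (p - 1)))
        + ∫⁻ t in Set.Ioi 1, μ {ω | t < V ω} * ENNReal.ofReal (t ^ (p - 1)))) := by
        refine mul_le_mul_right ((lintegral_mono_set hsub).trans ?_) _
        refine (lintegral_union_le _ _ _).trans ?_
        gcongr
        exact lintegral_union_le _ _ _
    _ ≤ _ := by
        rw [mul_add, mul_add, ENNReal.ofReal_add (by positivity) (by positivity),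
          ENNReal.ofReal_add (by positivity) (by positivity), ← add_assoc]
        gcongr

lemma exponential_moment_bound {p : ℝ} (hp : 1 ≤ p) :
    (4 * Real.exp 1)⁻¹ ^ p + Real.exp (-1) +
      p ^ p * Real.exp (1 - p) * (p * Real.exp (-p⁻¹)) ≤ (3 * p / Real.exp 1) ^ p := by
  have hp0 : 0 < p := by linarith
  set e := Real.exp 1 with he
  have he0 : 0 < e := Real.exp_pos 1
  have he3 : e ≤ 3 := by linarith [Real.exp_one_lt_d9]
  have hpp : 1 ≤ p ^ p := Real.one_le_rpow hp hp0.le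
  have h1 : (4 * e)⁻¹ ^ p ≤ (4 * e)⁻¹ := by
    have : (4 * e)⁻¹ ≤ 1 := inv_le_one_of_one_le₀ (by linarith [Real.add_one_le_exp 1])
    simpa using Real.rpow_le_rpow_of_exponent_ge (by positivity) this hp
  have h2 : Real.exp (1 - p) * (p * Real.exp (-p⁻¹)) ≤ 4 / 3 / e := by
    set y := p - 1 + p⁻¹ with hy
    have hy1 : p * y = p ^ 2 - p + 1 := by rw [hy]; field_simp
    have h3 : e * y ≤ Real.exp y := by
      have := Real.add_one_le_exp (y - 1)
      rw [Real.exp_sub, le_div_iff₀ he0] at this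
      linarith
    have h4 : Real.exp (1 - p) * (p * Real.exp (-p⁻¹)) = p / Real.exp y := by
      rw [mul_left_comm, ← Real.exp_add, div_eq_mul_inv, ← Real.exp_neg]
      congr 2
      rw [hy]; ring
    rw [h4, div_div, div_le_div_iff₀ (Real.exp_pos _) (by positivity)]
    have h5 : 3 * p ≤ 4 * y := by
      have : p * (3 * p) ≤ p * (4 * y) := by nlinarith [sq_nonneg (p - 2)]
      exact le_of_mul_le_mul_left this hp0
    nlinarith
  have h6 : 3 / e ≤ (3 / e) ^ p := by
    simpa using Real.rpow_le_rpow_of_exponent_le ((one_le_div he0).2 he3) hp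
  have h7 : (3 * p / e) ^ p = p ^ p * (3 / e) ^ p := by
    rw [← Real.mul_rpow hp0.le (by positivity)]
    congr 1
    ring
  have h8 : (4 * e)⁻¹ + e⁻¹ ≤ p ^ p * ((4 * e)⁻¹ + e⁻¹) :=
    le_mul_of_one_le_left (by positivity) hpp
  have h9 : (4 * e)⁻¹ + e⁻¹ + 4 / 3 / e ≤ 3 / e := by
    have : (4 * e)⁻¹ + e⁻¹ + 4 / 3 / e = (31 / 12) / e := by field_simp; norm_num
    rw [this]
    gcongr
    norm_num
  rw [Real.exp_neg, ← he, h7, mul_assoc]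
  calc (4 * e)⁻¹ ^ p + e⁻¹ + p ^ p * (Real.exp (1 - p) * (p * Real.exp (-p⁻¹)))
      ≤ p ^ p * ((4 * e)⁻¹ + e⁻¹) + p ^ p * (4 / 3 / e) := by gcongr; linarith
    _ = p ^ p * ((4 * e)⁻¹ + e⁻¹ + 4 / 3 / e) := by ring
    _ ≤ p ^ p * (3 / e) ^ p := by gcongr; linarith

/-- `L^q` estimate: `‖P‖_{L^q(F)} ≤ (12qd)^d M(P)` for every `q ≥ 1/d`. -/
theorem Lq_estimate {n : ℕ} (d : ℕ) (P : MvPolynomial (Fin n) ℝ)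
    (hPd : P.totalDegree ≤ d) (hPnc : ∀ c : ℝ, P ≠ MvPolynomial.C c)
    (F : Set (EuclideanSpace ℝ (Fin n))) (hFcomp : IsCompact F) (hFconv : Convex ℝ F)
    (hFvol : volume F = 1)
    (M : ℝ) (hM : 0 < M)
    (hMdef : volume {x ∈ F | M ≤ |MvPolynomial.eval (fun i => x i) P|} =
      ENNReal.ofReal (Real.exp (-1)))
    (q : ℝ) (hq : 1 / (d : ℝ) ≤ q) :
    (∫ x in F, |MvPolynomial.eval (fun i => x i) P| ^ q) ^ (1 / q) ≤
      (12 * q * d) ^ d * M := by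
  have hd : 0 < d := by
    refine Nat.pos_of_ne_zero fun h => ?_
    subst h
    exact hPnc _ (MvPolynomial.totalDegree_eq_zero_iff_eq_C.1 (Nat.le_zero.1 hPd))
  have hd0 : (0 : ℝ) < d := Nat.cast_pos.2 hd
  have hq0 : 0 < q := (by positivity : (0 : ℝ) < 1 / d).trans_le hq
  have hp : 1 ≤ q * d := (div_le_iff₀ hd0).1 hq
  set p := q * d with hpdef
  have hp0 : 0 < p := by linarith
  set w : EuclideanSpace ℝ (Fin n) → ℝ := fun x => |MvPolynomial.eval (fun i => x i) P| with hw
  have hwc : Continuous w := (P.continuous_eval.comp (by fun_prop)).abs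
  have hw0 : ∀ x, 0 ≤ w x := fun x => abs_nonneg _
  set B := 4 * Real.exp 1 with hB
  have hB0 : 0 < B := by positivity
  have hprob : IsProbabilityMeasure (volume.restrict F) := ⟨by simp [hFvol]⟩
  set V : EuclideanSpace ℝ (Fin n) → ℝ := fun x => (w x / M) ^ (1 / (d : ℝ)) / B with hV
  have hV0 : ∀ x, 0 ≤ V x := fun x =>
    div_nonneg (Real.rpow_nonneg (div_nonneg (hw0 x) hM.le) _) hB0.le
  have hVm : Measurable V := by
    have := hwc.measurable
    fun_prop
  have hwV : ∀ x, w x = (B * V x) ^ d * M := fun x => by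
    have hwM : 0 ≤ w x / M := div_nonneg (hw0 x) hM.le
    simp only [hV]
    rw [mul_div_cancel₀ _ hB0.ne', one_div, Real.rpow_inv_natCast_pow hwM hd.ne',
      div_mul_cancel₀ _ hM.ne']
  have hwVq : ∀ x, w x ^ q = (B ^ p * M ^ q) * V x ^ p := fun x => by
    have hBV : 0 ≤ B * V x := mul_nonneg hB0.le (hV0 x)
    rw [hwV x, Real.mul_rpow (by positivity) hM.le, ← Real.rpow_natCast_mul hBV,
      mul_comm (d : ℝ) q, ← hpdef, Real.mul_rpow hB0.le (hV0 x)]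
    ring
  have htail : ∀ t : ℝ, 0 ≤ t → (volume.restrict F) {x | t < V x} ≤
      volume {x ∈ F | (B * t) ^ d * M < w x} := fun t ht => by
    rw [Measure.restrict_apply' hFcomp.isClosed.measurableSet]
    refine measure_mono fun x hx => ⟨hx.2, ?_⟩
    rw [hwV x]
    have := hx.1.out
    gcongr
  have hmom := lintegral_rpow_le_of_tail (μ := volume.restrict F) hVm hV0
    (inv_nonneg.2 hB0.le) hp (fun t hbt _ => ?_) (fun t ht => ?_)
  · have hint : ∫ x in F, w x ^ q ≤ ((12 * q * d) ^ d * M) ^ q := by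
      rw [integral_eq_lintegral_of_nonneg_ae (ae_of_all _ fun x => Real.rpow_nonneg (hw0 x) q)
        (hwc.rpow_const fun _ => Or.inr hq0.le).aestronglyMeasurable]
      refine ENNReal.toReal_le_of_le_ofReal (by positivity) ?_
      have hc0 : 0 ≤ B ^ p * M ^ q := by positivity
      simp only [hwVq, ENNReal.ofReal_mul hc0]
      rw [lintegral_const_mul _ (by fun_prop)]
      calc _ ≤ ENNReal.ofReal (B ^ p * M ^ q) *
            ENNReal.ofReal ((3 * p / Real.exp 1) ^ p) := by
            refine mul_le_mul_right (hmom.trans (ENNReal.ofReal_le_ofReal ?_)) _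
            exact exponential_moment_bound hp
        _ = _ := by
            rw [← ENNReal.ofReal_mul hc0, Real.mul_rpow (by positivity) hM.le,
              ← Real.rpow_natCast_mul (by positivity), mul_comm (d : ℝ) q, ← hpdef,
              mul_right_comm, ← Real.mul_rpow hB0.le (by positivity)]
            congr 3
            rw [hB, mul_assoc 12 q, ← hpdef]
            field_simp
            norm_num
    calc _ ≤ (((12 * q * d) ^ d * M) ^ q) ^ (1 / q) :=
          Real.rpow_le_rpow (integral_nonneg fun x => Real.rpow_nonneg (hw0 x) q) hint
            (by positivity)
      _ = _ := by
          rw [one_div, Real.rpow_rpow_inv (by positivity) hq0.ne']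
  · have ht0 : 0 < t := (inv_pos.2 hB0).trans hbt
    refine (htail t ht0.le).trans (hMdef ▸ measure_mono fun x hx => ⟨hx.1, ?_⟩)
    have hBt : 1 ≤ B * t := ((inv_lt_iff_one_lt_mul₀' hB0).1 hbt).le
    exact (hx.2.trans_le' (le_mul_of_one_le_left hM.le (one_le_pow₀ hBt))).le
  · exact (htail t (by linarith)).trans
      (volume_lt_abs_eval_le_exp hPd hFcomp.isClosed hFconv hFvol hM hMdef ht.le)
end
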